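/- arXiv:2604.21619 — 2 statements merged into one kernel-verified Lean document; each statement's English description precedes it below -/
import Mathlib

section
/- Suppose the characteristic of F is not 2 and 2 ≤ n ≤ 4. Then the descent algebra D_F(B_n) has finite representation type: there are, up to isomorphism, only finitely many indecomposable D_F(B_n)-modules that are finite-dimensional over F. That is, there exists a finite family of D_F(B_n)-modules such that every finite-dimensional indecomposable D_F(B_n)-module is isomorphic to a member of the family. -/
set_option maxHeartbeats 1000000
set_option synthInstance.maxHeartbeats 1000000

/-- Coxeter matrix of type Bₙ, with the 4-bond between the simple reflections indexed 0 and 1,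
and 3-bonds between consecutive indices. -/
def BMat (n : ℕ) : CoxeterMatrix (Fin n) where
  M := Matrix.of fun i j : Fin n =>
    if i = j then 1
    else if min (i : ℕ) (j : ℕ) = 0 ∧ max (i : ℕ) (j : ℕ) = 1 then 4
    else if max (i : ℕ) (j : ℕ) = min (i : ℕ) (j : ℕ) + 1 then 3 else 2
  isSymm := by
    unfold Matrix.IsSymm
    ext i j
    simp only [Matrix.transpose_apply, Matrix.of_apply]
    rcases eq_or_ne i j with rfl | h
    · simp
    · rw [if_neg h, if_neg (Ne.symm h), min_comm (j : ℕ) (i : ℕ), max_comm (j : ℕ) (i : ℕ)]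
  diagonal := by simp
  off_diagonal := by
    intro i j h
    simp only [Matrix.of_apply, if_neg h]
    split_ifs <;> omega

/-- Coxeter matrix of type Dₙ: the simple reflections indexed 0 and 1 each have a 3-bond with
the one indexed 2, consecutive indices from 2 on have 3-bonds, and all other pairs commute. -/
def DMat (n : ℕ) : CoxeterMatrix (Fin n) where
  M := Matrix.of fun i j : Fin n =>
    if i = j then 1
    else if min (i : ℕ) (j : ℕ) = 0 ∧ max (i : ℕ) (j : ℕ) = 2 then 3
    else if 1 ≤ min (i : ℕ) (j : ℕ) ∧ max (i : ℕ) (j : ℕ) = min (i : ℕ) (j : ℕ) + 1 then 3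
    else 2
  isSymm := by
    unfold Matrix.IsSymm
    ext i j
    simp only [Matrix.transpose_apply, Matrix.of_apply]
    rcases eq_or_ne i j with rfl | h
    · simp
    · rw [if_neg h, if_neg (Ne.symm h), min_comm (j : ℕ) (i : ℕ), max_comm (j : ℕ) (i : ℕ)]
  diagonal := by simp
  off_diagonal := by
    intro i j h
    simp only [Matrix.of_apply, if_neg h]
    split_ifs <;> omega

open Classical in
/-- The element `x_J = ∑_{w ∈ X_J} w` of the group algebra, where
`X_J = {w : ℓ(w sᵢ) > ℓ(w) for all i ∈ J}`. -/
noncomputable def descentElt (F : Type*) [Field F] {B W : Type*} [Group W] [Fintype W]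
    {M : CoxeterMatrix B} (cs : CoxeterSystem M W) (J : Set B) : MonoidAlgebra F W :=
  ∑ w : W, if ∀ i ∈ J, cs.length w < cs.length (w * cs.simple i)
    then MonoidAlgebra.of F W w else 0

/-- The descent algebra: the `F`-subalgebra of the group algebra generated by the `x_J`. -/
noncomputable def descentAlgebra (F : Type*) [Field F] {B W : Type*} [Group W] [Fintype W]
    {M : CoxeterMatrix B} (cs : CoxeterSystem M W) : Subalgebra F (MonoidAlgebra F W) :=
  Algebra.adjoin F (Set.range (descentElt F cs))

set_option maxHeartbeats 1000000
set_option synthInstance.maxHeartbeats 1000000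

set_option linter.unusedSectionVars false
namespace DescB

/-! ### Representation theory -/

/-- Multiplication table of a block: labels `0,1,2,3` are the idempotents `q, o, p, t`;
`4, 5, 6` are the arrows `a : o → p`, `b : o → q`, `x : t → p`. If `glued`, then `p = t`. -/
def tab (glued : Bool) (l l' : Fin 7) : Option (Fin 7) :=
  match l, l' with
  | 0, 0 => some 0
  | 1, 1 => some 1
  | 2, 2 => some 2
  | 3, 3 => some 3
  | 2, 4 => some 4
  | 4, 1 => some 4
  | 0, 5 => some 5
  | 5, 1 => some 5
  | 2, 6 => some 6
  | 6, 3 => some 6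
  | 2, 3 => if glued then some 2 else none
  | 3, 2 => if glued then some 3 else none
  | 3, 4 => if glued then some 4 else none
  | 3, 6 => if glued then some 6 else none
  | 6, 2 => if glued then some 6 else none
  | _, _ => none

/-- The generators `g k l` multiply according to the block tables and generate the algebra. -/
structure BlockAlg (F D : Type*) [Field F] [Ring D] [Algebra F D]
    (gl : Fin 3 → Bool) (g : Fin 3 → Fin 7 → D) : Prop where
  cross : ∀ k k' l l', k ≠ k' → g k l * g k' l' = 0
  mul : ∀ k l l', g k l * g k l' = ((tab (gl k) l l').elim 0 (g k))
  glue : ∀ k, gl k = true → g k 2 = g k 3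
  one : (1 : D) ∈ Submodule.span F (Set.range fun x : Fin 3 × Fin 7 => g x.1 x.2)
  gen : Algebra.adjoin F (Set.range fun x : Fin 3 × Fin 7 => g x.1 x.2) = ⊤

section Rep

variable {F D V : Type*} [Field F] [Ring D] [Algebra F D] [AddCommGroup V] [Module D V]
  [Module F V] [IsScalarTower F D V]

/-- `V` has a basis of at most four vectors permuted (up to zero) by the generators. -/
def Typed (F : Type*) [Field F] [Module F V] (g : Fin 3 → Fin 7 → D) : Prop :=
  ∃ m : ℕ, m ≤ 4 ∧ ∃ v : Fin m → V, LinearIndependent F v ∧ Submodule.span F (Set.range v) = ⊤ ∧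
    ∀ k l j, g k l • v j = 0 ∨ ∃ i, g k l • v j = v i

/-- Indecomposability as in the statement. -/
def Indec (D V : Type*) [Ring D] [AddCommGroup V] [Module D V] : Prop :=
  ∀ P Q : Submodule D V, P ⊓ Q = ⊥ → P ⊔ Q = ⊤ → P = ⊥ ∨ Q = ⊥

theorem stable_of_gen {g : Fin 3 → Fin 7 → D}
    (hgen : Algebra.adjoin F (Set.range fun x : Fin 3 × Fin 7 => g x.1 x.2) = ⊤)
    (S : Submodule F V) (hS : ∀ k l, ∀ y ∈ S, g k l • y ∈ S) (d : D) : ∀ y ∈ S, d • y ∈ S := by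
  have hd : d ∈ Algebra.adjoin F (Set.range fun x : Fin 3 × Fin 7 => g x.1 x.2) := by
    rw [hgen]; trivial
  induction hd using Algebra.adjoin_induction with
  | mem x hx =>
    obtain ⟨⟨k, l⟩, rfl⟩ := hx
    exact hS k l
  | algebraMap r =>
    intro y hy
    rw [algebraMap_smul]
    exact S.smul_mem r hy
  | add a b _ _ ha hb =>
    intro y hy
    rw [add_smul]
    exact S.add_mem (ha y hy) (hb y hy)
  | mul a b _ _ ha hb =>
    intro y hy
    rw [mul_smul]
    exact ha _ (hb y hy)

/-- The splitting criterion. -/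
theorem split {g : Fin 3 → Fin 7 → D}
    (hgen : Algebra.adjoin F (Set.range fun x : Fin 3 × Fin 7 => g x.1 x.2) = ⊤)
    (hV : Indec D V) {m : ℕ} (hm : m + 1 ≤ 4) (v : Fin (m + 1) → V) (φ : Fin (m + 1) → (V →ₗ[F] F))
    (hd : ∀ i j, φ i (v j) = if i = j then 1 else 0)
    (hv : ∀ k l j, g k l • v j = 0 ∨ ∃ i, g k l • v j = v i)
    (hφ : ∀ k l i, (∀ y, φ i (g k l • y) = 0) ∨ ∃ j, ∀ y, φ i (g k l • y) = φ j y) :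
    Typed (V := V) F g := by
  classical
  have hli : LinearIndependent F v := by
    rw [Fintype.linearIndependent_iff]
    intro c hc i
    have := congrArg (φ i) hc
    simpa [map_sum, hd] using this
  let S : Submodule D V :=
    { Submodule.span F (Set.range v) with
      smul_mem' := fun d y hy => by
        refine stable_of_gen (F := F) hgen (Submodule.span F (Set.range v)) ?_ d y hy
        intro k l y hy
        induction hy using Submodule.span_induction with
        | mem x hx =>
          obtain ⟨j, rfl⟩ := hx
          rcases hv k l j with h | ⟨i, h⟩
          · rw [h]; exact Submodule.zero_mem _
          · rw [h]; exact Submodule.subset_span ⟨i, rfl⟩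
        | zero => rw [smul_zero]; exact Submodule.zero_mem _
        | add a b _ _ ha hb => rw [smul_add]; exact Submodule.add_mem _ ha hb
        | smul c a _ ha =>
          have := smul_comm (M := F) (N := D) c (g k l) a
          rw [← this]
          exact Submodule.smul_mem _ _ ha }
  let K : Submodule D V :=
    { (⨅ i, LinearMap.ker (φ i) : Submodule F V) with
      smul_mem' := fun d y hy => by
        refine stable_of_gen (F := F) hgen (⨅ i, LinearMap.ker (φ i)) ?_ d y hy
        intro k l y hy
        simp only [Submodule.mem_iInf, LinearMap.mem_ker] at hy ⊢
        intro i
        rcases hφ k l i with h | ⟨j, h⟩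
        · exact h y
        · rw [h, hy] }
  have memS : ∀ y, y ∈ S ↔ y ∈ Submodule.span F (Set.range v) := fun y => Iff.rfl
  have memK : ∀ y, y ∈ K ↔ ∀ i, φ i y = 0 := fun y => by
    change y ∈ (⨅ i, LinearMap.ker (φ i) : Submodule F V) ↔ _
    simp
  have hbot : S ⊓ K = ⊥ := by
    rw [eq_bot_iff]
    rintro y ⟨hy1, hy2⟩
    have h1 := (memS y).1 hy1
    have h2 := (memK y).1 hy2
    rw [Submodule.mem_span_range_iff_exists_fun] at h1
    obtain ⟨c, rfl⟩ := h1
    have : ∀ i, c i = 0 := fun i => by simpa [hd] using h2 i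
    simp [this]
  have htop : S ⊔ K = ⊤ := by
    rw [eq_top_iff]
    intro y _
    have e : y = (∑ i, φ i y • v i) + (y - ∑ i, φ i y • v i) := by abel
    rw [e]
    refine Submodule.add_mem_sup ?_ ?_
    · rw [memS]
      exact Submodule.sum_mem _ fun i _ => Submodule.smul_mem _ _ (Submodule.subset_span ⟨i, rfl⟩)
    · rw [memK]
      intro i
      simp [hd]
  rcases hV S K hbot htop with h | h
  · exfalso
    have h0 : v 0 ∈ S := (memS _).2 (Submodule.subset_span ⟨0, rfl⟩)
    rw [h, Submodule.mem_bot] at h0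
    have := hd 0 0
    rw [h0] at this
    simp at this
  · refine ⟨m + 1, hm, v, hli, ?_, hv⟩
    rw [eq_top_iff]
    intro y _
    have : y - ∑ i, φ i y • v i ∈ K := by
      rw [memK]
      intro i
      simp [hd]
    rw [h, Submodule.mem_bot, sub_eq_zero] at this
    rw [this]
    exact Submodule.sum_mem _ fun i _ => Submodule.smul_mem _ _ (Submodule.subset_span ⟨i, rfl⟩)

section Steps

variable {gl : Fin 3 → Bool} {g : Fin 3 → Fin 7 → D} (H : BlockAlg F D gl g)
include H

theorem BlockAlg.nul (k : Fin 3) (l l' : Fin 7) (h : tab true l l' = none) (y : V) :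
    g k l • g k l' • y = 0 := by
  rw [← mul_smul, H.mul]
  have : tab (gl k) l l' = none := by
    revert h
    generalize gl k = b
    revert l l' b
    decide
  rw [this]
  simp

theorem BlockAlg.idm (k : Fin 3) (l l' m : Fin 7) (h : tab false l l' = some m) (y : V) :
    g k l • g k l' • y = g k m • y := by
  rw [← mul_smul, H.mul]
  have : tab (gl k) l l' = some m := by
    revert h
    generalize gl k = b
    revert l l' m b
    decide
  rw [this]
  rfl

theorem BlockAlg.lab (k : Fin 3) (l l' : Fin 7) (hl : l.1 < 4) (hl' : l'.1 < 4) :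
    g k l * g k l' = 0 ∨ (g k l = g k l' ∧ g k l * g k l' = g k l') := by
  rw [H.mul]
  have hg := H.glue k
  revert hg
  generalize gl k = b
  intro hg
  cases b
  · have : tab false l l' = none ∨ (tab false l l' = some l' ∧ l = l') := by
      revert l l'; decide
    rcases this with h | ⟨h, rfl⟩
    · left; rw [h]; rfl
    · right; rw [h]; exact ⟨rfl, rfl⟩
  · have hg := hg rfl
    have : tab true l l' = none ∨ (tab true l l' = some l ∧ l = l') ∨
        (tab true l l' = some l ∧ ((l = 2 ∧ l' = 3) ∨ (l = 3 ∧ l' = 2))) := by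
      revert l l'; decide
    rcases this with h | ⟨h, rfl⟩ | ⟨h, ⟨rfl, rfl⟩ | ⟨rfl, rfl⟩⟩
    · left; rw [h]; rfl
    · right; rw [h]; exact ⟨rfl, rfl⟩
    · right; rw [h]; exact ⟨hg, hg⟩
    · right; rw [h]; exact ⟨hg.symm, hg.symm⟩

omit H in
theorem orth {k : Fin 3} {l l' : Fin 7} (H : BlockAlg F D gl g) (φ : V →ₗ[F] F) (v : V)
    (hφ : ∀ y, φ (g k l • y) = φ y) (hv : g k l' • v = v) (h : tab true l l' = none) :
    φ v = 0 := by
  rw [← hφ, ← hv, H.nul k l l' h, map_zero]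

/-- Splitting criterion inside one block: only the arrows have to be checked. -/
theorem BlockAlg.split1 (hV : Indec D V) (k : Fin 3) {m : ℕ} (hm : m + 1 ≤ 4)
    (lb : Fin (m + 1) → Fin 7) (hlb : ∀ j, (lb j).1 < 4)
    (v : Fin (m + 1) → V) (φ : Fin (m + 1) → (V →ₗ[F] F))
    (hd : ∀ i j, φ i (v j) = if i = j then 1 else 0)
    (hvl : ∀ j, g k (lb j) • v j = v j)
    (hφl : ∀ j y, φ j (g k (lb j) • y) = φ j y)
    (hv : ∀ j (l : Fin 3), g k (l.natAdd 4) • v j = 0 ∨ ∃ i, g k (l.natAdd 4) • v j = v i)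
    (hφ : ∀ i (l : Fin 3), (∀ y, φ i (g k (l.natAdd 4) • y) = 0) ∨
      ∃ j, ∀ y, φ i (g k (l.natAdd 4) • y) = φ j y) :
    Typed (V := V) F g := by
  refine split H.gen hV hm v φ hd ?_ ?_
  · intro k' l j
    by_cases hk : k' = k
    · subst hk
      by_cases hl : l.1 < 4
      · rw [← hvl j, ← mul_smul]
        rcases H.lab k' l (lb j) hl (hlb j) with h | ⟨-, h⟩
        · left; rw [h, zero_smul]
        · right; exact ⟨j, by rw [h, hvl]⟩
      · obtain ⟨l', rfl⟩ : ∃ l' : Fin 3, l = l'.natAdd 4 := ⟨⟨l.1 - 4, by omega⟩, by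
          ext; simp; omega⟩
        exact hv j l'
    · left
      rw [← hvl j, ← mul_smul, H.cross _ _ _ _ hk, zero_smul]
  · intro k' l j
    by_cases hk : k = k'
    · subst hk
      by_cases hl : l.1 < 4
      · rcases H.lab k (lb j) l (hlb j) hl with h | ⟨h1, h⟩
        · left; intro y; rw [← hφl, ← mul_smul, h, zero_smul, map_zero]
        · right
          refine ⟨j, fun y => ?_⟩
          rw [← h1, hφl]
      · obtain ⟨l', rfl⟩ : ∃ l' : Fin 3, l = l'.natAdd 4 := ⟨⟨l.1 - 4, by omega⟩, by
          ext; simp; omega⟩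
        exact hφ j l'
    · left
      intro y
      rw [← hφl, ← mul_smul, H.cross _ _ _ _ hk, zero_smul, map_zero]

omit H in
/-- The action of `d` as an `F`-linear map. -/
def act (F : Type*) {D V : Type*} [Field F] [Ring D] [Algebra F D] [AddCommGroup V] [Module D V]
    [Module F V] [IsScalarTower F D V] (d : D) : V →ₗ[F] V where
  toFun y := d • y
  map_add' := smul_add d
  map_smul' c y := smul_comm d c y

omit H in
@[simp] theorem act_apply (d : D) (y : V) : act F d y = d • y := rfl

theorem BlockAlg.exists_fun (k : Fin 3) (l : Fin 7) (hl : tab false l l = some l) (y : V)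
    (hy : g k l • y = y) (S : Submodule F V) (hS : ∀ s ∈ S, g k l • s = s) (h0 : y ∉ S) :
    ∃ ψ : V →ₗ[F] F, ψ y = 1 ∧ (∀ z, ψ (g k l • z) = ψ z) ∧ ∀ s ∈ S, ψ s = 0 := by
  obtain ⟨f, hf, hfS⟩ := Submodule.exists_le_ker_of_notMem h0
  refine ⟨(f y)⁻¹ • (f.comp (act F (g k l))), ?_, ?_, ?_⟩
  · simp [hy, hf]
  · intro z
    simp [H.idm k l l l hl]
  · intro s hs
    have : f s = 0 := hfS hs
    simp [hS s hs, this]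

theorem BlockAlg.exists_ne (k : Fin 3) (l : Fin 7) (hl : tab false l l = some l) (y : V)
    (hy : g k l • y = y) (h0 : y ≠ 0) :
    ∃ ψ : V →ₗ[F] F, ψ y = 1 ∧ ∀ z, ψ (g k l • z) = ψ z := by
  obtain ⟨ψ, h1, h2, -⟩ := H.exists_fun (F := F) k l hl y hy ⊥ (by simp) (by simpa using h0)
  exact ⟨ψ, h1, h2⟩

theorem BlockAlg.adjust (k : Fin 3) (ψ : V →ₗ[F] F) (p : V) (hp : g k 3 • p = p)
    (hψ : ∀ z, ψ (g k 2 • z) = ψ z) (h1 : ψ (g k 6 • p) = 1) :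
    ∃ p' : V, g k 3 • p' = p' ∧ g k 6 • p' = g k 6 • p ∧ ψ p' = 0 := by
  cases hgl : gl k
  · refine ⟨p, hp, rfl, ?_⟩
    rw [← hψ, ← hp, ← mul_smul, H.mul, hgl]
    simp [tab]
  · have h32 : g k 3 = g k 2 := (H.glue k hgl).symm
    refine ⟨p - ψ p • (g k 6 • p), ?_, ?_, ?_⟩
    · rw [smul_sub, hp, smul_comm, h32, H.idm k 2 6 6 rfl]
    · rw [smul_sub, smul_comm, H.nul k 6 6 rfl, smul_zero, sub_zero]
    · simp [h1]

omit H in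
theorem exists_factor {V' : Type*} [AddCommGroup V'] [Module F V'] (f : V →ₗ[F] V')
    (h : V →ₗ[F] F) (hk : ∀ y, f y = 0 → h y = 0) : ∃ χ : V' →ₗ[F] F, ∀ y, χ (f y) = h y := by
  have : h ∈ LinearMap.range f.dualMap := by
    rw [LinearMap.range_dualMap_eq_dualAnnihilator_ker]
    rw [Submodule.mem_dualAnnihilator]
    intro w hw
    exact hk w hw
  obtain ⟨χ, rfl⟩ := this
  exact ⟨χ, fun y => rfl⟩

theorem BlockAlg.block_case (hV : Indec D V) (k : Fin 3) :
    Typed (V := V) F g ∨ ∀ l : Fin 7, l.1 < 4 → ∀ y : V, g k l • y = 0 := by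
  by_contra hcon
  rw [not_or] at hcon
  obtain ⟨hT, hne⟩ := hcon
  have e00 : ∀ y : V, g k 0 • g k 0 • y = g k 0 • y := H.idm k 0 0 0 rfl
  have e11 : ∀ y : V, g k 1 • g k 1 • y = g k 1 • y := H.idm k 1 1 1 rfl
  have e22 : ∀ y : V, g k 2 • g k 2 • y = g k 2 • y := H.idm k 2 2 2 rfl
  have e33 : ∀ y : V, g k 3 • g k 3 • y = g k 3 • y := H.idm k 3 3 3 rfl
  have e24 : ∀ y : V, g k 2 • g k 4 • y = g k 4 • y := H.idm k 2 4 4 rfl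
  have e41 : ∀ y : V, g k 4 • g k 1 • y = g k 4 • y := H.idm k 4 1 4 rfl
  have e05 : ∀ y : V, g k 0 • g k 5 • y = g k 5 • y := H.idm k 0 5 5 rfl
  have e51 : ∀ y : V, g k 5 • g k 1 • y = g k 5 • y := H.idm k 5 1 5 rfl
  have e26 : ∀ y : V, g k 2 • g k 6 • y = g k 6 • y := H.idm k 2 6 6 rfl
  have e63 : ∀ y : V, g k 6 • g k 3 • y = g k 6 • y := H.idm k 6 3 6 rfl
  -- vectors at a vertex are killed by arrows starting elsewhere
  have vz : ∀ (l l' : Fin 7) (y : V), tab true l' l = none → g k l • y = y → g k l' • y = 0 := by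
    intro l l' y h hy
    rw [← hy, H.nul k l' l h]
  have fz : ∀ (l l' : Fin 7) (φ : V →ₗ[F] F), tab true l l' = none → (∀ y, φ (g k l • y) = φ y) →
      ∀ y, φ (g k l' • y) = 0 := by
    intro l l' φ h hφ y
    rw [← hφ, H.nul k l l' h, map_zero]
  -- step 1
  have s1 : ∀ o : V, g k 1 • o = o → g k 4 • o = 0 → g k 5 • o = 0 → o = 0 := by
    intro o ho h4 h5
    by_contra h0
    obtain ⟨ψ, hψ, hψl⟩ := H.exists_ne (F := F) k 1 rfl o ho h0
    refine hT (H.split1 hV k (m := 0) (by norm_num) ![1] (by decide) ![o] ![ψ] ?_ ?_ ?_ ?_ ?_)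
    · intro i j; fin_cases i; fin_cases j; simpa using hψ
    · intro j; fin_cases j; simpa using ho
    · intro j; fin_cases j; simpa using hψl
    · intro j l
      left
      fin_cases j; fin_cases l
      · exact h4
      · exact h5
      · exact vz 1 6 o rfl ho
    · intro j l
      left
      fin_cases j; fin_cases l
      · exact fz 1 4 ψ rfl hψl
      · exact fz 1 5 ψ rfl hψl
      · exact fz 1 6 ψ rfl hψl
  -- step 2
  have s2 : ∀ o : V, g k 1 • o = o → g k 4 • o = 0 → o = 0 := by
    intro o ho h4
    by_contra h0
    have h5 : g k 5 • o ≠ 0 := fun h5 => h0 (s1 o ho h4 h5)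
    obtain ⟨ψ, hψ, hψl⟩ := H.exists_ne (F := F) k 0 rfl _ (e05 o) h5
    refine hT (H.split1 hV k (m := 1) (by norm_num) ![1, 0] (by decide)
      ![o, g k 5 • o]
      ![ψ.comp (act F (g k 5)), ψ] ?_ ?_ ?_ ?_ ?_)
    · intro i j
      fin_cases i <;> fin_cases j
      · exact hψ
      · exact orth (l := 1) H _ _ (fun y => by simp [e51]) (e05 o) rfl
      · exact orth H _ _ hψl ho rfl
      · exact hψ
    · intro j
      fin_cases j
      · exact ho
      · exact (e05 o)
    · intro j
      fin_cases j
      · exact (fun y => by simp [e51])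
      · exact hψl
    · intro j l
      fin_cases j <;> fin_cases l
      · exact Or.inl h4
      · exact Or.inr ⟨1, rfl⟩
      · exact Or.inl (vz 1 6 _ rfl ho)
      · exact Or.inl (vz 0 4 _ rfl (e05 o))
      · exact Or.inl (vz 0 5 _ rfl (e05 o))
      · exact Or.inl (vz 0 6 _ rfl (e05 o))
    · intro j l
      fin_cases j <;> fin_cases l
      · exact Or.inl (fz 1 4 _ rfl (fun y => by simp [e51]))
      · exact Or.inl (fz 1 5 _ rfl (fun y => by simp [e51]))
      · exact Or.inl (fz 1 6 _ rfl (fun y => by simp [e51]))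
      · exact Or.inl (fz 0 4 _ rfl hψl)
      · exact Or.inr ⟨0, fun y => rfl⟩
      · exact Or.inl (fz 0 6 _ rfl hψl)
  have hR : ∀ s ∈ LinearMap.range (act F (g k 6) : V →ₗ[F] V), g k 2 • s = s := by
    rintro _ ⟨z, rfl⟩
    exact e26 z
  -- step 3
  have s3 : ∀ o : V, g k 1 • o = o → g k 5 • o = 0 → o ≠ 0 →
      g k 4 • o ∉ LinearMap.range (act F (g k 6) : V →ₗ[F] V) → False := by
    intro o ho h5 h0 hx
    obtain ⟨ψ, hψ, hψl, hψX⟩ := H.exists_fun (F := F) k 2 rfl _ (e24 o) _ hR hx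
    have hX : ∀ y, ψ (g k 6 • y) = 0 := fun y => hψX _ ⟨y, rfl⟩
    refine hT (H.split1 hV k (m := 1) (by norm_num) ![1, 2] (by decide)
      ![o, g k 4 • o]
      ![ψ.comp (act F (g k 4)), ψ] ?_ ?_ ?_ ?_ ?_)
    · intro i j
      fin_cases i <;> fin_cases j
      · exact hψ
      · exact orth (l := 1) H _ _ (fun y => by simp [e41]) (e24 o) rfl
      · exact orth H _ _ hψl ho rfl
      · exact hψ
    · intro j
      fin_cases j
      · exact ho
      · exact (e24 o)
    · intro j
      fin_cases j
      · exact (fun y => by simp [e41])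
      · exact hψl
    · intro j l
      fin_cases j <;> fin_cases l
      · exact Or.inr ⟨1, rfl⟩
      · exact Or.inl h5
      · exact Or.inl (vz 1 6 _ rfl ho)
      · exact Or.inl (vz 2 4 _ rfl (e24 o))
      · exact Or.inl (vz 2 5 _ rfl (e24 o))
      · exact Or.inl (H.nul k 6 4 rfl o)
    · intro j l
      fin_cases j <;> fin_cases l
      · exact Or.inl (fz 1 4 _ rfl (fun y => by simp [e41]))
      · exact Or.inl (fz 1 5 _ rfl (fun y => by simp [e41]))
      · exact Or.inl (fz 1 6 _ rfl (fun y => by simp [e41]))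
      · exact Or.inr ⟨0, fun y => rfl⟩
      · exact Or.inl (fz 2 5 _ rfl hψl)
      · exact Or.inl hX
  -- step 4
  have s4 : ∀ o : V, g k 1 • o = o → g k 5 • o = 0 → o = 0 := by
    intro o ho h5
    by_contra h0
    have h4 : g k 4 • o ≠ 0 := fun h => h0 (s2 o ho h)
    obtain ⟨ψ, hψ, hψl⟩ := H.exists_ne (F := F) k 2 rfl _ (e24 o) h4
    have hx : g k 4 • o ∈ LinearMap.range (act F (g k 6) : V →ₗ[F] V) := by
      by_contra hx
      exact s3 o ho h5 h0 hx
    obtain ⟨z, hz⟩ := hx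
    rw [act_apply] at hz
    obtain ⟨p, hp, hpx, hp0⟩ := H.adjust (F := F) k ψ (g k 3 • z) (e33 z) hψl (by rw [e63, hz, hψ])
    rw [e63, hz] at hpx
    refine hT (H.split1 hV k (m := 2) (by norm_num) ![1, 3, 2] (by decide)
      ![o, p, g k 4 • o]
      ![ψ.comp (act F (g k 4)), ψ.comp (act F (g k 6)), ψ] ?_ ?_ ?_ ?_ ?_)
    · intro i j
      fin_cases i <;> fin_cases j
      · exact hψ
      · exact orth (l := 1) H _ _ (fun y => by simp [e41]) hp rfl
      · exact orth (l := 1) H _ _ (fun y => by simp [e41]) (e24 o) rfl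
      · exact orth (l := 3) H _ _ (fun y => by simp [e63]) ho rfl
      · exact (congrArg ψ hpx).trans hψ
      · exact (congrArg ψ (H.nul k 6 4 rfl o)).trans (map_zero ψ)
      · exact orth H _ _ hψl ho rfl
      · exact hp0
      · exact hψ
    · intro j
      fin_cases j
      · exact ho
      · exact hp
      · exact (e24 o)
    · intro j
      fin_cases j
      · exact (fun y => by simp [e41])
      · exact (fun y => by simp [e63])
      · exact hψl
    · intro j l
      fin_cases j <;> fin_cases l
      · exact Or.inr ⟨2, rfl⟩
      · exact Or.inl h5
      · exact Or.inl (vz 1 6 _ rfl ho)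
      · exact Or.inl (vz 3 4 _ rfl hp)
      · exact Or.inl (vz 3 5 _ rfl hp)
      · exact Or.inr ⟨2, hpx⟩
      · exact Or.inl (vz 2 4 _ rfl (e24 o))
      · exact Or.inl (vz 2 5 _ rfl (e24 o))
      · exact Or.inl (H.nul k 6 4 rfl o)
    · intro j l
      fin_cases j <;> fin_cases l
      · exact Or.inl (fz 1 4 _ rfl (fun y => by simp [e41]))
      · exact Or.inl (fz 1 5 _ rfl (fun y => by simp [e41]))
      · exact Or.inl (fz 1 6 _ rfl (fun y => by simp [e41]))
      · exact Or.inl (fun y => (congrArg ψ (H.nul k 6 4 rfl y)).trans (map_zero ψ))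
      · exact Or.inl (fz 3 5 _ rfl (fun y => by simp [e63]))
      · exact Or.inl (fun y => (congrArg ψ (H.nul k 6 6 rfl y)).trans (map_zero ψ))
      · exact Or.inr ⟨0, fun y => rfl⟩
      · exact Or.inl (fz 2 5 _ rfl hψl)
      · exact Or.inr ⟨1, fun y => rfl⟩
  -- extension of functionals along `b`
  have ext : ∀ ψ : V →ₗ[F] F, ∃ χ : V →ₗ[F] F, (∀ y, χ (g k 0 • y) = χ y) ∧
      ∀ y, χ (g k 5 • y) = ψ (g k 4 • y) := by
    intro ψ
    obtain ⟨χ, hχ⟩ := exists_factor (act F (g k 5) : V →ₗ[F] V) (ψ.comp (act F (g k 4))) (by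
      intro y hy
      rw [act_apply, ← e51] at hy
      have := s4 _ (e11 y) hy
      simp [← e41 y, this])
    refine ⟨χ.comp (act F (g k 0)), fun y => by simp [e00], fun y => ?_⟩
    have := hχ y
    simp only [act_apply, LinearMap.comp_apply] at this ⊢
    rw [e05, this]
  -- step 5
  have s5 : ∀ o : V, g k 1 • o = o → o ≠ 0 →
      g k 4 • o ∉ LinearMap.range (act F (g k 6) : V →ₗ[F] V) → False := by
    intro o ho h0 hx
    obtain ⟨ψ, hψ, hψl, hψX⟩ := H.exists_fun (F := F) k 2 rfl _ (e24 o) _ hR hx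
    have hX : ∀ y, ψ (g k 6 • y) = 0 := fun y => hψX _ ⟨y, rfl⟩
    obtain ⟨χ, hχl, hχ⟩ := ext ψ
    refine hT (H.split1 hV k (m := 2) (by norm_num) ![1, 2, 0] (by decide)
      ![o, g k 4 • o, g k 5 • o]
      ![ψ.comp (act F (g k 4)), ψ, χ] ?_ ?_ ?_ ?_ ?_)
    · intro i j
      fin_cases i <;> fin_cases j
      · exact hψ
      · exact orth (l := 1) H _ _ (fun y => by simp [e41]) (e24 o) rfl
      · exact orth (l := 1) H _ _ (fun y => by simp [e41]) (e05 o) rfl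
      · exact orth H _ _ hψl ho rfl
      · exact hψ
      · exact orth H _ _ hψl (e05 o) rfl
      · exact orth H _ _ hχl ho rfl
      · exact orth H _ _ hχl (e24 o) rfl
      · exact (hχ o).trans hψ
    · intro j
      fin_cases j
      · exact ho
      · exact (e24 o)
      · exact (e05 o)
    · intro j
      fin_cases j
      · exact (fun y => by simp [e41])
      · exact hψl
      · exact hχl
    · intro j l
      fin_cases j <;> fin_cases l
      · exact Or.inr ⟨1, rfl⟩
      · exact Or.inr ⟨2, rfl⟩
      · exact Or.inl (vz 1 6 _ rfl ho)
      · exact Or.inl (vz 2 4 _ rfl (e24 o))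
      · exact Or.inl (vz 2 5 _ rfl (e24 o))
      · exact Or.inl (H.nul k 6 4 rfl o)
      · exact Or.inl (vz 0 4 _ rfl (e05 o))
      · exact Or.inl (vz 0 5 _ rfl (e05 o))
      · exact Or.inl (vz 0 6 _ rfl (e05 o))
    · intro j l
      fin_cases j <;> fin_cases l
      · exact Or.inl (fz 1 4 _ rfl (fun y => by simp [e41]))
      · exact Or.inl (fz 1 5 _ rfl (fun y => by simp [e41]))
      · exact Or.inl (fz 1 6 _ rfl (fun y => by simp [e41]))
      · exact Or.inr ⟨0, fun y => rfl⟩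
      · exact Or.inl (fz 2 5 _ rfl hψl)
      · exact Or.inl hX
      · exact Or.inl (fz 0 4 _ rfl hχl)
      · exact Or.inr ⟨0, hχ⟩
      · exact Or.inl (fz 0 6 _ rfl hχl)
  -- step 6
  have s6 : ∀ o : V, g k 1 • o = o → o = 0 := by
    intro o ho
    by_contra h0
    have h4 : g k 4 • o ≠ 0 := fun h => h0 (s2 o ho h)
    obtain ⟨ψ, hψ, hψl⟩ := H.exists_ne (F := F) k 2 rfl _ (e24 o) h4
    have hx : g k 4 • o ∈ LinearMap.range (act F (g k 6) : V →ₗ[F] V) := by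
      by_contra hx
      exact s5 o ho h0 hx
    obtain ⟨z, hz⟩ := hx
    rw [act_apply] at hz
    obtain ⟨p, hp, hpx, hp0⟩ := H.adjust (F := F) k ψ (g k 3 • z) (e33 z) hψl (by rw [e63, hz, hψ])
    rw [e63, hz] at hpx
    obtain ⟨χ, hχl, hχ⟩ := ext ψ
    refine hT (H.split1 hV k (m := 3) (by norm_num) ![1, 3, 2, 0] (by decide)
      ![o, p, g k 4 • o, g k 5 • o]
      ![ψ.comp (act F (g k 4)), ψ.comp (act F (g k 6)), ψ, χ] ?_ ?_ ?_ ?_ ?_)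
    · intro i j
      fin_cases i <;> fin_cases j
      · exact hψ
      · exact orth (l := 1) H _ _ (fun y => by simp [e41]) hp rfl
      · exact orth (l := 1) H _ _ (fun y => by simp [e41]) (e24 o) rfl
      · exact orth (l := 1) H _ _ (fun y => by simp [e41]) (e05 o) rfl
      · exact orth (l := 3) H _ _ (fun y => by simp [e63]) ho rfl
      · exact (congrArg ψ hpx).trans hψ
      · exact (congrArg ψ (H.nul k 6 4 rfl o)).trans (map_zero ψ)
      · exact orth (l := 3) H _ _ (fun y => by simp [e63]) (e05 o) rfl
      · exact orth H _ _ hψl ho rfl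
      · exact hp0
      · exact hψ
      · exact orth H _ _ hψl (e05 o) rfl
      · exact orth H _ _ hχl ho rfl
      · exact orth H _ _ hχl hp rfl
      · exact orth H _ _ hχl (e24 o) rfl
      · exact (hχ o).trans hψ
    · intro j
      fin_cases j
      · exact ho
      · exact hp
      · exact (e24 o)
      · exact (e05 o)
    · intro j
      fin_cases j
      · exact (fun y => by simp [e41])
      · exact (fun y => by simp [e63])
      · exact hψl
      · exact hχl
    · intro j l
      fin_cases j <;> fin_cases l
      · exact Or.inr ⟨2, rfl⟩
      · exact Or.inr ⟨3, rfl⟩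
      · exact Or.inl (vz 1 6 _ rfl ho)
      · exact Or.inl (vz 3 4 _ rfl hp)
      · exact Or.inl (vz 3 5 _ rfl hp)
      · exact Or.inr ⟨2, hpx⟩
      · exact Or.inl (vz 2 4 _ rfl (e24 o))
      · exact Or.inl (vz 2 5 _ rfl (e24 o))
      · exact Or.inl (H.nul k 6 4 rfl o)
      · exact Or.inl (vz 0 4 _ rfl (e05 o))
      · exact Or.inl (vz 0 5 _ rfl (e05 o))
      · exact Or.inl (vz 0 6 _ rfl (e05 o))
    · intro j l
      fin_cases j <;> fin_cases l
      · exact Or.inl (fz 1 4 _ rfl (fun y => by simp [e41]))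
      · exact Or.inl (fz 1 5 _ rfl (fun y => by simp [e41]))
      · exact Or.inl (fz 1 6 _ rfl (fun y => by simp [e41]))
      · exact Or.inl (fun y => (congrArg ψ (H.nul k 6 4 rfl y)).trans (map_zero ψ))
      · exact Or.inl (fz 3 5 _ rfl (fun y => by simp [e63]))
      · exact Or.inl (fun y => (congrArg ψ (H.nul k 6 6 rfl y)).trans (map_zero ψ))
      · exact Or.inr ⟨0, fun y => rfl⟩
      · exact Or.inl (fz 2 5 _ rfl hψl)
      · exact Or.inr ⟨1, fun y => rfl⟩
      · exact Or.inl (fz 0 4 _ rfl hχl)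
      · exact Or.inr ⟨0, hχ⟩
      · exact Or.inl (fz 0 6 _ rfl hχl)
  have o0 : ∀ y : V, g k 1 • y = 0 := fun y => s6 _ (e11 y)
  have a0 : ∀ y : V, g k 4 • y = 0 := fun y => by rw [← e41, o0, smul_zero]
  have b0 : ∀ y : V, g k 5 • y = 0 := fun y => by rw [← e51, o0, smul_zero]
  -- step 7
  have x0 : ∀ y : V, g k 6 • y = 0 := by
    intro y
    by_contra h0
    obtain ⟨ψ, hψ, hψl⟩ := H.exists_ne (F := F) k 2 rfl _ (e26 y) h0
    obtain ⟨p, hp, hpx, hp0⟩ := H.adjust (F := F) k ψ (g k 3 • y) (e33 y) hψl (by rw [e63, hψ])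
    have hpψ : ψ (g k 6 • p) = 1 := by rw [hpx, e63, hψ]
    refine hT (H.split1 hV k (m := 1) (by norm_num) ![3, 2] (by decide)
      ![p, g k 6 • p]
      ![ψ.comp (act F (g k 6)), ψ] ?_ ?_ ?_ ?_ ?_)
    · intro i j
      fin_cases i <;> fin_cases j
      · exact hpψ
      · exact (congrArg ψ (H.nul k 6 6 rfl p)).trans (map_zero ψ)
      · exact hp0
      · exact hpψ
    · intro j
      fin_cases j
      · exact hp
      · exact (e26 p)
    · intro j
      fin_cases j
      · exact (fun y => by simp [e63])
      · exact hψl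
    · intro j l
      fin_cases j <;> fin_cases l
      · exact Or.inl (vz 3 4 _ rfl hp)
      · exact Or.inl (vz 3 5 _ rfl hp)
      · exact Or.inr ⟨1, rfl⟩
      · exact Or.inl (vz 2 4 _ rfl (e26 p))
      · exact Or.inl (vz 2 5 _ rfl (e26 p))
      · exact Or.inl (H.nul k 6 6 rfl p)
    · intro j l
      fin_cases j <;> fin_cases l
      · exact Or.inl (fun y => (congrArg ψ (H.nul k 6 4 rfl y)).trans (map_zero ψ))
      · exact Or.inl (fz 3 5 _ rfl (fun y => by simp [e63]))
      · exact Or.inl (fun y => (congrArg ψ (H.nul k 6 6 rfl y)).trans (map_zero ψ))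
      · exact Or.inl (fun y => (congrArg ψ (a0 y)).trans (map_zero ψ))
      · exact Or.inl (fz 2 5 _ rfl hψl)
      · exact Or.inr ⟨0, fun y => rfl⟩
  -- step 8
  apply hne
  intro l hl y
  by_contra h0
  have hll : tab false l l = some l := by
    clear h0; revert l; decide
  have ho : g k l • g k l • y = g k l • y := H.idm k l l l hll y
  obtain ⟨ψ, hψ, hψl⟩ := H.exists_ne (F := F) k l hll _ ho h0
  refine hT (H.split1 hV k (m := 0) (by norm_num) ![l] (by simpa using hl) ![g k l • y] ![ψ]
    ?_ ?_ ?_ ?_ ?_)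
  · intro i j; fin_cases i; fin_cases j; exact hψ
  · intro j; fin_cases j; exact ho
  · intro j; fin_cases j; exact hψl
  · intro j l
    left
    fin_cases j; fin_cases l
    · exact a0 _
    · exact b0 _
    · exact x0 _
  · intro j l
    left
    fin_cases j; fin_cases l
    · exact fun y => (congrArg ψ (a0 y)).trans (map_zero ψ)
    · exact fun y => (congrArg ψ (b0 y)).trans (map_zero ψ)
    · exact fun y => (congrArg ψ (x0 y)).trans (map_zero ψ)

theorem BlockAlg.typed [Nontrivial V] (hV : Indec D V) : Typed (V := V) F g := by
  by_contra hT
  have h : ∀ k, ∀ l : Fin 7, l.1 < 4 → ∀ y : V, g k l • y = 0 := fun k =>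
    (H.block_case (F := F) hV k).resolve_left hT
  have h' : ∀ k l, ∀ y : V, g k l • y = 0 := by
    intro k l y
    by_cases hl : l.1 < 4
    · exact h k l hl y
    · have : ∃ l' : Fin 7, l'.1 < 4 ∧ tab false l l' = some l := by
        revert l; decide
      obtain ⟨l', h1, h2⟩ := this
      rw [← H.idm k l l' l h2, h k l' h1, smul_zero]
  obtain ⟨y, hy⟩ := _root_.exists_ne (0 : V)
  apply hy
  have h1 : ∀ d ∈ Submodule.span F (Set.range fun x : Fin 3 × Fin 7 => g x.1 x.2), d • y = 0 := by
    intro d hd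
    induction hd using Submodule.span_induction with
    | mem x hx =>
      obtain ⟨⟨k, l⟩, rfl⟩ := hx
      exact h' k l y
    | zero => exact zero_smul _ _
    | add a b _ _ ha hb => rw [add_smul, ha, hb, add_zero]
    | smul c a _ ha => rw [smul_assoc, ha, smul_zero]
  rw [← one_smul D y]
  exact h1 1 H.one

end Steps

/-- `V` has a basis on which the generators act through the combinatorial datum `τ`. -/
def HasType (F : Type*) {D : Type*} (V : Type*) [Field F] [Ring D] [AddCommGroup V] [Module D V]
    [Module F V] (g : Fin 3 → Fin 7 → D)
    (τ : Σ m : Fin 5, Fin 3 → Fin 7 → Fin m.1 → Option (Fin m.1)) : Prop :=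
  ∃ v : Fin τ.1.1 → V, LinearIndependent F v ∧ Submodule.span F (Set.range v) = ⊤ ∧
    ∀ k l j, g k l • v j = (τ.2 k l j).elim 0 v

theorem Typed.hasType {g : Fin 3 → Fin 7 → D} (h : Typed (V := V) F g) :
    ∃ τ, HasType F V g τ := by
  obtain ⟨m, hm, v, h1, h2, h3⟩ := h
  have : ∀ k l j, ∃ o : Option (Fin m), g k l • v j = o.elim 0 v := by
    intro k l j
    rcases h3 k l j with h | ⟨i, h⟩
    · exact ⟨none, h⟩
    · exact ⟨some i, h⟩
  choose f hf using this
  exact ⟨⟨⟨m, by omega⟩, f⟩, v, h1, h2, hf⟩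

theorem HasType.isom {g : Fin 3 → Fin 7 → D}
    (hgen : Algebra.adjoin F (Set.range fun x : Fin 3 × Fin 7 => g x.1 x.2) = ⊤)
    {V' : Type*} [AddCommGroup V'] [Module D V'] [Module F V'] [IsScalarTower F D V']
    {τ : Σ m : Fin 5, Fin 3 → Fin 7 → Fin m.1 → Option (Fin m.1)}
    (h : HasType F V g τ) (h' : HasType F V' g τ) : Nonempty (V ≃ₗ[D] V') := by
  obtain ⟨v, h1, h2, h3⟩ := h
  obtain ⟨v', h1', h2', h3'⟩ := h'
  let b := Module.Basis.mk h1 h2.ge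
  let b' := Module.Basis.mk h1' h2'.ge
  let e := b.equiv b' (Equiv.refl _)
  have ev : ∀ j, e (v j) = v' j := by
    intro j
    have := b.equiv_apply j b' (Equiv.refl _)
    simpa [b, b'] using this
  have key : ∀ (d : D) (y : V), e (d • y) = d • e y := by
    intro d
    have hd : d ∈ Algebra.adjoin F (Set.range fun x : Fin 3 × Fin 7 => g x.1 x.2) := by
      rw [hgen]; trivial
    induction hd using Algebra.adjoin_induction with
    | mem x hx =>
      obtain ⟨⟨k, l⟩, rfl⟩ := hx
      have : (e : V →ₗ[F] V').comp (act F (g k l)) = (act F (g k l)).comp (e : V →ₗ[F] V') := by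
        refine b.ext fun j => ?_
        simp only [b, Module.Basis.mk_apply, LinearMap.comp_apply, act_apply,
          LinearEquiv.coe_coe, ev]
        rw [h3, h3']
        cases τ.2 k l j with
        | none => simp
        | some i => simp [ev]
      intro y
      exact LinearMap.congr_fun this y
    | algebraMap r => intro y; simp
    | add a c _ _ ha hc => intro y; rw [add_smul, map_add, ha, hc, add_smul]
    | mul a c _ _ ha hc => intro y; rw [mul_smul, ha, hc, mul_smul]
  exact ⟨{ e with map_smul' := key }⟩

end Rep

theorem finite_type {F D : Type*} [Field F] [Ring D] [Algebra F D]
    {gl : Fin 3 → Bool} {g : Fin 3 → Fin 7 → D} (H : BlockAlg F D gl g) :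
    ∃ (N : ℕ) (Mod : Fin N → ModuleCat D),
      ∀ (V : Type) [AddCommGroup V] [Module D V]
        [Module F V] [IsScalarTower F D V] [FiniteDimensional F V],
        Nontrivial V →
        (∀ P Q : Submodule D V, P ⊓ Q = ⊥ → P ⊔ Q = ⊤ → P = ⊥ ∨ Q = ⊥) →
        ∃ i, Nonempty (V ≃ₗ[D] Mod i) := by
  classical
  have ex : ∀ τ : Σ m : Fin 5, Fin 3 → Fin 7 → Fin m.1 → Option (Fin m.1),
      ∃ M : ModuleCat D, ∀ (V : Type) [AddCommGroup V] [Module D V]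
        [Module F V] [IsScalarTower F D V], HasType F V g τ → Nonempty (V ≃ₗ[D] M) := by
    intro τ
    by_cases hP : ∃ (V : Type) (_ : AddCommGroup V) (_ : Module D V)
        (_ : Module F V) (_ : IsScalarTower F D V), HasType F V g τ
    · obtain ⟨V, _, _, _, _, hV⟩ := hP
      refine ⟨ModuleCat.of D (ULift V), fun V' _ _ _ _ hV' => ?_⟩
      obtain ⟨e⟩ := HasType.isom H.gen hV' hV
      exact ⟨e.trans ULift.moduleEquiv.symm⟩
    · refine ⟨ModuleCat.of D PUnit, fun V' i1 i2 i3 i4 hV' => ?_⟩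
      exact absurd ⟨V', i1, i2, i3, i4, hV'⟩ hP
  choose M hM using ex
  let E := Fintype.equivFin (Σ m : Fin 5, Fin 3 → Fin 7 → Fin m.1 → Option (Fin m.1))
  refine ⟨_, fun i => M (E.symm i), ?_⟩
  intro V _ _ _ _ _ hn hi
  obtain ⟨τ, hτ⟩ := (H.typed (F := F) (V := V) hi).hasType
  have h := hM (E.symm (E τ)) V (by rw [E.symm_apply_apply]; exact hτ)
  exact ⟨E τ, h⟩

end DescB

set_option maxHeartbeats 1000000
set_option synthInstance.maxHeartbeats 1000000

namespace DescB

/-! ### Words and rewriting -/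

/-- Rewrite a word at its beginning by one Coxeter relation. -/
def mv0 (n : ℕ) (w : List ℕ) : List ℕ :=
  match w with
  | i :: j :: t =>
    if i < n ∧ j < n then
      if i = j then t
      else if i + 2 ≤ j ∨ j + 2 ≤ i then j :: i :: t
      else match t with
        | a :: t1 =>
          if a = i then
            if i ≠ 0 ∧ j ≠ 0 then j :: i :: j :: t1
            else match t1 with
              | b :: t2 => if b = j then j :: i :: j :: i :: t2 else w
              | [] => w
          else w
        | [] => w
    else w
  | _ => w

/-- Rewrite a word at position `p`. -/
def mv (n : ℕ) : ℕ → List ℕ → List ℕ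
  | 0, w => mv0 n w
  | _ + 1, [] => []
  | p + 1, a :: t => a :: mv n p t

/-- Rewrite a word successively at the given positions. -/
def mvs (n : ℕ) (ps : List ℕ) (w : List ℕ) : List ℕ := ps.foldl (fun w p => mv n p w) w

/-- Coset representatives: the initial segments of `k-1, …, 1, 0, 1, …, k-1`. -/
def reps (k : ℕ) : List (List ℕ) := ((List.range k).reverse ++ (List.range k).tail).inits

/-- Words for all the elements of the group. -/
def WL : ℕ → List (List ℕ)
  | 0 => [[]]
  | k + 1 => (WL k).flatMap fun ω => (reps (k + 1)).map fun c => ω ++ c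

/-- Positions of the rewriting steps used for the closure of the set of words. -/
def CT : List (List (List (List ℕ))) :=
    [[], [[[]], [[0]]], [[[], []], [[], [0]], [[1], []], [[0], [2]]], [[[], [], []], [[0], [],
  [0]], [[], [1], [0]], [[2], [], [2, 0]], [[1, 0], [3], []], [[4, 1, 0], [3, 2, 0], [4]]],
  [[[], [], [], []], [[0], [0], [], [0]], [[1, 0], [], [1], [0]], [[], [2], [1, 0], [2, 0]],
  [[3], [], [3, 1, 0], [3, 2, 0]], [[2, 1, 0], [4], [], [4, 3, 2, 0]], [[5, 2, 1, 0], [4, 3, 1,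
  0], [5], []], [[6, 5, 2, 1, 0], [6, 4, 3, 1, 0], [5, 4, 3, 2, 0], [6]]]]

/-- Closure check. -/
def good (k : ℕ) (c : List ℕ) (i : ℕ) : Prop :=
  let r := mvs k (((CT.getD k []).getD c.length []).getD i []) (c ++ [i])
  r ∈ reps k ∨ ∃ i' ∈ List.range (k - 1), r = i' :: c

theorem good_all : ∀ k ∈ [1, 2, 3, 4], ∀ c ∈ reps k, ∀ i ∈ List.range k, good k c i := by
  unfold good
  decide +kernel

section Words

variable {W : Type*} [Group W]

/-- The relations needed. -/
structure Rels (n : ℕ) (s : ℕ → W) : Prop where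
  sq : ∀ i, i < n → s i * s i = 1
  comm : ∀ i j, i < n → j < n → i + 2 ≤ j → s i * s j = s j * s i
  br3 : ∀ i j, i < n → j < n → i ≠ 0 → j ≠ 0 → i ≠ j → ¬ (i + 2 ≤ j ∨ j + 2 ≤ i) →
    s i * (s j * s i) = s j * (s i * s j)
  br4 : ∀ i j, i < n → j < n → ¬ (i ≠ 0 ∧ j ≠ 0) → i ≠ j → ¬ (i + 2 ≤ j ∨ j + 2 ≤ i) →
    s i * (s j * (s i * s j)) = s j * (s i * (s j * s i))
  gen : ∀ P : W → Prop, P 1 → (∀ w i, i < n → P w → P (w * s i)) → ∀ w, P w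

/-- Product of a word. -/
def wp (s : ℕ → W) (ω : List ℕ) : W := (ω.map s).prod

theorem wp_append (s : ℕ → W) (a b : List ℕ) : wp s (a ++ b) = wp s a * wp s b := by
  simp [wp]

theorem wp_cons (s : ℕ → W) (a : ℕ) (b : List ℕ) : wp s (a :: b) = s a * wp s b := by
  simp [wp]

theorem Rels.mv0 {n : ℕ} {s : ℕ → W} (R : Rels n s) {k : ℕ} (hk : k ≤ n) (w : List ℕ) :
    wp s (mv0 k w) = wp s w := by
  unfold DescB.mv0
  split
  · rename_i i j t
    split_ifs with h1 h2 h3 h5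
    · subst h2
      rw [wp_cons, wp_cons, ← mul_assoc, R.sq i (by omega), one_mul]
    · rw [wp_cons, wp_cons, wp_cons, wp_cons, ← mul_assoc, ← mul_assoc]
      rcases h3 with h3 | h3
      · rw [R.comm i j (by omega) (by omega) h3]
      · rw [R.comm j i (by omega) (by omega) h3]
    · split
      · rename_i a t1
        split_ifs with h4
        · subst h4
          have := R.br3 a j (by omega) (by omega) h5.1 h5.2 h2 h3
          simp only [wp_cons]
          calc _ = (s j * (s a * s j)) * wp s t1 := by group
            _ = (s a * (s j * s a)) * wp s t1 := by rw [this]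
            _ = _ := by group
        · rfl
      · rfl
    · split
      · rename_i a t1
        by_cases h4 : a = i
        · rw [if_pos h4]
          split
          · rename_i b t2
            split_ifs with h6
            · subst h4 h6
              have := R.br4 a b (by omega) (by omega) h5 h2 h3
              simp only [wp_cons]
              calc _ = (s b * (s a * (s b * s a))) * wp s t2 := by group
                _ = (s a * (s b * (s a * s b))) * wp s t2 := by rw [this]
                _ = _ := by group
            · rfl
          · rfl
        · rw [if_neg h4]
      · rfl
    · rfl
  · rfl

theorem Rels.mv {n : ℕ} {s : ℕ → W} (R : Rels n s) {k : ℕ} (hk : k ≤ n) (p : ℕ) (w : List ℕ) :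
    wp s (mv k p w) = wp s w := by
  induction p generalizing w with
  | zero => cases w <;> exact R.mv0 hk _
  | succ p ih =>
    cases w with
    | nil => rfl
    | cons a t => simp only [DescB.mv, wp_cons, ih]

theorem Rels.mvs {n : ℕ} {s : ℕ → W} (R : Rels n s) {k : ℕ} (hk : k ≤ n) (ps : List ℕ)
    (w : List ℕ) : wp s (mvs k ps w) = wp s w := by
  induction ps generalizing w with
  | nil => rfl
  | cons p ps ih =>
    have := ih (DescB.mv k p w)
    rw [R.mv hk] at this
    exact this

theorem Rels.closure {n : ℕ} {s : ℕ → W} (R : Rels n s) (hn : n ≤ 4) :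
    ∀ k, k ≤ n → ∀ ω ∈ WL k, ∀ i, i < k → ∃ ω' ∈ WL k, wp s ω' = wp s ω * s i := by
  intro k
  induction k with
  | zero => intro _ _ _ i hi; omega
  | succ k ih =>
    intro hk ω hω i hi
    rw [WL, List.mem_flatMap] at hω
    obtain ⟨ω0, h0, hω⟩ := hω
    rw [List.mem_map] at hω
    obtain ⟨c, hc, rfl⟩ := hω
    have hg := good_all (k + 1) (by simp; omega) c hc i (List.mem_range.2 hi)
    unfold good at hg
    have hr := R.mvs hk (((CT.getD (k + 1) []).getD c.length []).getD i []) (c ++ [i])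
    rcases hg with hg | ⟨i', hi', hg⟩
    · refine ⟨ω0 ++ _, List.mem_flatMap.2 ⟨ω0, h0, List.mem_map.2 ⟨_, hg, rfl⟩⟩, ?_⟩
      rw [wp_append, hr, wp_append, wp_append, mul_assoc]
      simp [wp]
    · rw [hg] at hr
      rw [List.mem_range] at hi'
      obtain ⟨ω1, h1, e1⟩ := ih (by omega) ω0 h0 i' (by omega)
      refine ⟨ω1 ++ c, List.mem_flatMap.2 ⟨ω1, h1, List.mem_map.2 ⟨_, hc, rfl⟩⟩, ?_⟩
      rw [wp_append, e1, wp_append, mul_assoc, ← wp_cons, hr, wp_append, mul_assoc]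
      simp [wp]

theorem Rels.cover {n : ℕ} {s : ℕ → W} (R : Rels n s) (hn : n ≤ 4) (w : W) :
    ∃ ω ∈ WL n, wp s ω = w := by
  refine R.gen (fun w => ∃ ω ∈ WL n, wp s ω = w) ?_ ?_ w
  · refine ⟨[], ?_, rfl⟩
    have : ∀ k, [] ∈ WL k := by
      intro k
      induction k with
      | zero => simp [WL]
      | succ k ih =>
        rw [WL, List.mem_flatMap]
        exact ⟨[], ih, List.mem_map.2 ⟨[], by simp [reps], rfl⟩⟩
    exact this n
  · rintro w i hi ⟨ω, hω, rfl⟩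
    exact R.closure hn n le_rfl ω hω i hi

end Words
end DescB

set_option maxHeartbeats 1000000
set_option synthInstance.maxHeartbeats 1000000

set_option linter.unusedSectionVars false
namespace DescB

/-! ### Digits -/

theorem pack_lt (B : ℕ) (f : ℕ → ℕ) (hf : ∀ k, f k < B) (m : ℕ) :
    ∑ k ∈ Finset.range m, f k * B ^ k < B ^ m := by
  induction m with
  | zero => simp
  | succ m ih =>
    rw [Finset.sum_range_succ, pow_succ]
    have := hf m
    calc _ < B ^ m + f m * B ^ m := by omega
      _ = (f m + 1) * B ^ m := by ring
      _ ≤ B * B ^ m := Nat.mul_le_mul_right _ this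
      _ = _ := by ring

theorem pack_digit (B : ℕ) (hB : 0 < B) (f : ℕ → ℕ) (hf : ∀ k, f k < B) (m j : ℕ) (hj : j < m) :
    (∑ k ∈ Finset.range m, f k * B ^ k) / B ^ j % B = f j := by
  have h1 : ∑ k ∈ Finset.range m, f k * B ^ k =
      (∑ k ∈ Finset.range j, f k * B ^ k) + B ^ j * (f j + B *
        ∑ k ∈ Finset.range (m - j - 1), f (j + 1 + k) * B ^ k) := by
    obtain ⟨r, rfl⟩ : ∃ r, m = j + 1 + r := ⟨m - j - 1, by omega⟩
    rw [Finset.sum_range_add, Finset.sum_range_succ]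
    have : j + 1 + r - j - 1 = r := by omega
    rw [this, mul_add, add_assoc, Finset.mul_sum, Finset.mul_sum, mul_comm (f j)]
    congr 2
    refine Finset.sum_congr rfl fun k _ => ?_
    ring
  rw [h1, Nat.add_mul_div_left _ _ (Nat.pow_pos hB), Nat.div_eq_of_lt (pack_lt B f hf j), zero_add,
    Nat.add_mul_mod_self_left, Nat.mod_eq_of_lt (hf j)]

/-! ### The permutation model -/

/-- The simple reflections as maps on eight points. -/
def sf : ℕ → Fin 8 → Fin 8
  | 0 => ![0, 1, 2, 4, 3, 5, 6, 7]
  | 1 => ![0, 1, 3, 2, 5, 4, 6, 7]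
  | 2 => ![0, 2, 1, 3, 4, 6, 5, 7]
  | 3 => ![1, 0, 2, 3, 4, 5, 7, 6]
  | _ => id

theorem sf_sf : ∀ i x, sf i (sf i x) = x
  | 0 => by decide
  | 1 => by decide
  | 2 => by decide
  | 3 => by decide
  | _ + 4 => fun _ => rfl

/-- The simple reflections as permutations of eight points. -/
def sP (i : ℕ) : Equiv.Perm (Fin 8) := ⟨sf i, sf i, sf_sf i, sf_sf i⟩

/-- One-line form. -/
def vals (σ : Equiv.Perm (Fin 8)) : List ℕ :=
  [(σ 0).1, (σ 1).1, (σ 2).1, (σ 3).1, (σ 4).1, (σ 5).1, (σ 6).1, (σ 7).1]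

/-- Right multiplication by a simple reflection in one-line form. -/
def step (i : ℕ) (v : List ℕ) : List ℕ :=
  match v with
  | [a, b, c, d, e, f, g, h] =>
    match i with
    | 0 => [a, b, c, e, d, f, g, h]
    | 1 => [a, b, d, c, f, e, g, h]
    | 2 => [a, c, b, d, e, g, f, h]
    | 3 => [b, a, c, d, e, f, h, g]
    | _ => v
  | _ => v

theorem vals_mul (σ : Equiv.Perm (Fin 8)) : ∀ i, vals (σ * sP i) = step i (vals σ)
  | 0 => rfl
  | 1 => rfl
  | 2 => rfl
  | 3 => rfl
  | _ + 4 => rfl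

/-- One-line form of a word. -/
def pv (ω : List ℕ) : List ℕ := ω.foldl (fun v i => step i v) [0, 1, 2, 3, 4, 5, 6, 7]

/-- `1` if `b < a`, else `0`. -/
def gt (a b : ℕ) : ℕ := match Nat.ble a b with | true => 0 | false => 1

/-- Right descent set, as a bit mask. -/
def des (v : List ℕ) : ℕ :=
  match v with
  | [_, _, _, d, e, f, g, h] => gt d e + (2 * gt e f + (4 * gt f g + 8 * gt g h))
  | _ => 0

/-- Coxeter length. -/
def len (v : List ℕ) : ℕ :=
  match v with
  | [a, b, c, d, e, f, g, h] =>
    gt a h + gt b h + gt c h + gt d h + gt e h + gt f h + gt g h +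
    gt b g + gt c g + gt d g + gt e g + gt f g + gt c f + gt d f + gt e f + gt d e
  | _ => 0

/-- Table of comparisons. -/
def cmpn (v : List ℕ) : ℕ := Nat.rec 0 (fun k ih => Nat.add ih
  (Nat.mul (gt (v.getD (Nat.div k 8) 0) (v.getD (Nat.mod k 8) 0)) (Nat.pow 2 k))) 64

theorem cmpn_eq (v : List ℕ) : cmpn v =
    ∑ k ∈ Finset.range 64, gt (v.getD (k / 8) 0) (v.getD (k % 8) 0) * 2 ^ k := by
  have h : ∀ m, ∑ k ∈ Finset.range m, gt (v.getD (k / 8) 0) (v.getD (k % 8) 0) * 2 ^ k =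
      Nat.rec 0 (fun k ih => Nat.add ih
        (Nat.mul (gt (v.getD (Nat.div k 8) 0) (v.getD (Nat.mod k 8) 0)) (Nat.pow 2 k))) m := by
    intro m
    induction m with
    | zero => rfl
    | succ m ih =>
      rw [Finset.sum_range_succ, ih]
      rfl
  rw [h]
  rfl

/-- Bit extraction. -/
def bitAt (c k : ℕ) : ℕ := (c.shiftRight k).mod 2

theorem gt_lt (a b : ℕ) : gt a b < 2 := by
  unfold gt
  split <;> norm_num

theorem gt_eq (a b : ℕ) : gt a b = if b < a then 1 else 0 := by
  unfold gt
  split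
  · rename_i h
    have := Nat.le_of_ble_eq_true h
    rw [if_neg (by omega)]
  · rename_i h
    have : ¬ a ≤ b := fun h' => by rw [Nat.ble_eq_true_of_le h'] at h; cases h
    rw [if_pos (by omega)]

theorem bitAt_cmpn (v : List ℕ) (a b : ℕ) (ha : a < 8) (hb : b < 8) :
    bitAt (cmpn v) (8 * a + b) = gt (v.getD a 0) (v.getD b 0) := by
  have h := pack_digit 2 (by norm_num) (fun k => gt (v.getD (k / 8) 0) (v.getD (k % 8) 0))
    (fun k => gt_lt _ _) 64 (8 * a + b) (by omega)
  have h1 : (8 * a + b) / 8 = a := by omega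
  have h2 : (8 * a + b) % 8 = b := by omega
  simp only [h1, h2] at h
  rw [← h]
  change (cmpn v >>> (8 * a + b)) % 2 = _
  rw [Nat.shiftRight_eq_div_pow, cmpn_eq]

attribute [irreducible] cmpn

/-- Row of the table `CL`. -/
def row (v : List ℕ) : ℕ × ℕ × ℕ × ℕ × ℕ :=
  match v with
  | [_, _, _, d, e, f, g, h] => (des v, 8 * d + e, 8 * e + f, 8 * f + g, 8 * g + h)
  | _ => (0, 0, 0, 0, 0)

/-- The packed structure constants. -/
def NN (N k0 k1 k2 k3 : ℕ) (l : List (ℕ × ℕ)) : ℕ :=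
  List.rec 0 (fun x _ ih => Nat.add (Nat.pow 1024 (Nat.add (Nat.mul N x.1)
    (Nat.add (bitAt x.2 k0) (Nat.add (Nat.mul 2 (bitAt x.2 k1))
    (Nat.add (Nat.mul 4 (bitAt x.2 k2)) (Nat.mul 8 (bitAt x.2 k3))))))) ih) l

theorem NN_eq (N k0 k1 k2 k3 : ℕ) (l : List (ℕ × ℕ)) : NN N k0 k1 k2 k3 l =
    (l.map fun x => 1024 ^ (N * x.1 + (bitAt x.2 k0 + (2 * bitAt x.2 k1 +
      (4 * bitAt x.2 k2 + 8 * bitAt x.2 k3))))).sum := by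
  induction l with
  | nil => rfl
  | cons x l ih =>
    rw [List.map_cons, List.sum_cons, ← ih]
    rfl

attribute [irreducible] NN

theorem des_mul (u w : Equiv.Perm (Fin 8)) {r : ℕ × ℕ × ℕ × ℕ × ℕ} (hr : r = row (vals w)) :
    des (vals (u * w)) = bitAt (cmpn (vals u)) r.2.1 + (2 * bitAt (cmpn (vals u)) r.2.2.1 +
      (4 * bitAt (cmpn (vals u)) r.2.2.2.1 + 8 * bitAt (cmpn (vals u)) r.2.2.2.2)) := by
  have key : ∀ x : Fin 8, (vals u).getD x.1 0 = (u x).1 := by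
    intro x
    fin_cases x <;> rfl
  subst hr
  have hrow : row (vals w) = (des (vals w), 8 * (w 3).1 + (w 4).1, 8 * (w 4).1 + (w 5).1,
    8 * (w 5).1 + (w 6).1, 8 * (w 6).1 + (w 7).1) := rfl
  rw [hrow]
  dsimp only
  rw [bitAt_cmpn _ _ _ (w 3).2 (w 4).2, bitAt_cmpn _ _ _ (w 4).2 (w 5).2,
    bitAt_cmpn _ _ _ (w 5).2 (w 6).2, bitAt_cmpn _ _ _ (w 6).2 (w 7).2]
  simp only [key]
  rfl

/-- The length check. -/
def chkL (n : ℕ) (v : List ℕ) (l : ℕ) : Bool :=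
  Nat.beq (len v) l && (List.range n).all fun i =>
    match bitAt (des v) i with
    | 0 => Nat.beq (len (step i v)) (l + 1)
    | _ => Nat.beq (len (step i v) + 1) l

/-- Duplicate check by hashing; `acc` is the bit set of the hashes seen so far. -/
def ndB (l : List (ℕ × ℕ)) : ℕ → Bool :=
  List.rec (fun _ => true) (fun x _ ih acc => and (Nat.beq (bitAt acc (Nat.mod x.2 6021)) 0)
    (ih (Nat.add acc (Nat.pow 2 (Nat.mod x.2 6021))))) l

theorem ndB_nodup (l : List (ℕ × ℕ)) (s : Finset ℕ) (h : ndB l (∑ i ∈ s, 2 ^ i) = true) :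
    (l.map Prod.snd).Nodup ∧ ∀ x ∈ l, x.2 % 6021 ∉ s := by
  induction l generalizing s with
  | nil => simp
  | cons x l ih =>
    have h' : (Nat.beq (bitAt (∑ i ∈ s, 2 ^ i) (x.2 % 6021)) 0 &&
      ndB l ((∑ i ∈ s, 2 ^ i) + 2 ^ (x.2 % 6021))) = true := h
    rw [Bool.and_eq_true] at h'
    have h1 := Nat.eq_of_beq_eq_true h'.1
    have hx : x.2 % 6021 ∉ s := by
      intro hx
      have e : (∑ i ∈ s, 2 ^ i) / 2 ^ (x.2 % 6021) % 2 = 0 := by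
        rw [← h1]
        change _ = (_ >>> _) % 2
        rw [Nat.shiftRight_eq_div_pow]
      have hb : (∑ i ∈ s, 2 ^ i).testBit (x.2 % 6021) = true := by
        rw [← Nat.mem_bitIndices, ← List.mem_toFinset, Finset.toFinset_bitIndices_sum_two_pow]
        exact hx
      rw [Nat.testBit_eq_decide_div_mod_eq, e] at hb
      simp at hb
    have h2 := ih (insert (x.2 % 6021) s) (by rw [Finset.sum_insert hx, add_comm]; exact h'.2)
    refine ⟨?_, ?_⟩
    · rw [List.map_cons, List.nodup_cons]
      refine ⟨?_, h2.1⟩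
      intro hm
      obtain ⟨y, hy, hyx⟩ := List.mem_map.1 hm
      apply h2.2 y hy
      rw [hyx]
      exact Finset.mem_insert_self _ _
    · intro y hy
      rcases List.mem_cons.1 hy with rfl | hy
      · exact hx
      · exact fun hs => h2.2 y hy (Finset.mem_insert_of_mem hs)

/-- All the tables. -/
structure Tables (n : ℕ) where
  EL : List (ℕ × ℕ)
  CL : List (ℕ × ℕ × ℕ × ℕ × ℕ)
  TL : List ℕ
  hE : (WL n).map (fun ω => (des (pv ω.reverse), cmpn (pv ω))) = EL
  hC : (WL n).map (fun ω => row (pv ω)) = CL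
  hN : CL.all (fun r => Nat.beq (NN (2 ^ n) r.2.1 r.2.2.1 r.2.2.2.1 r.2.2.2.2 EL) (TL.getD r.1 0)
    && Nat.ble (r.1 + 1) (2 ^ n)) = true
  hL : (WL n).all (fun ω => chkL n (pv ω) ω.length && ω.all fun i => Nat.ble (i + 1) n) = true
  hnd : ndB EL 0 = true
  hlen : EL.length < 1024

section Model

variable {W : Type*} [Group W] {n : ℕ} {s : ℕ → W}

theorem vals_wp (φ : W →* Equiv.Perm (Fin 8)) (hφ : ∀ i, i < n → φ (s i) = sP i) (ω : List ℕ)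
    (hω : ∀ i ∈ ω, i < n) : vals (φ (wp s ω)) = pv ω := by
  induction ω using List.reverseRecOn with
  | nil => simp [wp, pv, vals]
  | append_singleton ω i ih =>
    rw [wp_append, map_mul]
    have : wp s [i] = s i := by simp [wp]
    rw [this, hφ i (hω i (by simp)), vals_mul, ih (fun j hj => hω j (by simp [hj]))]
    simp [pv]

theorem wp_reverse (R : Rels n s) (ω : List ℕ) (hω : ∀ i ∈ ω, i < n) :
    wp s ω.reverse = (wp s ω)⁻¹ := by
  induction ω with
  | nil => simp [wp]
  | cons i ω ih =>
    have : wp s [i] = s i := by simp [wp]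
    rw [List.reverse_cons, wp_append, this, wp_cons, ih (fun j hj => hω j (by simp [hj])), mul_inv_rev,
      inv_eq_of_mul_eq_one_left (R.sq i (hω i (by simp)))]

/-- The descent set of a group element. -/
def desW (φ : W →* Equiv.Perm (Fin 8)) (w : W) : ℕ := des (vals (φ w))

variable (T : Tables n) (R : Rels n s) (hn : n ≤ 4) (φ : W →* Equiv.Perm (Fin 8))
  (hφ : ∀ i, i < n → φ (s i) = sP i)
include T R hn hφ

theorem lt_of_mem {ω : List ℕ} (hω : ω ∈ WL n) : ∀ i ∈ ω, i < n := by
  have h := List.all_eq_true.1 T.hL ω hω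
  rw [Bool.and_eq_true] at h
  intro i hi
  have := List.all_eq_true.1 h.2 i hi
  exact Nat.le_of_ble_eq_true this

theorem chkL_of_mem {ω : List ℕ} (hω : ω ∈ WL n) : chkL n (pv ω) ω.length = true := by
  have h := List.all_eq_true.1 T.hL ω hω
  rw [Bool.and_eq_true] at h
  exact h.1

theorem nodup_wp : ((WL n).map (wp s)).Nodup := by
  have h := (ndB_nodup T.EL ∅ T.hnd).1
  rw [← T.hE, List.map_map] at h
  have h' : ((WL n).map fun ω => cmpn (pv ω)).Nodup := h
  rw [List.nodup_map_iff_inj_on h'.of_map]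
  intro ω hω ω' hω' e
  refine List.inj_on_of_nodup_map h' hω hω' ?_
  have := congrArg (fun w => vals (φ w)) e
  simp only [vals_wp φ hφ ω (lt_of_mem T R hn φ hφ hω),
    vals_wp φ hφ ω' (lt_of_mem T R hn φ hφ hω')] at this
  change cmpn (pv ω) = cmpn (pv ω')
  rw [this]

theorem sum_eq [Fintype W] {M : Type*} [AddCommMonoid M] (f : W → M) :
    ∑ w, f w = ((WL n).map fun ω => f (wp s ω)).sum := by
  classical
  have h : (Finset.univ : Finset W) = ((WL n).map (wp s)).toFinset := by
    ext w
    obtain ⟨ω, h1, h2⟩ := R.cover hn w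
    simp only [Finset.mem_univ, List.mem_toFinset, List.mem_map, true_iff]
    exact ⟨ω, h1, h2⟩
  rw [h, List.sum_toFinset _ (nodup_wp T R hn φ hφ), List.map_map]
  rfl

theorem pack_eq [Fintype W] (w : W) :
    ∑ u, 1024 ^ (2 ^ n * desW φ u⁻¹ + desW φ (u * w)) = T.TL.getD (desW φ w) 0 := by
  obtain ⟨ω, hω, rfl⟩ := R.cover hn w
  have hv := vals_wp φ hφ ω (lt_of_mem T R hn φ hφ hω)
  have hrow : row (pv ω) ∈ T.CL := by
    rw [← T.hC]
    exact List.mem_map.2 ⟨ω, hω, rfl⟩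
  have h := List.all_eq_true.1 T.hN _ hrow
  rw [Bool.and_eq_true] at h
  have h1 := Nat.eq_of_beq_eq_true h.1
  have e1 : (row (pv ω)).1 = desW φ (wp s ω) := by
    rw [desW, ← hv]
    rfl
  rw [e1] at h1
  rw [← h1, NN_eq, ← T.hE, List.map_map, sum_eq T R hn φ hφ]
  congr 1
  refine List.map_congr_left fun ω' hω' => ?_
  have hl := lt_of_mem T R hn φ hφ hω'
  have e2 : desW φ (wp s ω')⁻¹ = des (pv ω'.reverse) := by
    rw [desW, ← wp_reverse R ω' hl, vals_wp φ hφ _ (by simpa using hl)]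
  have e3 := des_mul (φ (wp s ω')) (φ (wp s ω)) (r := row (pv ω)) (by rw [hv])
  rw [vals_wp φ hφ ω' hl] at e3
  rw [e2, desW, map_mul, e3, Function.comp_apply]

theorem desW_lt (w : W) : desW φ w < 2 ^ n := by
  obtain ⟨ω, hω, rfl⟩ := R.cover hn w
  have hv := vals_wp φ hφ ω (lt_of_mem T R hn φ hφ hω)
  have hrow : row (pv ω) ∈ T.CL := by
    rw [← T.hC]
    exact List.mem_map.2 ⟨ω, hω, rfl⟩
  have h := List.all_eq_true.1 T.hN _ hrow
  rw [Bool.and_eq_true] at h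
  have h1 := Nat.le_of_ble_eq_true h.2
  have e1 : (row (pv ω)).1 = desW φ (wp s ω) := by
    rw [desW, ← hv]
    rfl
  rw [e1] at h1
  exact h1

theorem count_eq [Fintype W] {M : Type*} [Semiring M] (f : ℕ → M) (w : W) :
    ∑ u, f (2 ^ n * desW φ u⁻¹ + desW φ (u * w)) =
      ∑ k ∈ Finset.range (2 ^ n * 2 ^ n),
        ((T.TL.getD (desW φ w) 0 / 1024 ^ k % 1024 : ℕ) : M) * f k := by
  classical
  let key : W → ℕ := fun u => 2 ^ n * desW φ u⁻¹ + desW φ (u * w)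
  have hkey : ∀ u ∈ (Finset.univ : Finset W), key u ∈ Finset.range (2 ^ n * 2 ^ n) := by
    intro u _
    have h1 := desW_lt T R hn φ hφ u⁻¹
    have h2 := desW_lt T R hn φ hφ (u * w)
    rw [Finset.mem_range]
    calc key u < 2 ^ n * desW φ u⁻¹ + 2 ^ n := by simp only [key]; omega
      _ = 2 ^ n * (desW φ u⁻¹ + 1) := by ring
      _ ≤ _ := Nat.mul_le_mul_left _ h1
  let c : ℕ → ℕ := fun k => (Finset.univ.filter fun u : W => key u = k).card
  have gen : ∀ {M : Type _} [Semiring M] (f : ℕ → M), ∑ u, f (key u) =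
      ∑ k ∈ Finset.range (2 ^ n * 2 ^ n), (c k : M) * f k := by
    intro M _ f
    rw [← Finset.sum_fiberwise_of_maps_to hkey]
    refine Finset.sum_congr rfl fun k _ => ?_
    rw [Finset.sum_congr rfl (g := fun _ => f k)]
    · rw [Finset.sum_const, nsmul_eq_mul]
    · intro u hu
      rw [(Finset.mem_filter.1 hu).2]
  have gen0 : ∑ u, 1024 ^ (key u) = ∑ k ∈ Finset.range (2 ^ n * 2 ^ n), c k * 1024 ^ k := by
    rw [← Finset.sum_fiberwise_of_maps_to hkey]
    refine Finset.sum_congr rfl fun k _ => ?_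
    rw [Finset.sum_congr rfl (g := fun _ => 1024 ^ k)]
    · rw [Finset.sum_const, nsmul_eq_mul]
      rfl
    · intro u hu
      rw [(Finset.mem_filter.1 hu).2]
  have hc : ∀ k, c k < 1024 := by
    intro k
    refine lt_of_le_of_lt (Finset.card_le_univ _) ?_
    have h1 : Fintype.card W = ∑ _w : W, 1 := by simp
    rw [h1, sum_eq T R hn φ hφ, List.map_const', List.sum_replicate, smul_eq_mul, mul_one]
    have := T.hlen
    rwa [← T.hE, List.length_map] at this
  rw [gen f, ← pack_eq T R hn φ hφ w]
  refine Finset.sum_congr rfl fun k hk => ?_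
  rw [gen0, pack_digit 1024 (by norm_num) c hc _ k (Finset.mem_range.1 hk)]

theorem len_step (w : W) (i : ℕ) (hi : i < n) :
    (bitAt (desW φ w) i = 0 → len (vals (φ (w * s i))) = len (vals (φ w)) + 1) ∧
    (bitAt (desW φ w) i ≠ 0 → len (vals (φ (w * s i))) + 1 = len (vals (φ w))) := by
  obtain ⟨ω, hω, rfl⟩ := R.cover hn w
  have hv := vals_wp φ hφ ω (lt_of_mem T R hn φ hφ hω)
  have h := chkL_of_mem T R hn φ hφ hω
  unfold chkL at h
  rw [Bool.and_eq_true] at h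
  have h1 := Nat.eq_of_beq_eq_true h.1
  have h2 := List.all_eq_true.1 h.2 i (List.mem_range.2 hi)
  rw [map_mul, hφ i hi, vals_mul, hv, desW, hv, h1]
  constructor
  · intro h0
    rw [h0] at h2
    exact Nat.eq_of_beq_eq_true h2
  · intro h0
    split at h2
    · contradiction
    · exact Nat.eq_of_beq_eq_true h2

theorem len_le (w : W) : ∃ ω, (∀ i ∈ ω, i < n) ∧ wp s ω = w ∧ ω.length = len (vals (φ w)) := by
  obtain ⟨ω, hω, rfl⟩ := R.cover hn w
  refine ⟨ω, lt_of_mem T R hn φ hφ hω, rfl, ?_⟩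
  have h := chkL_of_mem T R hn φ hφ hω
  unfold chkL at h
  rw [Bool.and_eq_true] at h
  have h1 := Nat.eq_of_beq_eq_true h.1
  rw [vals_wp φ hφ ω (lt_of_mem T R hn φ hφ hω), h1]

end Model
end DescB

set_option maxRecDepth 100000
namespace DescB

/-- Table for `n = 2`. -/
def EL2 : List (ℕ × ℕ) :=
  [(0, 9169081515752227072), (2, 9169064060938551552), (2, 9169072668925952256), (2,
  9169050850159165696), (1, 9169081481660924160), (1, 9169059662894137600), (1,
  9169068270881538304), (3, 9169050816067862784)]

/-- Table for `n = 2`. -/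
def CL2 : List (ℕ × ℕ × ℕ × ℕ × ℕ) :=
  [(0, 28, 37, 46, 55), (2, 21, 44, 38, 55), (1, 42, 20, 38, 55), (2, 28, 34, 22, 55), (1, 35, 29,
  46, 55), (2, 21, 43, 30, 55), (1, 42, 19, 30, 55), (3, 35, 26, 22, 55)]

/-- Table for `n = 2`. -/
def TL2 : List ℕ :=
  [1427247692705962417597426466348851709108813825, 1393796576207507049519957968003422304076800,
  1361129468952643604228578494249775923200, 1329229265911396182010938016976076800]

/-- The tables for `n = 2`. -/
def tables2 : Tables 2 where
  EL := EL2
  CL := CL2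
  TL := TL2
  hE := by decide +kernel
  hC := by decide +kernel
  hN := by decide +kernel
  hL := by decide +kernel
  hnd := by decide +kernel
  hlen := by decide +kernel

/-- Table for `n = 3`. -/
def EL3 : List (ℕ × ℕ) :=
  [(0, 9169081515752227072), (4, 9160144685241533696), (4, 9164560736155535616), (4,
  9166820861596078336), (4, 9167922751233270016), (4, 9151698504249343232), (2,
  9169064060938551552), (2, 9155641360458517760), (6, 9155623905644842240), (6,
  9157884031085384960), (6, 9163419426450254080), (6, 9151681049435667712), (2,
  9169072668925952256), (2, 9157892843820356864), (2, 9163428239185225984), (2,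
  9165688364625768704), (6, 9165670909812093184), (6, 9151689657423068416), (2,
  9169050850159165696), (2, 9152826603175238912), (2, 9153932856765541632), (2,
  9156192982206084352), (2, 9160604669166975232), (6, 9151667838656281856), (1,
  9169081481660924160), (5, 9160144651150230784), (5, 9164556338111121664), (5,
  9166816463551664384), (5, 9167922717141967104), (5, 9151698470158040320), (1,
  9169059662894137600), (1, 9155078410505112832), (5, 9155060955691437312), (5,
  9157321081131980032), (5, 9162856476496849152), (5, 9151676651391253760), (1,
  9169068270881538304), (1, 9157329893866951936), (1, 9162865289231821056), (1,
  9165125414672363776), (5, 9165107959858688256), (5, 9151685259378654464), (3,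
  9169050816067862784), (3, 9152826569083936000), (3, 9153928458721127680), (3,
  9156188584161670400), (3, 9160604635075672320), (7, 9151667804564978944)]

/-- Table for `n = 3`. -/
def CL3 : List (ℕ × ℕ × ℕ × ℕ × ℕ) :=
  [(0, 28, 37, 46, 55), (4, 28, 38, 53, 47), (2, 14, 52, 37, 47), (1, 49, 12, 37, 47), (2, 28, 33,
  13, 47), (4, 28, 37, 41, 15), (2, 21, 44, 38, 55), (4, 21, 46, 52, 39), (6, 14, 53, 44, 39), (5,
  49, 13, 44, 39), (2, 21, 41, 12, 39), (6, 21, 44, 33, 15), (1, 42, 20, 38, 55), (5, 42, 22, 52,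
  39), (2, 14, 50, 20, 39), (1, 49, 10, 20, 39), (3, 42, 17, 12, 39), (5, 42, 20, 33, 15), (2, 28,
  34, 22, 55), (4, 28, 38, 50, 23), (6, 14, 52, 34, 23), (5, 49, 12, 34, 23), (2, 28, 33, 10, 23),
  (6, 28, 34, 17, 15), (1, 35, 29, 46, 55), (5, 35, 30, 53, 47), (2, 14, 51, 29, 47), (1, 49, 11,
  29, 47), (3, 35, 25, 13, 47), (5, 35, 29, 41, 15), (2, 21, 43, 30, 55), (4, 21, 46, 51, 31), (6,
  14, 53, 43, 31), (5, 49, 13, 43, 31), (2, 21, 41, 11, 31), (6, 21, 43, 25, 15), (1, 42, 19, 30,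
  55), (5, 42, 22, 51, 31), (2, 14, 50, 19, 31), (1, 49, 10, 19, 31), (3, 42, 17, 11, 31), (5, 42,
  19, 25, 15), (3, 35, 26, 22, 55), (5, 35, 30, 50, 23), (6, 14, 51, 26, 23), (5, 49, 11, 26, 23),
  (3, 35, 25, 10, 23), (7, 35, 26, 17, 15)]

/-- Table for `n = 3`. -/
def TL3 : List ℕ :=
  [4455508415646675018204269156996113410028913900296907074726632509549817612855640594911428966589798724752040732856556922061101492330247136716054756641461436025554890479274860490938169870516225,
  4351082437154956072468799303549940209874155152119797433758824835761463417198833040993664882176832924192298972053499909357483646174142210309221648879070595270448535377792769525572358374400,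
  4249103942534136789520311819872988486205232692304594276994522653123387664516527075496353581728594749355159259068148353174524969413523216504498374757313215523847580515393604677769625600,
  4149515568880992962122086660933785526366364354498286731860546547079638883343792884707972537974118252006140632396671290662238011112720610628457087094301565975926820558587449206374400,
  4052261297735348288693088702705228963896318446079840524636544519763788903783356408648997088800282593470296160743786400692630000535794941484617177292475019580917674739347593625600,
  3957286423573275190786787334235635154418642965811603258731078891302764835694739286136670468892664742452682195568757751119056838726545771618845901596955380383196242661238374400,
  3864537523020776553502722006089490435522889194896597905501386259368204187043716105437603617371208771386050404753848996171460797566534233804029108137647018420497133705625600,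
  3773962428339750159614863287258330470410266444879832600570827954741608090730031236595020476051130600823279013434745179834805133689357800969098490655991296547508086374400]

/-- The tables for `n = 3`. -/
def tables3 : Tables 3 where
  EL := EL3
  CL := CL3
  TL := TL3
  hE := by decide +kernel
  hC := by decide +kernel
  hN := by decide +kernel
  hL := by decide +kernel
  hnd := by decide +kernel
  hlen := by decide +kernel

/-- Table for `n = 4`. -/
def EL4 : List (ℕ × ℕ) :=
  [(0, 9169081515752227072), (8, 4593424294343802882), (8, 6854442413516129540), (8,
  8011639781287725320), (8, 8590360107145171216), (8, 8879691275578319136), (8,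
  9007301841196809536), (8, 53654580554268926), (4, 9160144685241533696), (4,
  2287722022618398726), (12, 2278785192107705350), (12, 3435982559879301130), (12,
  4014702885736747026), (12, 4304034054169894946), (12, 6701599569471405380), (12,
  44717750043575550), (4, 9164560736155535616), (4, 3440485884662317066), (4,
  5697018133865303308), (12, 5697000679051627788), (12, 6275721004909073684), (12,
  7722266995927492904), (12, 7854363431515323720), (12, 49133800957577470), (4,
  9166820861596078336), (4, 4016954693066620946), (4, 6275729817644045588), (4,
  7722275808662464808), (4, 8300996134519910704), (12, 8300978679706235184), (12,
  8430832239919627600), (12, 51393926398120190), (4, 9167922751233270016), (4,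
  4305162153095790626), (4, 6702727668397301060), (4, 7856615238845197640), (4,
  8435335564702643536), (4, 8727976530459490656), (12, 8719039699948797280), (12,
  52495816035311870), (4, 9151698504249343232), (4, 198051243606802622), (4, 332949225698526430),
  (4, 625594555408484590), (4, 1204314881265930486), (4, 2358198087760716026), (4,
  4611928790459809276), (12, 36271569051385086), (2, 9169064060938551552), (10,
  4593406839530127362), (10, 6849939088733113604), (10, 8002702950777031944), (10,
  8581423276634477840), (10, 8875187950795303200), (10, 9007284386383134016), (10,
  53637125740593406), (2, 9155641360458517760), (2, 1134801067750588430), (10,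
  1125864237239895054), (10, 1130280288153896974), (10, 1709000614011342870), (10,
  3151113099302084650), (10, 5548678614603595084), (10, 40214425260559614), (6,
  9155623905644842240), (6, 1134783612936912910), (6, 1121360912456879118), (14,
  1121343457643203598), (14, 1700063783500649494), (14, 3146609774519068714), (14,
  5548661159789919564), (14, 40196970446884094), (6, 9157884031085384960), (6,
  1711252421341216790), (6, 1700072596235621398), (6, 3146618587254040618), (6,
  3725338913111486514), (14, 3725321458297810994), (14, 6125129968194223444), (14,
  42457095887426814), (6, 9163419426450254080), (6, 3152241198227980330), (6,
  5549806713529490764), (6, 5550912967119793484), (6, 6129633292977239380), (6,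
  7575055575591680360), (14, 7566118745080986984), (14, 47992491252295934), (6,
  9151681049435667712), (6, 198033788793127102), (6, 328445900915510494), (6, 616657724897791214),
  (6, 1195378050755237110), (6, 2353694762977700090), (6, 4611911335646133756), (14,
  36254114237709566), (2, 9169072668925952256), (10, 4593415447517528066), (10,
  6852190572094952708), (10, 8010507284317415688), (10, 8589227610174861584), (10,
  8877439434157142304), (10, 9007292994370534720), (10, 53645733727994110), (2,
  9157892843820356864), (2, 1711261234076188694), (10, 1702324403565495318), (10,
  3147746686179936298), (10, 3726467012037382194), (10, 3727573265627684914), (10,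
  6125138780929195348), (10, 42465908622398718), (2, 9163428239185225984), (2,
  3152250010962952234), (2, 5552058520859364684), (10, 5552041066045689164), (10,
  6130761391903135060), (10, 7577307382921554280), (10, 7566127557815958888), (10,
  48001303987267838), (2, 9165688364625768704), (2, 3728718819367256114), (2,
  6130770204638106964), (2, 7577316195656526184), (2, 8156036521513972080), (10,
  8156019066700296560), (10, 8142596366220262768), (10, 50261429427810558), (6,
  9165670909812093184), (6, 3728701364553580594), (6, 6126266879855091028), (6,
  7568379365145832808), (6, 8147099691003278704), (6, 8151515741917280624), (14,
  8142578911406587248), (14, 50243974614135038), (6, 9151689657423068416), (6,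
  198042396780527806), (6, 330697384277349598), (6, 624462058438174958), (6, 1203182384295620854),
  (6, 2355946246339539194), (6, 4611919943633534460), (14, 36262722225110270), (2,
  9169050850159165696), (10, 4593393628750741506), (10, 6847124331449834756), (10,
  8001011901897731336), (10, 8579732227755177232), (10, 8872373193512024352), (10,
  9007271175603748160), (10, 53623914961207550), (2, 9152826603175238912), (2,
  486282719261753502), (10, 477345888751060126), (10, 769991218461018286), (10,
  1348711544318464182), (10, 2502594750813249722), (10, 4900160266114760156), (10,
  37399667977280766), (2, 9153932856765541632), (2, 774494543244034222), (2, 904906655366417614),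
  (10, 904889200552742094), (10, 1483609526410187990), (10, 2930155517428607210), (10,
  5188372090097040876), (10, 38505921567583486), (2, 9156192982206084352), (2,
  1350963351648338102), (2, 1483618339145159894), (2, 2930164330163579114), (2,
  3508884656021025010), (10, 3508867201207349490), (10, 5764840898501344756), (10,
  40766047008126206), (2, 9160604669166975232), (2, 2503722849739145402), (2,
  4901288365040655836), (2, 5190623897426914796), (2, 5769344223284360692), (2,
  6926537227102845432), (10, 6917600396592152056), (10, 45177733969017086), (6,
  9151667838656281856), (6, 198020578013741246), (6, 325631143632231646), (6, 614966676018490606),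
  (6, 1193687001875936502), (6, 2350880005694421242), (6, 4611898124866747900), (14,
  36240903458323710), (1, 9169081481660924160), (9, 4593424260252499970), (9,
  6854442379424826628), (9, 8011635383243311368), (9, 8590355709100757264), (9,
  8879691241487016224), (9, 9007301807105506624), (9, 53654546462966014), (5,
  9160144651150230784), (5, 2287721988527095814), (13, 2278785158016402438), (13,
  3435978161834887178), (13, 4014698487692333074), (13, 4304034020078592034), (13,
  6701599535380102468), (13, 44717715952272638), (5, 9164556338111121664), (5,
  3440481486617903114), (5, 5696455183911898380), (13, 5696437729098222860), (13,
  6275158054955668756), (13, 7721704045974087976), (13, 7854359033470909768), (13,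
  49129402913163518), (5, 9166816463551664384), (5, 4016950295022206994), (5,
  6275166867690640660), (5, 7721712858709059880), (5, 8300433184566505776), (13,
  8300415729752830256), (13, 8430827841875213648), (13, 51389528353706238), (5,
  9167922717141967104), (5, 4305162119004487714), (5, 6702727634305998148), (5,
  7856610840800783688), (5, 8435331166658229584), (5, 8727976496368187744), (13,
  8719039665857494368), (13, 52495781944008958), (5, 9151698470158040320), (5,
  198051209515499710), (5, 332949191607223518), (5, 625590157364070638), (5, 1204310483221516534),
  (5, 2358198053669413114), (5, 4611928756368506364), (13, 36271534960082174), (1,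
  9169059662894137600), (9, 4593402441485713410), (9, 6849376138779708676), (9,
  8002140000823627016), (9, 8580860326681072912), (9, 8874625000841898272), (9,
  9007279988338720064), (9, 53632727696179454), (1, 9155078410505112832), (1,
  1062743473712660622), (9, 1053806643201967246), (9, 1058222694115969166), (9,
  1636943019973415062), (9, 3079055505264156842), (9, 5476621020565667276), (9,
  39651475307154686), (5, 9155060955691437312), (5, 1062726018898985102), (5,
  1049303318418951310), (13, 1049285863605275790), (13, 1628006189462721686), (13,
  3074552180481140906), (13, 5476603565751991756), (13, 39634020493479166), (5,
  9157321081131980032), (5, 1639194827303288982), (5, 1628015002197693590), (5,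
  3074560993216112810), (5, 3653281319073558706), (13, 3653263864259883186), (13,
  6053072374156295636), (13, 41894145934021886), (5, 9162856476496849152), (5,
  3080183604190052522), (5, 5477749119491562956), (5, 5478855373081865676), (5,
  6057575698939311572), (5, 7502997981553752552), (13, 7494061151043059176), (13,
  47429541298891006), (5, 9151676651391253760), (5, 198029390748713150), (5, 327882950962105566),
  (5, 616094774944386286), (5, 1194815100801832182), (5, 2353131813024295162), (5,
  4611906937601719804), (13, 36249716193295614), (1, 9169068270881538304), (9,
  4593411049473114114), (9, 6851627622141547780), (9, 8009944334364010760), (9,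
  8588664660221456656), (9, 8876876484203737376), (9, 9007288596326120768), (9,
  53641335683580158), (1, 9157329893866951936), (1, 1639203640038260886), (9,
  1630266809527567510), (9, 3075689092142008490), (9, 3654409417999454386), (9,
  3655515671589757106), (9, 6053081186891267540), (9, 41902958668993790), (1,
  9162865289231821056), (1, 3080192416925024426), (1, 5480000926821436876), (9,
  5479983472007761356), (9, 6058703797865207252), (9, 7505249788883626472), (9,
  7494069963778031080), (9, 47438354033862910), (1, 9165125414672363776), (1,
  3656661225329328306), (1, 6058712610600179156), (1, 7505258601618598376), (1,
  8083978927476044272), (9, 8083961472662368752), (9, 8070538772182334960), (9,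
  49698479474405630), (5, 9165107959858688256), (5, 3656643770515652786), (5,
  6054209285817163220), (5, 7496321771107905000), (5, 8075042096965350896), (5,
  8079458147879352816), (13, 8070521317368659440), (13, 49681024660730110), (5,
  9151685259378654464), (5, 198037998736113854), (5, 330134434323944670), (5, 623899108484770030),
  (5, 1202619434342215926), (5, 2355383296386134266), (5, 4611915545589120508), (13,
  36258324180696318), (3, 9169050816067862784), (11, 4593393594659438594), (11,
  6847124297358531844), (11, 8001007503853317384), (11, 8579727829710763280), (11,
  8872373159420721440), (11, 9007271141512445248), (11, 53623880869904638), (3,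
  9152826569083936000), (3, 486282685170450590), (11, 477345854659757214), (11,
  769986820416604334), (11, 1348707146274050230), (11, 2502594716721946810), (11,
  4900160232023457244), (11, 37399633885977854), (3, 9153928458721127680), (3,
  774490145199620270), (3, 904343705413012686), (11, 904326250599337166), (11,
  1483046576456783062), (11, 2929592567475202282), (11, 5188367692052626924), (11,
  38501523523169534), (3, 9156188584161670400), (3, 1350958953603924150), (3,
  1483055389191754966), (3, 2929601380210174186), (3, 3508321706067620082), (11,
  3508304251253944562), (11, 5764836500456930804), (11, 40761648963712254), (3,
  9160604635075672320), (3, 2503722815647842490), (3, 4901288330949352924), (3,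
  5190619499382500844), (3, 5769339825239946740), (3, 6926537193011542520), (11,
  6917600362500849144), (11, 45177699877714174), (7, 9151667804564978944), (7,
  198020543922438334), (7, 325631109540928734), (7, 614962277974076654), (7, 1193682603831522550),
  (7, 2350879971603118330), (7, 4611898090775444988), (15, 36240869367020798)]

/-- Table for `n = 4`. -/
def CL4 : List (ℕ × ℕ × ℕ × ℕ × ℕ) :=
  [(0, 28, 37, 46, 55), (8, 28, 37, 47, 62), (4, 28, 39, 61, 46), (2, 7, 60, 37, 46), (1, 56, 4,
  37, 46), (2, 28, 32, 5, 46), (4, 28, 37, 40, 6), (8, 28, 37, 46, 48), (4, 28, 38, 53, 47), (8,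
  28, 38, 55, 61), (12, 28, 39, 62, 53), (10, 7, 60, 38, 53), (9, 56, 4, 38, 53), (10, 28, 32, 6,
  53), (4, 28, 38, 48, 5), (12, 28, 38, 53, 40), (2, 14, 52, 37, 47), (10, 14, 52, 39, 61), (4,
  14, 55, 60, 37), (6, 7, 62, 52, 37), (5, 56, 6, 52, 37), (2, 14, 48, 4, 37), (6, 14, 52, 32, 5),
  (10, 14, 52, 37, 40), (1, 49, 12, 37, 47), (9, 49, 12, 39, 61), (5, 49, 15, 60, 37), (2, 7, 57,
  12, 37), (1, 56, 1, 12, 37), (3, 49, 8, 4, 37), (5, 49, 12, 32, 5), (9, 49, 12, 37, 40), (2, 28,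
  33, 13, 47), (10, 28, 33, 15, 61), (4, 28, 39, 57, 13), (6, 7, 60, 33, 13), (5, 56, 4, 33, 13),
  (2, 28, 32, 1, 13), (6, 28, 33, 8, 5), (10, 28, 33, 13, 40), (4, 28, 37, 41, 15), (8, 28, 37,
  47, 57), (12, 28, 39, 61, 41), (10, 7, 60, 37, 41), (9, 56, 4, 37, 41), (10, 28, 32, 5, 41), (4,
  28, 37, 40, 1), (12, 28, 37, 41, 8), (2, 21, 44, 38, 55), (10, 21, 44, 39, 62), (4, 21, 47, 60,
  38), (6, 7, 61, 44, 38), (5, 56, 5, 44, 38), (2, 21, 40, 4, 38), (6, 21, 44, 32, 6), (10, 21,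
  44, 38, 48), (4, 21, 46, 52, 39), (8, 21, 46, 55, 60), (12, 21, 47, 62, 52), (10, 7, 61, 46,
  52), (9, 56, 5, 46, 52), (10, 21, 40, 6, 52), (4, 21, 46, 48, 4), (12, 21, 46, 52, 32), (6, 14,
  53, 44, 39), (10, 14, 53, 47, 60), (12, 14, 55, 61, 44), (14, 7, 62, 53, 44), (13, 56, 6, 53,
  44), (10, 14, 48, 5, 44), (6, 14, 53, 40, 4), (14, 14, 53, 44, 32), (5, 49, 13, 44, 39), (9, 49,
  13, 47, 60), (13, 49, 15, 61, 44), (10, 7, 57, 13, 44), (9, 56, 1, 13, 44), (11, 49, 8, 5, 44),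
  (5, 49, 13, 40, 4), (13, 49, 13, 44, 32), (2, 21, 41, 12, 39), (10, 21, 41, 15, 60), (4, 21, 47,
  57, 12), (6, 7, 61, 41, 12), (5, 56, 5, 41, 12), (2, 21, 40, 1, 12), (6, 21, 41, 8, 4), (10, 21,
  41, 12, 32), (6, 21, 44, 33, 15), (10, 21, 44, 39, 57), (12, 21, 47, 60, 33), (14, 7, 61, 44,
  33), (13, 56, 5, 44, 33), (10, 21, 40, 4, 33), (6, 21, 44, 32, 1), (14, 21, 44, 33, 8), (1, 42,
  20, 38, 55), (9, 42, 20, 39, 62), (5, 42, 23, 60, 38), (2, 7, 58, 20, 38), (1, 56, 2, 20, 38),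
  (3, 42, 16, 4, 38), (5, 42, 20, 32, 6), (9, 42, 20, 38, 48), (5, 42, 22, 52, 39), (9, 42, 22,
  55, 60), (13, 42, 23, 62, 52), (10, 7, 58, 22, 52), (9, 56, 2, 22, 52), (11, 42, 16, 6, 52), (5,
  42, 22, 48, 4), (13, 42, 22, 52, 32), (2, 14, 50, 20, 39), (10, 14, 50, 23, 60), (4, 14, 55, 58,
  20), (6, 7, 62, 50, 20), (5, 56, 6, 50, 20), (2, 14, 48, 2, 20), (6, 14, 50, 16, 4), (10, 14,
  50, 20, 32), (1, 49, 10, 20, 39), (9, 49, 10, 23, 60), (5, 49, 15, 58, 20), (2, 7, 57, 10, 20),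
  (1, 56, 1, 10, 20), (3, 49, 8, 2, 20), (5, 49, 10, 16, 4), (9, 49, 10, 20, 32), (3, 42, 17, 12,
  39), (11, 42, 17, 15, 60), (5, 42, 23, 57, 12), (6, 7, 58, 17, 12), (5, 56, 2, 17, 12), (3, 42,
  16, 1, 12), (7, 42, 17, 8, 4), (11, 42, 17, 12, 32), (5, 42, 20, 33, 15), (9, 42, 20, 39, 57),
  (13, 42, 23, 60, 33), (10, 7, 58, 20, 33), (9, 56, 2, 20, 33), (11, 42, 16, 4, 33), (5, 42, 20,
  32, 1), (13, 42, 20, 33, 8), (2, 28, 34, 22, 55), (10, 28, 34, 23, 62), (4, 28, 39, 58, 22), (6,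
  7, 60, 34, 22), (5, 56, 4, 34, 22), (2, 28, 32, 2, 22), (6, 28, 34, 16, 6), (10, 28, 34, 22,
  48), (4, 28, 38, 50, 23), (8, 28, 38, 55, 58), (12, 28, 39, 62, 50), (10, 7, 60, 38, 50), (9,
  56, 4, 38, 50), (10, 28, 32, 6, 50), (4, 28, 38, 48, 2), (12, 28, 38, 50, 16), (6, 14, 52, 34,
  23), (10, 14, 52, 39, 58), (12, 14, 55, 60, 34), (14, 7, 62, 52, 34), (13, 56, 6, 52, 34), (10,
  14, 48, 4, 34), (6, 14, 52, 32, 2), (14, 14, 52, 34, 16), (5, 49, 12, 34, 23), (9, 49, 12, 39,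
  58), (13, 49, 15, 60, 34), (10, 7, 57, 12, 34), (9, 56, 1, 12, 34), (11, 49, 8, 4, 34), (5, 49,
  12, 32, 2), (13, 49, 12, 34, 16), (2, 28, 33, 10, 23), (10, 28, 33, 15, 58), (4, 28, 39, 57,
  10), (6, 7, 60, 33, 10), (5, 56, 4, 33, 10), (2, 28, 32, 1, 10), (6, 28, 33, 8, 2), (10, 28, 33,
  10, 16), (6, 28, 34, 17, 15), (10, 28, 34, 23, 57), (12, 28, 39, 58, 17), (14, 7, 60, 34, 17),
  (13, 56, 4, 34, 17), (10, 28, 32, 2, 17), (6, 28, 34, 16, 1), (14, 28, 34, 17, 8), (1, 35, 29,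
  46, 55), (9, 35, 29, 47, 62), (5, 35, 31, 61, 46), (2, 7, 59, 29, 46), (1, 56, 3, 29, 46), (3,
  35, 24, 5, 46), (5, 35, 29, 40, 6), (9, 35, 29, 46, 48), (5, 35, 30, 53, 47), (9, 35, 30, 55,
  61), (13, 35, 31, 62, 53), (10, 7, 59, 30, 53), (9, 56, 3, 30, 53), (11, 35, 24, 6, 53), (5, 35,
  30, 48, 5), (13, 35, 30, 53, 40), (2, 14, 51, 29, 47), (10, 14, 51, 31, 61), (4, 14, 55, 59,
  29), (6, 7, 62, 51, 29), (5, 56, 6, 51, 29), (2, 14, 48, 3, 29), (6, 14, 51, 24, 5), (10, 14,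
  51, 29, 40), (1, 49, 11, 29, 47), (9, 49, 11, 31, 61), (5, 49, 15, 59, 29), (2, 7, 57, 11, 29),
  (1, 56, 1, 11, 29), (3, 49, 8, 3, 29), (5, 49, 11, 24, 5), (9, 49, 11, 29, 40), (3, 35, 25, 13,
  47), (11, 35, 25, 15, 61), (5, 35, 31, 57, 13), (6, 7, 59, 25, 13), (5, 56, 3, 25, 13), (3, 35,
  24, 1, 13), (7, 35, 25, 8, 5), (11, 35, 25, 13, 40), (5, 35, 29, 41, 15), (9, 35, 29, 47, 57),
  (13, 35, 31, 61, 41), (10, 7, 59, 29, 41), (9, 56, 3, 29, 41), (11, 35, 24, 5, 41), (5, 35, 29,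
  40, 1), (13, 35, 29, 41, 8), (2, 21, 43, 30, 55), (10, 21, 43, 31, 62), (4, 21, 47, 59, 30), (6,
  7, 61, 43, 30), (5, 56, 5, 43, 30), (2, 21, 40, 3, 30), (6, 21, 43, 24, 6), (10, 21, 43, 30,
  48), (4, 21, 46, 51, 31), (8, 21, 46, 55, 59), (12, 21, 47, 62, 51), (10, 7, 61, 46, 51), (9,
  56, 5, 46, 51), (10, 21, 40, 6, 51), (4, 21, 46, 48, 3), (12, 21, 46, 51, 24), (6, 14, 53, 43,
  31), (10, 14, 53, 47, 59), (12, 14, 55, 61, 43), (14, 7, 62, 53, 43), (13, 56, 6, 53, 43), (10,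
  14, 48, 5, 43), (6, 14, 53, 40, 3), (14, 14, 53, 43, 24), (5, 49, 13, 43, 31), (9, 49, 13, 47,
  59), (13, 49, 15, 61, 43), (10, 7, 57, 13, 43), (9, 56, 1, 13, 43), (11, 49, 8, 5, 43), (5, 49,
  13, 40, 3), (13, 49, 13, 43, 24), (2, 21, 41, 11, 31), (10, 21, 41, 15, 59), (4, 21, 47, 57,
  11), (6, 7, 61, 41, 11), (5, 56, 5, 41, 11), (2, 21, 40, 1, 11), (6, 21, 41, 8, 3), (10, 21, 41,
  11, 24), (6, 21, 43, 25, 15), (10, 21, 43, 31, 57), (12, 21, 47, 59, 25), (14, 7, 61, 43, 25),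
  (13, 56, 5, 43, 25), (10, 21, 40, 3, 25), (6, 21, 43, 24, 1), (14, 21, 43, 25, 8), (1, 42, 19,
  30, 55), (9, 42, 19, 31, 62), (5, 42, 23, 59, 30), (2, 7, 58, 19, 30), (1, 56, 2, 19, 30), (3,
  42, 16, 3, 30), (5, 42, 19, 24, 6), (9, 42, 19, 30, 48), (5, 42, 22, 51, 31), (9, 42, 22, 55,
  59), (13, 42, 23, 62, 51), (10, 7, 58, 22, 51), (9, 56, 2, 22, 51), (11, 42, 16, 6, 51), (5, 42,
  22, 48, 3), (13, 42, 22, 51, 24), (2, 14, 50, 19, 31), (10, 14, 50, 23, 59), (4, 14, 55, 58,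
  19), (6, 7, 62, 50, 19), (5, 56, 6, 50, 19), (2, 14, 48, 2, 19), (6, 14, 50, 16, 3), (10, 14,
  50, 19, 24), (1, 49, 10, 19, 31), (9, 49, 10, 23, 59), (5, 49, 15, 58, 19), (2, 7, 57, 10, 19),
  (1, 56, 1, 10, 19), (3, 49, 8, 2, 19), (5, 49, 10, 16, 3), (9, 49, 10, 19, 24), (3, 42, 17, 11,
  31), (11, 42, 17, 15, 59), (5, 42, 23, 57, 11), (6, 7, 58, 17, 11), (5, 56, 2, 17, 11), (3, 42,
  16, 1, 11), (7, 42, 17, 8, 3), (11, 42, 17, 11, 24), (5, 42, 19, 25, 15), (9, 42, 19, 31, 57),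
  (13, 42, 23, 59, 25), (10, 7, 58, 19, 25), (9, 56, 2, 19, 25), (11, 42, 16, 3, 25), (5, 42, 19,
  24, 1), (13, 42, 19, 25, 8), (3, 35, 26, 22, 55), (11, 35, 26, 23, 62), (5, 35, 31, 58, 22), (6,
  7, 59, 26, 22), (5, 56, 3, 26, 22), (3, 35, 24, 2, 22), (7, 35, 26, 16, 6), (11, 35, 26, 22,
  48), (5, 35, 30, 50, 23), (9, 35, 30, 55, 58), (13, 35, 31, 62, 50), (10, 7, 59, 30, 50), (9,
  56, 3, 30, 50), (11, 35, 24, 6, 50), (5, 35, 30, 48, 2), (13, 35, 30, 50, 16), (6, 14, 51, 26,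
  23), (10, 14, 51, 31, 58), (12, 14, 55, 59, 26), (14, 7, 62, 51, 26), (13, 56, 6, 51, 26), (10,
  14, 48, 3, 26), (6, 14, 51, 24, 2), (14, 14, 51, 26, 16), (5, 49, 11, 26, 23), (9, 49, 11, 31,
  58), (13, 49, 15, 59, 26), (10, 7, 57, 11, 26), (9, 56, 1, 11, 26), (11, 49, 8, 3, 26), (5, 49,
  11, 24, 2), (13, 49, 11, 26, 16), (3, 35, 25, 10, 23), (11, 35, 25, 15, 58), (5, 35, 31, 57,
  10), (6, 7, 59, 25, 10), (5, 56, 3, 25, 10), (3, 35, 24, 1, 10), (7, 35, 25, 8, 2), (11, 35, 25,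
  10, 16), (7, 35, 26, 17, 15), (11, 35, 26, 23, 57), (13, 35, 31, 58, 17), (14, 7, 59, 26, 17),
  (13, 56, 3, 26, 17), (11, 35, 24, 2, 17), (7, 35, 26, 16, 1), (15, 35, 26, 17, 8)]

/-- Table for `n = 4`. -/
def TL4 : List ℕ :=
  [423144736596608182911363010737432157350441332336186255111882367324317339400389944282779086831019903778108966277039520340676957674947222564862579817297672004409017503667800612134215064100449542293914357422773634860630527746527850703511121444056009293945931440557503205664968605366200982554596923116168765210941001785108269287977979757827639695770227897028855202376172283846767201416948185110459236273415521382157383007587798618476247282682838142213818356882396691315018271761105755819945614749489981588679580239677781223362245639666680182162118661320900080788347801502487954920489731552890732710035430163961961359038093930806518371046430089591630868405190937275459955685555692540834512318507562185319491521855271800614707634570920035356906792917838342916815167971917825,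
  413227281832625178624377940173273591162540363899932215298485615718907211284791542753740110169362710706659259150306497201517346695496677165178325938899377492502526244507816929520436880487829786990581074240831478569725212188010060185733760349222618714693786520025689757821850427995358547684777066911553584396638161833167545054384334161086634051101827061583076962828300038169384763797629123582611248219839453348247016319168010262671770930719035345030652380857032569718204435979499237540017702292566809630370059395571117396041187792675132026016038368791495518198335710295543534610311666475782274329864387034058905587273343250176384533694222581764217128535068117623605876237069771793735180583054421143672045558050210691624046644060194294217194081238602352812456752972800,
  403542267414673026000369082200462491369668324121027554002427359100495323520304240970449326535564780273779773987264329801036470284610135255189707388887420500643281171488759376616468049151462232828903561301717543347851366770668981850438430158034671160434445069659600541642888469666902046976695755952923168756815282802737056359895864196248504123654034751466645039607153423355251657822687710970052632633426892295968495176740825848159077174386743044322102122861927624215803799068095488021102256415784905883608067246970212950970198807174687270947861404683695984243639787944813101493691424439253478847341925982666496103051473075548086746895154008406247276096103075072710872799749968378771025341751462990989970429832959300795039477612080206559064703117820249692255027200,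
  394084245522141626953485431836389151728192006344094819131268298685600439568888702206159680349911841833166828396016989974231196126924102884117358428811306277902938536821896436530792504786236006243776554865677898863809022466355458780181012853053105602799943698090834839358834879850236459180354734314452402892201126609995426818174812722186535947476926073190244627080223663570013737707594287251968524272657845045364150078370598003210929463354394647975432876715963831617080441144262528153744542404342266969258900411353577115951629358966794372812721588767221992589527836115968048375447493994024863625595904537518709167692164021350090315260048410415454170771549603565126834839368472991252164491972765214096437224102696798722710479987845358585012833764521502624972800,
  384847896017716432571763117027723780984845246696642019180552968148114691423892950434311089667794869844678191926576429779710243981881488023722083792086081653757197550596934058911598523977353705087251579264478477821878232452452577008615622089282857046721703790876312483444715486072880434048573690736075155822516146246304633138133137297065959068486536984175903062225533052918028650532703200494224829158898527936944498584687030414102242225535532003914607898030949596786241058394105602872277818946051653619977692724678625588142548394687244020472576158792584670731561208063113507095567405072616226741972303332407452120046454826416860854878521639979048420307620512453599827558659746700978430779238315744604177176736548419395850766339293941473114669852694623027200,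
  375828023454801203683362418972386505150754247183459015818994834010875314488050581326502136500172624880478495343679067256173806249763520867173866187902414135674424994271514489508609844043223495323660113000914803056179376106557308161072866921114120758969057524478157708081394963887967476268397578260584992750880355984644195707207725950617665992101402307051089614676623770255245878517605577473348502827298027694899851276320602886653924434933561190515434756539302902204980711591644937724732293227928196280353970792056738357337697221010388461549431750986272225523709499018954987601530872689580925562718264836678916338723028226778343469582282368246075903224918987703061889539848689319283982157410923820342421958124598335187362422395060314816154866771872972800,
  367019554155079300472033612277721196436283444515096695135737142588745424304736896020310623415259261914852984150233630669009717903596455221314051843941127129178711167178249903340836981534137393101285496883307222852359867202030027272763276264915716340220453428807782090649306672552775662674772586161575853467045014185416097844952220028645918286374396205245297817137925308112497648094934857658028454389670438954417515453808194682478207624892822048993603125181784869149463000200850423025964752416134554760586647351806837863737717770669585675628587195325243008592230275397978419637476712538690475627383040531887003083571163567118915016702104216632906366859417320875062509679015237877148784142206027586947031210758979501629940873068039247965119617119027200,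
  358417533354569629367220324489962382009369532016250642697083199532037664755721691332564485882074672720947882913149095141159774296424973567352979632668814412216116104861132520141196369587695292901414213511211816004225795072615302420517071124567222513603667438988755631286795620835192354958922657573963718975975066014907674980162874668832292970111371960993300259228544753431192139955555022649465748911579117176724367809803603480337376380406461741528300230334553116201386989019601095417794824621074588172070628588450403286300901667848480824215563605960599003895661091905627237797734374271476527600775520104619322154683045188922910906611443978394598049555034067847904574879602808320626214418363717440233648975432778260986741168221617565606307744972800,
  350017122416571903678926098417746313671098867306999398680002554969529227804702287943815736402280221566756897366421368883111591995708495923310752173340355760605860005812531369941943966084064144259853547079141540511160713898279533596924124282586713967799046393159496514872583906727245470274810449161203263574671916371078389460230914324478299586424818090369957818086811693703978207496468299355968286848677148802115110056229466498818662873272512409003033722697371554754707211334344308178473885142622098009700420078682318455299766562488102299842616027836511248014721442991685141869705207953056566268977588841624903942404705858606285012159662193028227113434663750580609191207717793930291654349993205396359041619568793120268523217925772688529503027200,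
  341813596109933499686451550727390813552943136428601243250178995624249395906576199326817504330474347621770065027459687595946459912773720576938951337293738476789245667829997646739179742382809654074952014947078703610053323058761916613213221852154914424822595793687197351689981898537143579235723205366310098522842878487102701174430867890094111410999860504588799241274630553846774580316439480967114705596411051729359411160850633445008701123560590411927484999123221461346265886104212746574134611468351319091322825269122913220518424886278786575980195047101311789042288020889466090882114513179829958008283617141106004400561643404934176681490911097423753315610746996361453007496467451733333863110080814004932080436584402300035450835596316207008972800,
  333802339951106933287550342507217591360296031668555901611502925414306050878941248978288812099225383203481894724570138643537031854783963465008554240851299588870235204913311503986394134847019778602383377697767225640680802840662826335899983418886789758649661193597765286148141610032373594336584482796952447045474874558639461567087366223463952294071719604496088946682834885931125345871279965224590518512135256560184834620608354690956453509049749657073111882877844762240763468886024205893622718211112713285334923534221587021035819477778204727465836346214062282091692687328521836944150819460526428096154699364364298770570193241915476288075168884736177436704073753470138432217886620030670488400145343635362127558243233096175422933104891999027200,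
  325978847608502864538899495915670605342719585720897342139163537336733817798401060215278691900817823682598270984653459965318624924620439886628326413079916672543284394210461148972758695034932208751511977410377177504864057258570059027654902950784522499593577464917191651365719539556958968360507395885284869536852776254450074248052567925465332985165897378494790321061408793653081757434595650477380990859054232595117898645246983998074174904299685765371808447129165890736102331858564550265651085168325819501676463016291854912248429275113887281933031700042894862588173930326056744460792563809676885838069802357420769160899705999034626321081033255405742957019611666517064652787476341490423213597715896728821661217975358278245424110462880972800,
  318338718367678578650999396111606636445887941290891811027456389296290913248320355588951179216798864338255297318461337630218603886383079222531895728414475316355883485730964415492550026122253988772688261543265829056748312802724090184285290671532224244558147625115618406716151972543865940610205220172015717975383940721922921763404531769272706198749856517360512368702461506810516772456220495409081865195166732737111957974678435319511877188793998565075367163575156103266869300092652904748745792485683840918745303016506855351444343464556215731830722431483509315201715532480258249757283387517689106676997136021000982024886566882935718402732988759293830338459253293015906208449508135741181048903644738956870601564910587451239383734367027200,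
  310877654655936111964130178281898177080232471659819956362103448656295384529034866301096240148087112952318370263510115978612479122810987209014111404149243474478596458392061362156812666074377569252570957554155033164291274530440649786809634057993054745037598656789749099914408585700716686900823346801734831276546864469540887260261796022249736971262328682960488755823513857148708045036118874575173321860546589463229985824546710581935572620310835916401702237598807202921283308557028496291741707740693116378774607666199582769438960741679150541674245944655576843130834139529341701130700278226679275713250347210131461155657236341133355953704122063880045701003447888282710550590131376244837507765871553649605495778985665478752692128972800,
  303591459624937609339970877228416188554914523105292926134866649078593810733978650977238130292700051995432898843879681594742180796745726312334264160528067936063713857973840513923364777582899086785241467957394077109602552374945113901100125475099313133924687676658635176707868285177043543955728342633711473775580964596390318085740283314980791771108169994564502827640823956828297594082598397172328722018546232868245715367768024955766708695707296411086721727559288370803499685755134812309049211183278832194742413273859012538858146572729408375082967026180612686687731941207223528989000426116994402887527421573720753675634682842106865319342302980918594193064511256022696863563474480179996391392070722754709764229728570572576863027200,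
  296476034789978134378468158091540395117132339881557697009702278530335320227847638556311121036097411017404854205486821701863184670821902508086850788740026091339841938732969560350947129677202341163562306646150964568208435179580465731843560515725653746225295856977988377338675293546539101700270272590254548604646103184390602262574009686741141009601555175174701807327136286196963424453955658907029263493433680306657540451658576977934248897381910881010069322856558767891294501718064106928001173251084066888467772027489025220386525051617856205997210364228574501784220878691162388264810166187787040427340819438296949879330512310141089083851979347493429754882930597190526869616986657077294031558615375802646849302511421188000972800]

/-- The tables for `n = 4`. -/
def tables4 : Tables 4 where
  EL := EL4
  CL := CL4
  TL := TL4
  hE := by decide +kernel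
  hC := by decide +kernel
  hN := by decide +kernel
  hL := by decide +kernel
  hnd := by decide +kernel
  hlen := by decide +kernel

end DescB

set_option maxHeartbeats 1000000
set_option synthInstance.maxHeartbeats 1000000
set_option maxRecDepth 100000
namespace DescB

/-! ### Certificates -/

/-- Sum of integers. -/
def sumN (f : ℕ → ℤ) (n : ℕ) : ℤ := Nat.rec 0 (fun k ih => Int.add (f k) ih) n

theorem sumN_eq (f : ℕ → ℤ) (n : ℕ) : sumN f n = ∑ k ∈ Finset.range n, f k := by
  induction n with
  | zero => rfl
  | succ n ih =>
    rw [Finset.sum_range_succ, ← ih, add_comm (sumN f n)]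
    rfl

/-- Bounded quantifier. -/
def allN (f : ℕ → Bool) (n : ℕ) : Bool := Nat.rec true (fun k ih => and (f k) ih) n

theorem allN_eq {f : ℕ → Bool} {n : ℕ} (h : allN f n = true) : ∀ k, k < n → f k = true := by
  induction n with
  | zero => intro k hk; omega
  | succ n ih =>
    have h' : (f n && allN f n) = true := h
    rw [Bool.and_eq_true] at h'
    intro k hk
    rcases Nat.lt_succ_iff_lt_or_eq.1 hk with h1 | h1
    · exact ih h'.2 k h1
    · rw [h1]; exact h'.1

/-- Entry of an integer matrix. -/
def ent (C : List (List ℤ)) (i U : ℕ) : ℤ := (C.getD i []).getD U 0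

/-- Digit. -/
def dig (x k : ℕ) : ℕ := Nat.mod (Nat.div x (Nat.pow 1024 k)) 1024

/-- Divisibility check. -/
def eqm (m : ℕ) (x y : ℤ) : Bool := decide (Int.emod (Int.sub x y) (Int.ofNat m) = 0)

/-- Scalar product of a list and a function. -/
def dotL (f : ℕ → ℤ) (l : List ℤ) : ℕ → ℤ :=
  List.rec (fun _ => 0) (fun x _ ih k => Int.add (Int.mul x (f k)) (ih (Nat.add k 1))) l

theorem dotL_eq (f : ℕ → ℤ) (l : List ℤ) (k N : ℕ) (h : l.length ≤ N) :
    dotL f l k = ∑ i ∈ Finset.range N, l.getD i 0 * f (k + i) := by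
  induction l generalizing k N with
  | nil => simp [dotL]
  | cons x l ih =>
    obtain ⟨N, rfl⟩ : ∃ N', N = N' + 1 := ⟨N - 1, by simp only [List.length_cons] at h; omega⟩
    rw [Finset.sum_range_succ']
    have h' : l.length ≤ N := by simpa using h
    change x * f k + dotL f l (k + 1) = _
    rw [ih (k + 1) N h', add_comm]
    simp [add_assoc, add_comm 1]

/-- Partial product. -/
def part (N : ℕ) (TL : List ℕ) (C : List (List ℤ)) (i U T : ℕ) : ℤ :=
  dotL (fun S => Int.ofNat (dig (TL.getD U 0) (Nat.add (Nat.mul N S) T))) (C.getD i []) 0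

/-- Expected product. -/
def tgt (gl : Fin 3 → Bool) (C : List (List ℤ)) (i j U : ℕ) : ℤ :=
  if i / 7 = j / 7 then
    (tab (gl (Fin.ofNat 3 (i / 7))) (Fin.ofNat 7 (i % 7)) (Fin.ofNat 7 (j % 7))).elim 0
      fun t => ent C (7 * (i / 7) + t.1) U
  else 0

/-- The coefficients of `x_J`. -/
def ind (n J U : ℕ) : ℤ := if ∀ i ∈ List.range n, bitAt J i = 0 ∨ bitAt U i = 0 then 1 else 0

/-- The inverse of `ind`. -/
def mob (n S J : ℕ) : ℤ := ((List.range n).map fun i =>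
  if bitAt J i = 0 then (if bitAt S i = 0 then 0 else 1)
  else (if bitAt S i = 0 then 1 else -1 : ℤ)).prod

/-- Inversion check. -/
def Mob (n : ℕ) : Prop := allN (fun S => allN (fun U => eqm 0
  (sumN (fun J => Int.mul (mob n S J) (ind n J U)) (2 ^ n)) (if S = U then 1 else 0)) (2 ^ n)) (2 ^ n)
  = true

/-- A certificate. -/
structure Cert (n : ℕ) (T : Tables n) where
  m : ℕ
  d : ℕ
  d2 : ℕ
  gl : Fin 3 → Bool
  C : List (List ℤ)
  R : List (List ℤ)
  hmul : allN (fun U => allN (fun i => allN (fun j => eqm m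
    (dotL (fun S => part (2 ^ n) T.TL C i U S) (C.getD j []) 0)
    (Int.mul (Int.ofNat d) (tgt gl C i j U))) 21) 21) (2 ^ n) = true
  hgen : allN (fun J => allN (fun U => eqm m
    (dotL (fun i => ent C i U) (R.getD J []) 0)
    (Int.mul (Int.ofNat d2) (ind n J U))) (2 ^ n)) (2 ^ n) = true
  hlC : allN (fun i => Nat.ble (C.getD i []).length (2 ^ n)) 21 = true
  hlR : allN (fun i => Nat.ble (R.getD i []).length 21) (2 ^ n) = true
  hglue : ∀ k, gl k = true → ∀ U ∈ List.range (2 ^ n), ent C (7 * k.1 + 2) U = ent C (7 * k.1 + 3) U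

theorem mob2 : Mob 2 := by unfold Mob; decide +kernel
theorem mob3 : Mob 3 := by unfold Mob; decide +kernel
theorem mob4 : Mob 4 := by unfold Mob; decide +kernel

/-- Certificate for `n = 2`, characteristic zero or large. -/
def cert20 : Cert 2 tables2 where
  m := 0
  d := 8
  d2 := 8
  gl := ![false, false, false]
  C :=
    [[3, -1, -1, 3], [2, -2, 2, -2], [2, 2, -2, -2], [1, 1, 1, 1]]
  R :=
    [[0, 0, 0, 8], [0, 2, 0, 4], [0, 0, 2, 4], [1, 1, 1, 1]]
  hmul := by decide +kernel
  hgen := by decide +kernel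
  hlC := by decide +kernel
  hlR := by decide +kernel
  hglue := by decide +kernel

/-- Certificate for `n = 3`, characteristic zero or large. -/
def cert30 : Cert 3 tables3 where
  m := 0
  d := 48
  d2 := 48
  gl := ![false, false, false]
  C :=
    [[6, 6, -6, -6, 6, 6, -6, -6], [15, -3, 3, 9, -9, -3, 3, -15], [8, 8, -4, -4, -4, -4, 8, 8],
    [1, 1, 1, 1, 1, 1, 1, 1], [], [0, 0, 1, 1, -1, -1], [], [6, -6, 6, -6, -6, 6, -6, 6], [3,
    -3, 3, -3, 3, -3, 3, -3], [9, -3, -3, 9, 9, -3, -3, 9]]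
  R :=
    [[0, 0, 0, 48], [0, 0, 0, 24, 0, 0, 0, 0, 8], [4, 0, 0, 24], [2, 0, 0, 6, 0, 0, 0, 0, 4, 2],
    [4, 0, 0, 24, 0, 48], [2, 0, 0, 12, 0, 24, 0, 2, 4], [4, 0, 2, 8, 0, 24], [1, 1, 1, 1, 0, 0,
    0, 1, 1, 1]]
  hmul := by decide +kernel
  hgen := by decide +kernel
  hlC := by decide +kernel
  hlR := by decide +kernel
  hglue := by decide +kernel

/-- Certificate for `n = 3`, characteristic 3. -/
def cert33 : Cert 3 tables3 where
  m := 3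
  d := 1
  d2 := 1
  gl := ![true, false, false]
  C :=
    [[-1, -1, 1, 1, -1, -1, 1, 1], [-1, -1, 1, 0, 0, -1, 1, 1], [0, 0, -1, -1, -1, -1], [0, 0,
    -1, -1, -1, -1], [], [0, 0, 1, 1, -1, -1], [1, 1, 1, 1, 1, 1, 1, 1], [-1, 1, -1, 1, 1, -1,
    1, -1], [1, -1, 1, -1, 1, -1, 1, -1], [0, -1, -1, 0, 0, -1, -1]]
  R :=
    [[0, 0, 0, 0, 0, 0, 1], [0, 0, 0, 0, 0, 0, -1, 0, -1], [1, 0, 0, 0, 0, 0, -1], [-1, 0, 0, 0,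
    0, 0, -1, 0, 1, -1], [1, 0, 0, 0, 0, 1, -1], [-1, 0, 0, 0, 0, -1, 1, -1, 1], [1, 0, -1, 0,
    0, -1, -1], [1, 1, 1, 0, 0, 0, 0, 1, 1, 1]]
  hmul := by decide +kernel
  hgen := by decide +kernel
  hlC := by decide +kernel
  hlR := by decide +kernel
  hglue := by decide +kernel

/-- Certificate for `n = 4`, characteristic zero or large. -/
def cert40 : Cert 4 tables4 where
  m := 0
  d := 384
  d2 := 384
  gl := ![false, false, false]
  C :=
    [[24, -24, 24, -24, -24, 24, -24, 24, 24, -24, 24, -24, -24, 24, -24, 24], [105, -15, 9, 33,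
    9, -15, 9, -63, -63, 9, -15, 9, 33, 9, -15, 105], [32, 32, -16, -16, -16, -16, 32, 32, 32,
    32, -16, -16, -16, -16, 32, 32], [1, 1, 1, 1, 1, 1, 1, 1, 1, 1, 1, 1, 1, 1, 1, 1], [0, 0, 1,
    1, 0, 0, -1, -1, -1, -1, 0, 0, 1, 1], [0, 0, 0, 0, 1, -1, 1, -1, -1, 1, -1, 1], [], [32,
    -32, 32, -32, -16, 16, -16, 16, -16, 16, -16, 16, 32, -32, 32, -32], [60, -12, 12, 36, -36,
    -12, 12, -60, 60, -12, 12, 36, -36, -12, 12, -60], [12, 12, -12, -12, 12, 12, -12, -12, 12,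
    12, -12, -12, 12, 12, -12, -12], [48, 48, -24, -24, 0, 0, 24, 24, -24, -24, 0, 0, 24, 24,
    -48, -48], [0, 0, 1, 1, -1, -1, 0, 0, 0, 0, 1, 1, -1, -1], [], [0, 0, -1, -1, 2, 2, 1, 1,
    -1, -1, -2, -2, 1, 1], [4, -4, 4, -4, 4, -4, 4, -4, 4, -4, 4, -4, 4, -4, 4, -4], [18, -6,
    -6, 18, 18, -6, -6, 18, 18, -6, -6, 18, 18, -6, -6, 18], [12, 12, -12, -12, 12, 12, -12,
    -12, -12, -12, 12, 12, -12, -12, 12, 12], [36, -12, -12, 36, 36, -12, -12, 36, -36, 12, 12,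
    -36, -36, 12, 12, -36]]
  R :=
    [[0, 0, 0, 384], [0, 0, 0, 192, 0, 0, 0, 0, 0, 0, 0, 0, 0, 0, 48], [0, 0, 0, 192, 0, 0, 0,
    0, 0, 16], [0, 0, 0, 48, 0, 0, 0, 0, 0, 8, 0, 0, 0, 0, 24, 8], [0, 0, 0, 192, 0, 0, 0, 0, 0,
    16, 0, 384], [4, 0, 0, 96, 0, 0, 0, 0, 0, 8, 0, 192, 0, 0, 24], [0, 0, 4, 64, 0, 0, 0, 0, 0,
    16, 0, 192], [2, 0, 2, 8, 0, 0, 0, 0, 2, 4, 0, 0, 0, 0, 6, 4], [0, 0, 0, 192, 0, 0, 0, 0, 0,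
    16, 0, 768, 0, 384], [4, 0, 0, 96, 0, 192, 0, 0, 0, 8, 0, 384, 0, 192, 24], [0, 0, 0, 96, 0,
    0, 0, 0, 0, 16, 0, 384, 0, 192, 0, 0, 8], [2, 0, 0, 24, 0, 96, 0, 0, 0, 6, 0, 96, 0, 48, 12,
    4, 4, 2], [0, 0, 4, 64, 192, 0, 0, 0, 0, 16, 0, 576, 0, 192], [4, 0, 2, 32, 96, 96, 0, 2, 0,
    8, 0, 288, 0, 96, 8], [0, 0, 4, 16, 96, 0, 0, 0, 0, 8, 2, 192, 0, 48, 0, 0, 4], [1, 1, 1, 1,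
    0, 0, 0, 1, 1, 1, 1, 0, 0, 0, 1, 1, 1, 1]]
  hmul := by decide +kernel
  hgen := by decide +kernel
  hlC := by decide +kernel
  hlR := by decide +kernel
  hglue := by decide +kernel

/-- Certificate for `n = 4`, characteristic 3. -/
def cert43 : Cert 4 tables4 where
  m := 3
  d := 1
  d2 := 1
  gl := ![true, false, true]
  C :=
    [[1, -1, 1, -1, -1, 1, -1, 1, 1, -1, 1, -1, -1, 1, -1, 1], [1, -1, 0, 1, 0, -1, 0, 0, 0, 0,
    -1, 0, 1, 0, -1, 1], [1, 1, -1, -1, -1, -1, 1, 1, 1, 1, -1, -1, -1, -1, 1, 1], [1, 1, -1,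
    -1, -1, -1, 1, 1, 1, 1, -1, -1, -1, -1, 1, 1], [0, 0, -1, -1, 0, 0, 1, 1, 1, 1, 0, 0, -1,
    -1], [0, 0, 0, 0, -1, 1, -1, 1, 1, -1, 1, -1], [1, 1, 1, 1, 1, 1, 1, 1, 1, 1, 1, 1, 1, 1, 1,
    1], [0, -1, -1, 0, 0, -1, -1, 0, 0, -1, -1, 0, 0, -1, -1], [1, 1, -1, 0, 0, 1, -1, -1, 1, 1,
    -1, 0, 0, 1, -1, -1], [-1, -1, 1, 1, -1, -1, 1, 1, -1, -1, 1, 1, -1, -1, 1, 1], [-1, -1, -1,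
    -1, 0, 0, 1, 1, -1, -1, 0, 0, 1, 1, 1, 1], [0, 0, 1, 1, -1, -1, 0, 0, 0, 0, 1, 1, -1, -1],
    [], [0, 0, -1, -1, -1, -1, 1, 1, -1, -1, 1, 1, 1, 1], [-1, -1, 1, 1, -1, -1, 1, 1, 1, 1, -1,
    -1, 1, 1, -1, -1], [0, 1, 1, 0, 0, 1, 1, 0, 0, -1, -1, 0, 0, -1, -1], [0, 0, 0, 0, 1, -1, 1,
    -1, 1, -1, 1, -1], [0, 0, 0, 0, 1, -1, 1, -1, 1, -1, 1, -1], [], [], [-1, 1, -1, 1, -1, 1,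
    -1, 1, -1, 1, -1, 1, -1, 1, -1, 1]]
  R :=
    [[0, 0, 0, 0, 0, 0, 1], [0, 0, 0, 0, 0, 0, -1, 0, 0, 0, 0, 0, 0, 0, 0, 0, 0, 0, 0, 0, 1],
    [0, 0, 0, 0, 0, 0, -1, 0, 0, 1], [0, 0, 0, 0, 0, 0, -1, -1, 0, -1, 0, 0, 0, 0, 0, 0, 0, 0,
    0, 0, -1], [0, 0, 0, 0, 0, 0, -1, 0, 0, 1, 0, 1], [1, 0, 0, 0, 0, 0, 1, 0, 0, -1, 0, -1, 0,
    0, 0, 0, 0, 0, 0, 0, -1], [0, 0, 1, 0, 0, 0, 1, 0, 0, 1, 0, -1], [-1, 0, -1, 0, 0, 0, 1, 1,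
    -1, 1, 0, 0, 0, 0, 0, 0, 0, 0, 0, 0, -1], [0, 0, 0, 0, 0, 0, -1, 0, 0, 1, 0, -1, 0, 1], [1,
    0, 0, 0, 0, 1, 1, 0, 0, -1, 0, 1, 0, -1, 0, 0, 0, 0, 0, 0, -1], [0, 0, 0, 0, 0, 0, 1, 0, 0,
    1, 0, 1, 0, -1, -1], [-1, 0, 0, 0, 0, -1, 1, 1, 0, 0, 0, 1, 0, -1, 1, -1, 0, 0, 0, 0, 1],
    [0, 0, 1, 0, 1, 0, 1, 0, 0, 1, 0, 0, 0, -1], [1, 0, -1, 0, -1, -1, -1, 0, 0, -1, 0, 0, 0, 1,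
    0, 0, -1, 0, 0, 0, -1], [0, 0, 1, 0, -1, 0, -1, 0, 0, -1, -1, -1, 0, -1, 1], [1, 1, 1, 0, 0,
    0, 0, 1, 1, 1, 1, 0, 0, 0, 1, 1, 1]]
  hmul := by decide +kernel
  hgen := by decide +kernel
  hlC := by decide +kernel
  hlR := by decide +kernel
  hglue := by decide +kernel

end DescB

set_option maxHeartbeats 1000000
set_option synthInstance.maxHeartbeats 1000000
set_option linter.unusedSectionVars false
namespace DescB

/-! ### The algebra -/

section Psi

variable {F W : Type*} [Field F] [Group W] [Fintype W] {n : ℕ} {s : ℕ → W}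

/-- The element of the group algebra with coefficients depending on descents. -/
noncomputable def Psi (F : Type*) [Field F] {W : Type*} [Group W] [Fintype W]
    (φ : W →* Equiv.Perm (Fin 8)) (c : ℕ → F) : MonoidAlgebra F W :=
  ∑ w, c (desW φ w) • MonoidAlgebra.of F W w

theorem Psi_smul (φ : W →* Equiv.Perm (Fin 8)) (a : F) (c : ℕ → F) :
    a • Psi F φ c = Psi F φ fun U => a * c U := by
  simp only [Psi, Finset.smul_sum, smul_smul]

theorem Psi_sum (φ : W →* Equiv.Perm (Fin 8)) {ι : Type*} (t : Finset ι) (a : ι → F)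
    (c : ι → ℕ → F) : ∑ i ∈ t, a i • Psi F φ (c i) = Psi F φ fun U => ∑ i ∈ t, a i * c i U := by
  simp only [Psi_smul]
  simp only [Psi, Finset.sum_smul]
  rw [Finset.sum_comm]

variable (T : Tables n) (R : Rels n s) (hn : n ≤ 4) (φ : W →* Equiv.Perm (Fin 8))
  (hφ : ∀ i, i < n → φ (s i) = sP i)
include T R hn hφ

theorem Psi_congr {c c' : ℕ → F} (h : ∀ U, U < 2 ^ n → c U = c' U) : Psi F φ c = Psi F φ c' := by
  unfold Psi
  refine Finset.sum_congr rfl fun w _ => ?_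
  rw [h _ (desW_lt T R hn φ hφ w)]

theorem Psi_mul (c c' : ℕ → F) : Psi F φ c * Psi F φ c' = Psi F φ fun U =>
    ∑ k ∈ Finset.range (2 ^ n * 2 ^ n),
      ((T.TL.getD U 0 / 1024 ^ k % 1024 : ℕ) : F) * (c (k / 2 ^ n) * c' (k % 2 ^ n)) := by
  have hN : 0 < 2 ^ n := by positivity
  unfold Psi
  simp only [← count_eq T R hn φ hφ fun k => c (k / 2 ^ n) * c' (k % 2 ^ n)]
  rw [Finset.sum_mul_sum]
  simp only [Finset.sum_smul]
  rw [Finset.sum_comm (s := Finset.univ) (t := Finset.univ) (f := fun w u =>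
    (c ((2 ^ n * desW φ u⁻¹ + desW φ (u * w)) / 2 ^ n) *
      c' ((2 ^ n * desW φ u⁻¹ + desW φ (u * w)) % 2 ^ n)) • MonoidAlgebra.of F W w)]
  refine Fintype.sum_equiv (Equiv.inv W) _ _ fun v => ?_
  refine Fintype.sum_equiv (Equiv.mulLeft v) _ _ fun u => ?_
  have h1 := desW_lt T R hn φ hφ u
  simp only [Equiv.inv_apply, inv_inv, Equiv.coe_mulLeft, inv_mul_cancel_left]
  rw [Nat.mul_add_div hN, Nat.div_eq_of_lt h1, add_zero, Nat.mul_add_mod, Nat.mod_eq_of_lt h1,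
    map_mul, smul_mul_smul_comm]

theorem star_eq (x : ℕ) (c c' : ℕ → F) : ∑ k ∈ Finset.range (2 ^ n * 2 ^ n),
      ((x / 1024 ^ k % 1024 : ℕ) : F) * (c (k / 2 ^ n) * c' (k % 2 ^ n)) =
    ∑ S ∈ Finset.range (2 ^ n), (∑ S' ∈ Finset.range (2 ^ n),
      ((dig x (2 ^ n * S' + S) : ℕ) : F) * c S') * c' S := by
  have hN : 0 < 2 ^ n := by positivity
  simp only [Finset.sum_mul]
  rw [Finset.sum_comm, ← Finset.sum_product', Finset.sum_nbij' (fun k => (k / 2 ^ n, k % 2 ^ n))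
    (fun p => 2 ^ n * p.1 + p.2)]
  · intro k hk
    rw [Finset.mem_range] at hk
    rw [Finset.mem_product, Finset.mem_range, Finset.mem_range]
    exact ⟨Nat.div_lt_of_lt_mul hk, Nat.mod_lt _ hN⟩
  · rintro ⟨a, b⟩ h
    rw [Finset.mem_product, Finset.mem_range, Finset.mem_range] at h
    rw [Finset.mem_range]
    calc 2 ^ n * a + b < 2 ^ n * a + 2 ^ n := by have := h.2; simp only at this ⊢; omega
      _ = 2 ^ n * (a + 1) := by ring
      _ ≤ _ := Nat.mul_le_mul_left _ h.1
  · intro k _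
    exact Nat.div_add_mod k _
  · rintro ⟨a, b⟩ h
    rw [Finset.mem_product, Finset.mem_range, Finset.mem_range] at h
    simp only
    rw [Nat.mul_add_div hN, Nat.div_eq_of_lt h.2, add_zero, Nat.mul_add_mod, Nat.mod_eq_of_lt h.2]
  · intro k _
    simp only [Nat.div_add_mod]
    rw [mul_assoc]
    rfl

end Psi

theorem eqm_cast {F : Type*} [Field F] {m : ℕ} (hm : (m : F) = 0) {x y : ℤ} (h : eqm m x y = true) :
    (x : F) = y := by
  have h1 : (x - y) % (m : ℤ) = 0 := of_decide_eq_true h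
  obtain ⟨z, hz⟩ := Int.dvd_of_emod_eq_zero h1
  have : ((x - y : ℤ) : F) = 0 := by rw [hz]; push_cast; rw [hm, zero_mul]
  push_cast at this
  exact sub_eq_zero.1 this

section Main

variable {F W : Type*} [Field F] [Group W] [Fintype W] {n : ℕ} {s : ℕ → W} {T : Tables n}

/-- The (unscaled) generators. -/
noncomputable def G (F : Type*) [Field F] {W : Type*} [Group W] [Fintype W]
    (φ : W →* Equiv.Perm (Fin 8)) (C : List (List ℤ)) (i : ℕ) : MonoidAlgebra F W :=
  Psi F φ fun U => (ent C i U : F)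

variable (K : Cert n T) (R : Rels n s) (hn : n ≤ 4) (φ : W →* Equiv.Perm (Fin 8))
  (hφ : ∀ i, i < n → φ (s i) = sP i) (hm : (K.m : F) = 0)

include R hn hφ hm

theorem G_mul (i j : ℕ) (hi : i < 21) (hj : j < 21) :
    G F φ K.C i * G F φ K.C j = Psi F φ fun U => (K.d : F) * (tgt K.gl K.C i j U : F) := by
  unfold G
  rw [Psi_mul T R hn φ hφ]
  refine Psi_congr T R hn φ hφ fun U hU => ?_
  refine (star_eq T R hn φ hφ _ (fun U => (ent K.C i U : F)) (fun U => (ent K.C j U : F))).trans ?_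
  have h := eqm_cast (F := F) hm (allN_eq (allN_eq (allN_eq K.hmul U hU) i hi) j hj)
  rw [dotL_eq _ _ 0 (2 ^ n) (Nat.le_of_ble_eq_true (allN_eq K.hlC j hj))] at h
  simp only [part, zero_add,
    dotL_eq _ _ 0 (2 ^ n) (Nat.le_of_ble_eq_true (allN_eq K.hlC i hi))] at h
  have e : ((Int.mul (Int.ofNat K.d) (tgt K.gl K.C i j U) : ℤ) : F) =
    (K.d : F) * (tgt K.gl K.C i j U : F) := by
    change (((K.d : ℤ) * (tgt K.gl K.C i j U) : ℤ) : F) = _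
    push_cast
    rfl
  rw [e] at h
  rw [← h]
  rw [Int.cast_sum]
  refine Finset.sum_congr rfl fun S _ => ?_
  change _ = ((ent K.C j S * (∑ S' ∈ Finset.range (2 ^ n), ent K.C i S' *
    ((dig (T.TL.getD U 0) (2 ^ n * S' + S) : ℕ) : ℤ)) : ℤ) : F)
  push_cast
  rw [mul_comm]
  congr 1
  exact Finset.sum_congr rfl fun S' _ => mul_comm _ _

theorem G_mul_ne (k k' : Fin 3) (l l' : Fin 7) (h : k ≠ k') :
    G F φ K.C (7 * k + l) * G F φ K.C (7 * k' + l') = 0 := by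
  rw [G_mul K R hn φ hφ hm _ _ (by omega) (by omega)]
  have : ∀ U, tgt K.gl K.C (7 * k + l) (7 * k' + l') U = 0 := by
    intro U
    unfold tgt
    rw [if_neg (by have := Fin.val_ne_of_ne h; omega)]
  simp [this, Psi]

theorem G_mul_eq (k : Fin 3) (l l' : Fin 7) :
    G F φ K.C (7 * k + l) * G F φ K.C (7 * k + l') =
      (tab (K.gl k) l l').elim 0 fun t => (K.d : F) • G F φ K.C (7 * k + t) := by
  rw [G_mul K R hn φ hφ hm _ _ (by omega) (by omega)]
  have e1 : (7 * k.1 + l) / 7 = k := by omega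
  have e2 : (7 * k.1 + l) % 7 = l := by omega
  have e3 : (7 * k.1 + l') % 7 = l' := by omega
  have e4 : (7 * k.1 + l') / 7 = k := by omega
  have : ∀ U, tgt K.gl K.C (7 * k + l) (7 * k + l') U =
      (tab (K.gl k) l l').elim 0 fun t => ent K.C (7 * k + t) U := by
    intro U
    unfold tgt
    rw [e1, e2, e3, e4, if_pos rfl]
    simp
  simp only [this]
  cases tab (K.gl k) l l' with
  | none => simp [Psi]
  | some t => simp only [Option.elim_some, G, Psi_smul]

theorem G_glue (k : Fin 3) (h : K.gl k = true) : G F φ K.C (7 * k + 2) = G F φ K.C (7 * k + 3) :=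
  Psi_congr T R hn φ hφ fun U hU => by rw [K.hglue k h U (List.mem_range.2 hU)]

theorem ind_eq (J : ℕ) (hJ : J < 2 ^ n) : (K.d2 : F) • Psi F φ (fun U => (ind n J U : F)) =
    ∑ i ∈ Finset.range 21, (ent K.R J i : F) • G F φ K.C i := by
  unfold G
  rw [Psi_sum, Psi_smul]
  refine Psi_congr T R hn φ hφ fun U hU => ?_
  have h := eqm_cast (F := F) hm (allN_eq (allN_eq K.hgen J hJ) U hU)
  rw [dotL_eq _ _ 0 21 (Nat.le_of_ble_eq_true (allN_eq K.hlR J hJ))] at h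
  simp only [zero_add] at h
  have e : ((Int.mul (Int.ofNat K.d2) (ind n J U) : ℤ) : F) = (K.d2 : F) * (ind n J U : F) := by
    change (((K.d2 : ℤ) * ind n J U : ℤ) : F) = _
    push_cast
    rfl
  rw [e] at h
  rw [← h, Int.cast_sum]
  refine Finset.sum_congr rfl fun S _ => ?_
  change (((ent K.R J S) * ent K.C S U : ℤ) : F) = _
  push_cast
  rfl

end Main

theorem Psi_mem {F W : Type*} [Field F] [Group W] [Fintype W] {n : ℕ} {s : ℕ → W} (T : Tables n)
    (M : Mob n) (R : Rels n s) (hn : n ≤ 4) (φ : W →* Equiv.Perm (Fin 8))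
    (hφ : ∀ i, i < n → φ (s i) = sP i) (c : ℕ → F) :
    Psi F φ c = ∑ J ∈ Finset.range (2 ^ n), (∑ S ∈ Finset.range (2 ^ n), c S * (mob n S J : F)) •
      Psi F φ fun U => (ind n J U : F) := by
  rw [Psi_sum]
  refine Psi_congr T R hn φ hφ fun U hU => ?_
  simp only [Finset.sum_mul]
  rw [Finset.sum_comm]
  have h : ∀ S ∈ Finset.range (2 ^ n), ∑ J ∈ Finset.range (2 ^ n), c S * (mob n S J : F) * (ind n J U : F) =
      if S = U then c S else 0 := by
    intro S hS
    have h := eqm_cast (F := F) (by simp) (allN_eq (allN_eq M S (Finset.mem_range.1 hS)) U hU)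
    rw [sumN_eq, Int.cast_sum] at h
    simp only [mul_assoc]
    rw [← Finset.mul_sum]
    have e : ∑ J ∈ Finset.range (2 ^ n), (mob n S J : F) * (ind n J U : F) =
        ((if S = U then 1 else 0 : ℤ) : F) := by
      rw [← h]
      refine Finset.sum_congr rfl fun J _ => ?_
      change _ = ((mob n S J * ind n J U : ℤ) : F)
      push_cast
      rfl
    rw [e]
    split_ifs <;> simp
  rw [Finset.sum_congr rfl h]
  simp [hU]

end DescB

set_option maxHeartbeats 1000000
set_option synthInstance.maxHeartbeats 1000000
set_option linter.unusedSectionVars false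
namespace DescB

/-! ### The Coxeter group -/

section Cox

variable {W : Type*} [Group W] {n : ℕ} (cs : CoxeterSystem (BMat n) W)

/-- The simple reflections, indexed by natural numbers. -/
def sn (i : ℕ) : W := if h : i < n then cs.simple ⟨i, h⟩ else 1

theorem sn_eq {i : ℕ} (h : i < n) : sn cs i = cs.simple ⟨i, h⟩ := dif_pos h

theorem sn_sq {i : ℕ} (h : i < n) : sn cs i * sn cs i = 1 := by
  rw [sn_eq cs h, cs.simple_mul_simple_self]

theorem sn_pow {i j : ℕ} (hi : i < n) (hj : j < n) :
    (sn cs i * sn cs j) ^ (BMat n ⟨i, hi⟩ ⟨j, hj⟩) = 1 := by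
  rw [sn_eq cs hi, sn_eq cs hj, cs.simple_mul_simple_pow]

theorem BMat_apply {i j : ℕ} (hi : i < n) (hj : j < n) : BMat n ⟨i, hi⟩ ⟨j, hj⟩ =
    if i = j then 1
    else if min i j = 0 ∧ max i j = 1 then 4
    else if max i j = min i j + 1 then 3 else 2 := by
  change (if (⟨i, hi⟩ : Fin n) = ⟨j, hj⟩ then 1 else _) = _
  simp only [Fin.mk.injEq]

theorem rels : Rels n (sn cs) where
  sq i hi := sn_sq cs hi
  comm i j hi hj h := by
    have h1 := sn_pow cs hi hj
    rw [BMat_apply, if_neg (by omega), if_neg (by omega), if_neg (by omega), pow_two] at h1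
    have h2 := eq_inv_of_mul_eq_one_left h1
    rw [mul_inv_rev, inv_eq_of_mul_eq_one_left (sn_sq cs hi),
      inv_eq_of_mul_eq_one_left (sn_sq cs hj)] at h2
    exact h2
  br3 i j hi hj h0 h0' hij hf := by
    have h1 := sn_pow cs hi hj
    rw [BMat_apply, if_neg (by omega), if_neg (by omega), if_pos (by omega)] at h1
    have h2 : sn cs i * (sn cs j * sn cs i) * (sn cs j * (sn cs i * sn cs j)) = 1 := by
      rw [← h1, pow_succ, pow_two]
      simp only [mul_assoc]
    have h3 := eq_inv_of_mul_eq_one_left h2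
    rw [mul_inv_rev, mul_inv_rev, inv_eq_of_mul_eq_one_left (sn_sq cs hi),
      inv_eq_of_mul_eq_one_left (sn_sq cs hj), mul_assoc] at h3
    exact h3
  br4 i j hi hj h0 hij hf := by
    have h1 := sn_pow cs hi hj
    rw [BMat_apply, if_neg (by omega), if_pos (by omega)] at h1
    have h2 : sn cs i * (sn cs j * (sn cs i * sn cs j)) *
        (sn cs i * (sn cs j * (sn cs i * sn cs j))) = 1 := by
      rw [← h1, pow_succ, pow_succ, pow_two]
      simp only [mul_assoc]
    have h3 := eq_inv_of_mul_eq_one_left h2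
    rw [mul_inv_rev, mul_inv_rev, mul_inv_rev, inv_eq_of_mul_eq_one_left (sn_sq cs hi),
      inv_eq_of_mul_eq_one_left (sn_sq cs hj), mul_assoc, mul_assoc] at h3
    exact h3
  gen P h1 h w := by
    induction w using cs.simple_induction_right with
    | one => exact h1
    | mul_simple_right w i ih =>
      have := h w i i.2 ih
      rwa [sn_eq cs i.2] at this

theorem length_wp_le (ω : List ℕ) : cs.length (wp (sn cs) ω) ≤ ω.length := by
  induction ω with
  | nil => simp [wp]
  | cons i ω ih =>
    rw [wp_cons, List.length_cons]
    refine (cs.length_mul_le _ _).trans ?_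
    have : cs.length (sn cs i) ≤ 1 := by
      unfold sn
      split_ifs
      · rw [cs.length_simple]
      · simp
    omega

variable (T : Tables n) (hn : n ≤ 4) (φ : W →* Equiv.Perm (Fin 8))
  (hφ : ∀ i, i < n → φ (sn cs i) = sP i)
include T hn hφ

theorem length_eq (w : W) : cs.length w = len (vals (φ w)) := by
  apply le_antisymm
  · obtain ⟨ω, _, rfl, h3⟩ := len_le T (rels cs) hn φ hφ w
    rw [← h3]
    exact length_wp_le cs ω
  · obtain ⟨ω, h1, rfl⟩ := cs.exists_isReduced w
    rw [h1.eq]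
    clear h1
    induction ω using List.reverseRecOn with
    | nil => rw [cs.wordProd_nil, map_one]; exact le_refl 0
    | append_singleton ω i ih =>
      rw [cs.wordProd_append, cs.wordProd_singleton, List.length_append, List.length_singleton]
      have h := len_step T (rels cs) hn φ hφ (cs.wordProd ω) i i.2
      rw [sn_eq cs i.2] at h
      change _ ≤ ω.length + 1
      by_cases h0 : bitAt (desW φ (cs.wordProd ω)) i = 0
      · have := h.1 h0
        change len (vals (φ (cs.wordProd ω * cs.simple i))) = _ at this
        omega
      · have := h.2 h0
        change len (vals (φ (cs.wordProd ω * cs.simple i))) + 1 = _ at this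
        omega

theorem ascent_iff (w : W) (i : Fin n) :
    cs.length w < cs.length (w * cs.simple i) ↔ bitAt (desW φ w) i = 0 := by
  have h := len_step T (rels cs) hn φ hφ w i i.2
  rw [sn_eq cs i.2] at h
  change (_ → len (vals (φ (w * cs.simple i))) = _) ∧
    (_ → len (vals (φ (w * cs.simple i))) + 1 = _) at h
  rw [length_eq cs T hn φ hφ, length_eq cs T hn φ hφ]
  by_cases h0 : bitAt (desW φ w) i = 0
  · have := h.1 h0
    constructor <;> intro <;> omega
  · have := h.2 h0
    constructor <;> intro <;> omega

theorem descentElt_eq (F : Type*) [Field F] [Fintype W] (J : Set (Fin n)) (m : ℕ)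
    (h : ∀ i : Fin n, i ∈ J ↔ bitAt m i ≠ 0) :
    descentElt F cs J = Psi F φ fun U => (ind n m U : F) := by
  classical
  unfold descentElt Psi
  refine Finset.sum_congr rfl fun w _ => ?_
  have e : (∀ i ∈ J, cs.length w < cs.length (w * cs.simple i)) ↔
      ∀ i ∈ List.range n, bitAt m i = 0 ∨ bitAt (desW φ w) i = 0 := by
    simp only [ascent_iff cs T hn φ hφ]
    constructor
    · intro H i hi
      by_contra! hc
      exact hc.2 (H ⟨i, List.mem_range.1 hi⟩ ((h _).2 hc.1))
    · intro H i hi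
      exact (H i (List.mem_range.2 i.2)).resolve_left ((h i).1 hi)
  unfold ind
  beta_reduce
  by_cases h0 : ∀ i ∈ J, cs.length w < cs.length (w * cs.simple i)
  · rw [if_pos h0, if_pos (e.1 h0)]
    simp
  · rw [if_neg h0, if_neg (fun h' => h0 (e.2 h'))]
    simp

theorem exists_mask (J : Set (Fin n)) : ∃ m, m < 2 ^ n ∧ ∀ i : Fin n, i ∈ J ↔ bitAt m i ≠ 0 := by
  classical
  let f : ℕ → ℕ := fun k => if ∃ h : k < n, (⟨k, h⟩ : Fin n) ∈ J then 1 else 0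
  have hf : ∀ k, f k < 2 := by
    intro k
    simp only [f]
    split_ifs <;> norm_num
  refine ⟨_, pack_lt 2 f hf n, fun i => ?_⟩
  have h := pack_digit 2 (by norm_num) f hf n i i.2
  have e : bitAt (∑ k ∈ Finset.range n, f k * 2 ^ k) i = f i := by
    rw [← h]
    change ((∑ k ∈ Finset.range n, f k * 2 ^ k) >>> i.1) % 2 = _
    rw [Nat.shiftRight_eq_div_pow]
  rw [e]
  simp [f]

omit hn hφ T in
theorem one_eq (F : Type*) [Field F] [Fintype W] : descentElt F cs Set.univ = 1 := by
  classical
  unfold descentElt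
  rw [Finset.sum_eq_single 1]
  · rw [if_pos]
    · exact map_one _
    · intro i _
      simp
  · intro w _ hw
    rw [if_neg]
    intro h
    obtain ⟨i, hi⟩ := cs.exists_rightDescent_of_ne_one hw
    exact absurd (h i trivial) (not_lt.2 hi.le)
  · intro h
    exact absurd (Finset.mem_univ _) h

end Cox

section Final

variable {F W : Type*} [Field F] [Group W] [Fintype W] {n : ℕ} (cs : CoxeterSystem (BMat n) W)

theorem blockAlg {T : Tables n} (K : Cert n T) (M : Mob n) (hn : n ≤ 4)
    (φ : W →* Equiv.Perm (Fin 8)) (hφ : ∀ i, i < n → φ (sn cs i) = sP i)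
    (hm : (K.m : F) = 0) (hd : (K.d : F) ≠ 0) (hd2 : (K.d2 : F) ≠ 0) :
    ∃ g : Fin 3 → Fin 7 → descentAlgebra F cs, BlockAlg F (descentAlgebra F cs) K.gl g := by
  have R := rels cs
  have hmemx : ∀ J, Psi F φ (fun U => (ind n J U : F)) ∈ descentAlgebra F cs := by
    intro J
    rw [← descentElt_eq cs T hn φ hφ F {i | bitAt J i ≠ 0} J (fun i => Iff.rfl)]
    exact Algebra.subset_adjoin ⟨_, rfl⟩
  have hmem : ∀ i, G F φ K.C i ∈ descentAlgebra F cs := by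
    intro i
    unfold G
    rw [Psi_mem T M R hn φ hφ]
    exact Subalgebra.sum_mem _ fun J _ => Subalgebra.smul_mem _ (hmemx J) _
  let g : Fin 3 → Fin 7 → descentAlgebra F cs := fun k l =>
    (K.d : F)⁻¹ • ⟨G F φ K.C (7 * k + l), hmem _⟩
  have hgv : ∀ k l, ((g k l : descentAlgebra F cs) : MonoidAlgebra F W) =
    (K.d : F)⁻¹ • G F φ K.C (7 * k + l) := fun k l => rfl
  let Sp := Submodule.span F (Set.range fun x : Fin 3 × Fin 7 => g x.1 x.2)
  have hG : ∀ i, i < 21 → (⟨G F φ K.C i, hmem i⟩ : descentAlgebra F cs) ∈ Sp := by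
    intro i hi
    have : (⟨G F φ K.C i, hmem i⟩ : descentAlgebra F cs) =
        (K.d : F) • g ⟨i / 7, by omega⟩ ⟨i % 7, by omega⟩ := by
      simp only [g]
      rw [smul_smul, mul_inv_cancel₀ hd, one_smul]
      apply Subtype.ext
      simp only
      rw [Nat.div_add_mod]
    rw [this]
    exact Sp.smul_mem _ (Submodule.subset_span ⟨(_, _), rfl⟩)
  have hx : ∀ J : Set (Fin n), ∀ h, (⟨descentElt F cs J, h⟩ : descentAlgebra F cs) ∈ Sp := by
    intro J h
    obtain ⟨m, hm2, hmJ⟩ := exists_mask cs T hn φ hφ J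
    have e1 := descentElt_eq cs T hn φ hφ F J m hmJ
    have e2 := ind_eq K R hn φ hφ hm m hm2
    have e3 : (⟨descentElt F cs J, h⟩ : descentAlgebra F cs) =
        (K.d2 : F)⁻¹ • ∑ i ∈ Finset.range 21, (ent K.R m i : F) •
          (⟨G F φ K.C i, hmem i⟩ : descentAlgebra F cs) := by
      apply Subtype.ext
      simp only [Subalgebra.coe_smul, AddSubmonoidClass.coe_finsetSum]
      rw [← e2, smul_smul, inv_mul_cancel₀ hd2, one_smul, e1]
    rw [e3]
    exact Sp.smul_mem _ (Sp.sum_mem fun i hi => Sp.smul_mem _ (hG i (Finset.mem_range.1 hi)))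
  refine ⟨g, ?_, ?_, ?_, ?_, ?_⟩
  · intro k k' l l' h
    apply Subtype.ext
    change (K.d : F)⁻¹ • G F φ K.C (7 * k + l) * (K.d : F)⁻¹ • G F φ K.C (7 * k' + l') = 0
    rw [smul_mul_smul_comm, G_mul_ne K R hn φ hφ hm _ _ _ _ h, smul_zero]
  · intro k l l'
    apply Subtype.ext
    change (K.d : F)⁻¹ • G F φ K.C (7 * k + l) * (K.d : F)⁻¹ • G F φ K.C (7 * k + l') = _
    rw [smul_mul_smul_comm, G_mul_eq K R hn φ hφ hm]
    cases tab (K.gl k) l l' with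
    | none => simp
    | some t =>
      simp only [Option.elim_some]
      rw [hgv, smul_smul, mul_assoc, inv_mul_cancel₀ hd, mul_one]
  · intro k h
    apply Subtype.ext
    rw [hgv, hgv]
    change _ • G F φ K.C (7 * k + 2) = _ • G F φ K.C (7 * k + 3)
    rw [G_glue K R hn φ hφ hm k h]
  · have h1 := hx Set.univ (by rw [one_eq]; exact Subalgebra.one_mem _)
    have : (⟨descentElt F cs Set.univ, by rw [one_eq]; exact Subalgebra.one_mem _⟩ :
      descentAlgebra F cs) = 1 := Subtype.ext (one_eq cs F)
    rw [this] at h1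
    exact h1
  · rw [eq_top_iff]
    rintro ⟨x, hxm⟩ -
    have hx' : x ∈ Algebra.adjoin F (Set.range (descentElt F cs)) := hxm
    have hle : Algebra.adjoin F (Set.range (descentElt F cs)) ≤
        (Algebra.adjoin F (Set.range fun x : Fin 3 × Fin 7 => g x.1 x.2)).map
          (descentAlgebra F cs).val := by
      refine Algebra.adjoin_le ?_
      rintro _ ⟨J, rfl⟩
      refine ⟨⟨descentElt F cs J, Algebra.subset_adjoin ⟨J, rfl⟩⟩, ?_, rfl⟩
      exact Algebra.span_le_adjoin F _ (hx J _)
    obtain ⟨y, hy, hyx⟩ := hle hx'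
    have : y = ⟨x, hxm⟩ := Subtype.ext hyx
    rw [← this]
    exact hy

theorem liftable {n : ℕ} (hn : n ≤ 4) :
    CoxeterMatrix.IsLiftable (BMat n) (fun i : Fin n => sP i) := by
  intro i j
  obtain ⟨i, hi⟩ := i
  obtain ⟨j, hj⟩ := j
  rw [BMat_apply]
  have h : ∀ i < 4, ∀ j < 4, (sP i * sP j) ^ (if i = j then 1
    else if min i j = 0 ∧ max i j = 1 then 4
    else if max i j = min i j + 1 then 3 else 2) = 1 := by decide +kernel
  exact h i (by omega) j (by omega)

theorem exists_hom (hn : n ≤ 4) :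
    ∃ φ : W →* Equiv.Perm (Fin 8), ∀ i, i < n → φ (sn cs i) = sP i := by
  refine ⟨cs.lift ⟨_, liftable hn⟩, fun i hi => ?_⟩
  rw [sn_eq cs hi, cs.lift_apply_simple]

theorem finish {T : Tables n} (K : Cert n T) (M : Mob n) (hn : n ≤ 4)
    (hm : (K.m : F) = 0) (hd : (K.d : F) ≠ 0) (hd2 : (K.d2 : F) ≠ 0) :
    ∃ (N : ℕ) (Mod : Fin N → ModuleCat (descentAlgebra F cs)),
      ∀ (V : Type) [AddCommGroup V] [Module (descentAlgebra F cs) V]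
        [Module F V] [IsScalarTower F (descentAlgebra F cs) V] [FiniteDimensional F V],
        Nontrivial V →
        (∀ P Q : Submodule (descentAlgebra F cs) V, P ⊓ Q = ⊥ → P ⊔ Q = ⊤ → P = ⊥ ∨ Q = ⊥) →
        ∃ i, Nonempty (V ≃ₗ[descentAlgebra F cs] Mod i) := by
  obtain ⟨φ, hφ⟩ := exists_hom cs hn
  obtain ⟨g, H⟩ := blockAlg cs K M hn φ hφ hm hd hd2
  exact finite_type H

end Final

end DescB

/-- If `char F ≠ 2` and `2 ≤ n ≤ 4`, the descent algebra `D_F(B_n)` has finite representation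
type: there is a finite family of modules containing, up to isomorphism, every
finite-dimensional indecomposable module. -/
theorem stmt_16 (F : Type*) [Field F] (n : ℕ) (hn : 2 ≤ n) (hn4 : n ≤ 4)
    (W : Type*) [Group W] [Fintype W] (cs : CoxeterSystem (BMat n) W)
    (hchar : ringChar F ≠ 2)
    (D : Subalgebra F (MonoidAlgebra F W)) (hD : D = descentAlgebra F cs) :
    ∃ (N : ℕ) (Mod : Fin N → ModuleCat ↥D),
      ∀ (V : Type) [AddCommGroup V] [Module ↥D V]
        [Module F V] [IsScalarTower F ↥D V] [FiniteDimensional F V],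
        Nontrivial V →
        (∀ P Q : Submodule ↥D V, P ⊓ Q = ⊥ → P ⊔ Q = ⊤ → P = ⊥ ∨ Q = ⊥) →
        ∃ i, Nonempty (V ≃ₗ[↥D] Mod i) := by
  subst hD
  have h2 : (2 : F) ≠ 0 := Ring.two_ne_zero hchar
  obtain rfl | rfl | rfl : n = 2 ∨ n = 3 ∨ n = 4 := by omega
  · have h8 : ((8 : ℕ) : F) ≠ 0 := by
      rw [show (8 : ℕ) = 2 ^ 3 by norm_num, Nat.cast_pow]
      exact pow_ne_zero _ (by exact_mod_cast h2)
    exact DescB.finish cs DescB.cert20 DescB.mob2 hn4 Nat.cast_zero h8 h8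
  · by_cases h3 : (3 : F) = 0
    · exact DescB.finish cs DescB.cert33 DescB.mob3 hn4 (by exact_mod_cast h3)
        (by simp [DescB.cert33]) (by simp [DescB.cert33])
    · have h8 : ((48 : ℕ) : F) ≠ 0 := by
        rw [show (48 : ℕ) = 2 ^ 4 * 3 by norm_num, Nat.cast_mul, Nat.cast_pow]
        exact mul_ne_zero (pow_ne_zero _ (by exact_mod_cast h2)) (by exact_mod_cast h3)
      exact DescB.finish cs DescB.cert30 DescB.mob3 hn4 Nat.cast_zero h8 h8
  · by_cases h3 : (3 : F) = 0
    · exact DescB.finish cs DescB.cert43 DescB.mob4 hn4 (by exact_mod_cast h3)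
        (by simp [DescB.cert43]) (by simp [DescB.cert43])
    · have h8 : ((384 : ℕ) : F) ≠ 0 := by
        rw [show (384 : ℕ) = 2 ^ 7 * 3 by norm_num, Nat.cast_mul, Nat.cast_pow]
        exact mul_ne_zero (pow_ne_zero _ (by exact_mod_cast h2)) (by exact_mod_cast h3)
      exact DescB.finish cs DescB.cert40 DescB.mob4 hn4 Nat.cast_zero h8 h8
end

section
/- Suppose the characteristic of F is 2 and n = 3, and let D = D_F(B_3) with Jacobson radical J(D). Then J(D)², viewed as an F-subspace of F[W(B_3)], equals the F-span of the four elements {x_J : J ⊆ {0,1,2}, |J| ≤ 1} (namely x_∅, x_{{0}}, x_{{1}}, x_{{2}}); consequently the F-dimension of J(D)/J(D)² is exactly 3 (the Ext-quiver of D_F(B_3) is a single vertex with exactly three loops). -/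
set_option maxHeartbeats 1000000
set_option synthInstance.maxHeartbeats 1000000

/-- The dimension over `F` of the quotient `I/K` of two (left) ideals of an `F`-algebra. -/
noncomputable def subquotDim (F : Type*) [Field F] (R : Type*) [Ring R] [Algebra F R]
    (I K : Ideal R) : ℕ :=
  Module.finrank F
    ((I.restrictScalars F) ⧸ Submodule.comap (I.restrictScalars F).subtype (K.restrictScalars F))


namespace B3

/-- Packed tables for right multiplication by the three simple reflections on the 48 normal forms
`(a, y, x)` with index `a + 2 y + 8 x`. -/
def rtab : Fin 3 → ℕ := ![
  363240509118964411389227052634553599326934684433361528339862669392339295933105903517697,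
  355113288372948160875614712348156278778717348470159888696740848969034798898259331121346,
  307741463497716748328410203591847320547221558061931557912866011140243040911663427265096]

/-- Right multiplication by a simple reflection. -/
def R (s : Fin 3) (i : Fin 48) : Fin 48 := Fin.ofNat 48 ((rtab s >>> (6 * i.val)) % 64)

/-- Right descent set (as a bit mask) of the normal form with index `i`. -/
def des (i : ℕ) : ℕ := (21853503062099124974486927361669075837686920 >>> (3 * i)) % 8

/-- Descent masks of the quotients `i⁻¹ k`; entry `k` is packed over `i`. -/
def ddTab : List ℕ := [
  21858267021545250105583846443923609179693704,
  19457820687019498383490301958144276149638209,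
  16016823451043604543683698245103076625454098,
  15939409217183374165562568194177709063319698,
  19104618940070921594050182313623618987820617,
  19027204706210691215929052262698251425686217,
  15586206734406407151392983723277172636426906,
  13185760399880655429299439237497839606371411,
  9203482887842682807415072007298057690598188,
  6725622314842434916111305946020798421948773,
  9556684266219309769642443464543249720858916,
  9556684256990778187464260415398132367939876,
  6372419094263813532668209326483806232922989,
  6372419085035281950490026277338688880003949,
  9203482140154742141115361035430959076526892,
  6725621567154494249811594974153699807877477,
  15752109024953163910664855542242598855468434,
  15906937506516422040174390217811010009115794,
  3362815810049070417495082544631963502455990,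
  3207987323871546496896456344490993672349110,
  15906937505858667325326374443725484510096530,
  15752109019681143404727748243584514679989650,
  3207986955299596669683708157215528540792246,
  3362815436862854799193242832783939694439606,
  18937929761667768342342475439864421811540809,
  19092758243231026471852010115432832965188169,
  6548636178849479736807970029063846825990765,
  6393807692671955816209343828922876995883885,
  19092757874659076644639261928157367833631305,
  18937929388481552724040635728016398003524425,
  6393807692014201101361328054837351496864621,
  6548636173577459230870862730405762650511981,
  15575123631376128891724123298494661698102938,
  13097263058375881000420357237217402429453523,
  15928326113495341191045691995309672625976466,
  15928326104266809608867508946164555273057426,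
  12744060941539844954071457857250229138040539,
  12744060932311313371893274808105111785121499,
  15575122883688188225424412326627563084031642,
  13097262310687940334120646265350303815382227,
  9114984798649967712236279035150521899609004,
  6714538464124215990142734549371188869553509,
  3273540492319931925606666009950110080294198,
  3196126258459701547485535959024742518159798,
  6361335981347248975973150078470652442660717,
  6283921747487018597852020027545284880526317,
  2842924511511124758045416314504085356342206,
  442478176985373035951871828724752326286711]

/-- Descent mask of `i⁻¹ k`. -/
def dd (i k : ℕ) : ℕ := (ddTab.getD k 0 >>> (3 * i)) % 8

/-- Structure constants mod 2 of the descent algebra. -/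
def T (J K L : Fin 8) : ℕ :=
  (6717023150812729662589414044462416888300799236900878511648716678574797458685217831221529496204267489955979868268026537475108331469454613719780849335926784
    >>> (L.val + 8 * (K.val + 8 * J.val))) % 2

/-- Membership of a descent mask `d` in `X_J`. -/
def ok (d J : ℕ) : Bool := Nat.beq (Nat.land d J) 0

/-- Number of `i < n` with `i ∈ X_J` and `i⁻¹ k ∈ X_K`. -/
def cnt (J K k : ℕ) : ℕ → ℕ
  | 0 => 0
  | n + 1 => cnt J K k n + (bif ok (des n) J && ok (dd n k) K then 1 else 0)

/-- The part of the normal form in the parabolic of type `A_1`. -/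
def Aw : Fin 2 → List (Fin 3) := ![[], [0]]
/-- Coset representatives of `A_1` in `B_2`. -/
def Yw : Fin 4 → List (Fin 3) := ![[], [1], [1, 0], [1, 0, 1]]
/-- Coset representatives of `B_2` in `B_3`. -/
def Xw : Fin 6 → List (Fin 3) := ![[], [2], [2, 1], [2, 1, 0], [2, 1, 0, 1], [2, 1, 0, 1, 2]]

/-- Normal form word with index `i`. -/
def word (i : Fin 48) : List (Fin 3) :=
  Aw (Fin.ofNat 2 (i.val % 2)) ++ (Yw (Fin.ofNat 4 (i.val / 2 % 4)) ++ Xw (Fin.ofNat 6 (i.val / 8)))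

/-- The state reached from `i` by multiplying with a word on the right. -/
def run (i : Fin 48) (ω : List (Fin 3)) : Fin 48 := ω.foldl (fun k s => R s k) i

/-- Index of `i⁻¹ k`. -/
def dv (i k : Fin 48) : Fin 48 := run (run 0 (word i).reverse) (word k)

theorem dd_eq : ∀ i k : Fin 48, dd i.val k.val = des (dv i k).val := by decide +kernel

theorem run_word : ∀ i : Fin 48, run 0 (word i) = i := by decide +kernel

theorem len_step : ∀ (s : Fin 3) (i : Fin 48), (word (R s i)).length ≤ (word i).length + 1 := by
  decide +kernel

theorem des_spec : ∀ (J : Fin 8) (i : Fin 48), ok (des i.val) J.val = true ↔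
    ∀ s : Fin 3, Nat.testBit J.val s.val = true →
      (word i).length < (word (R s i)).length := by decide +kernel

theorem cnt_spec : ∀ (J K : Fin 8) (k : Fin 48), cnt J.val K.val k.val 48 % 2 =
    (∑ L : Fin 8, T J K L * (bif ok (des k.val) L.val then 1 else 0)) % 2 := by
  decide +kernel

theorem cnt_eq (J K k n : ℕ) : cnt J K k n =
    ∑ i ∈ Finset.range n, (bif ok (des i) J && ok (dd i k) K then 1 else 0) := by
  induction n with
  | zero => rfl
  | succ n ih => rw [Finset.sum_range_succ, ← ih]; rfl

/-- Decomposition of `x s` as an element of `B_2` times a representative. -/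
def xs : Fin 6 → Fin 3 → List (Fin 2) × Fin 6 :=
  ![![([0], 0), ([1], 0), ([], 1)],
    ![([0], 1), ([], 2), ([], 0)],
    ![([], 3), ([], 1), ([1], 2)],
    ![([], 2), ([], 4), ([1], 3)],
    ![([0], 4), ([], 3), ([], 5)],
    ![([0], 5), ([1], 5), ([], 4)]]

/-- Decomposition of `y s` as an element of `A_1` times a representative. -/
def ys : Fin 4 → Fin 2 → List (Fin 1) × Fin 4 :=
  ![![([0], 0), ([], 1)],
    ![([], 2), ([], 0)],
    ![([], 1), ([], 3)],
    ![([0], 3), ([], 2)]]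

/-- Inclusion of the generators of `B_2`. -/
def i2 (s : Fin 2) : Fin 3 := s.castSucc

/-- Index of a triple. -/
def enc (a : Fin 2) (y : Fin 4) (x : Fin 6) : Fin 48 := Fin.ofNat 48 (a.val + 2 * y.val + 8 * x.val)

theorem word_enc : ∀ a y x, word (enc a y x) = Aw a ++ (Yw y ++ Xw x) := by decide +kernel

theorem exists_enc : ∀ i, ∃ a y x, i = enc a y x := by decide +kernel

section group
variable {W : Type*} [Group W] (cs : CoxeterSystem (BMat 3) W)

theorem rel_ab : cs.simple 0 * (cs.simple 1 * (cs.simple 0 * cs.simple 1)) =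
    cs.simple 1 * (cs.simple 0 * (cs.simple 1 * cs.simple 0)) := by
  have h := cs.simple_mul_simple_pow 0 1
  have e : (BMat 3) 0 1 = 4 := by decide
  rw [e] at h
  have h' : (cs.simple 0 * (cs.simple 1 * (cs.simple 0 * cs.simple 1))) *
    (cs.simple 0 * (cs.simple 1 * (cs.simple 0 * cs.simple 1))) = 1 := by
    rw [← h]; simp only [pow_succ, pow_zero, one_mul, mul_assoc]
  rw [mul_eq_one_iff_eq_inv] at h'
  rw [h']; simp [mul_assoc]

theorem rel_bc : cs.simple 1 * (cs.simple 2 * cs.simple 1) =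
    cs.simple 2 * (cs.simple 1 * cs.simple 2) := by
  have h := cs.simple_mul_simple_pow 1 2
  have e : (BMat 3) 1 2 = 3 := by decide
  rw [e] at h
  have h' : (cs.simple 1 * (cs.simple 2 * cs.simple 1)) *
    (cs.simple 2 * (cs.simple 1 * cs.simple 2)) = 1 := by
    rw [← h]; simp only [pow_succ, pow_zero, one_mul, mul_assoc]
  rw [mul_eq_one_iff_eq_inv] at h'
  rw [h']; simp [mul_assoc]

theorem rel_ac : cs.simple 2 * cs.simple 0 = cs.simple 0 * cs.simple 2 := by
  have h := cs.simple_mul_simple_pow 2 0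
  have e : (BMat 3) 2 0 = 2 := by decide
  rw [e, pow_two, mul_eq_one_iff_eq_inv] at h
  rw [h]; simp

theorem rel_ac' (z : W) : cs.simple 2 * (cs.simple 0 * z) = cs.simple 0 * (cs.simple 2 * z) := by
  rw [← mul_assoc, rel_ac, mul_assoc]

theorem rel_bc' (z : W) : cs.simple 2 * (cs.simple 1 * (cs.simple 2 * z)) =
    cs.simple 1 * (cs.simple 2 * (cs.simple 1 * z)) := by
  have := congrArg (· * z) (rel_bc cs)
  simpa [mul_assoc] using this.symm

theorem ys_spec (y : Fin 4) (s : Fin 2) :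
    cs.wordProd (Yw y) * cs.simple (i2 s) =
      cs.wordProd ((ys y s).1.map (fun _ => 0)) * cs.wordProd (Yw (ys y s).2) := by
  have h1 := rel_ab cs
  fin_cases y <;> fin_cases s <;>
    simp [Yw, ys, i2, cs.wordProd_cons, mul_assoc]
  all_goals exact h1.symm

theorem xs_spec (x : Fin 6) (s : Fin 3) :
    cs.wordProd (Xw x) * cs.simple s =
      cs.wordProd ((xs x s).1.map i2) * cs.wordProd (Xw (xs x s).2) := by
  have h1 := rel_ab cs
  have h2 := rel_bc cs
  have h3 := rel_ac cs
  have h3' := rel_ac' cs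
  have h2' := rel_bc' cs
  have h4 : cs.simple 2 * (cs.simple 1 * (cs.simple 0 * (cs.simple 1 * cs.simple 0))) =
      cs.simple 0 * (cs.simple 2 * (cs.simple 1 * (cs.simple 0 * cs.simple 1))) := by
    rw [← h1, h3']
  fin_cases x <;> fin_cases s <;>
    simp [Xw, xs, i2, cs.wordProd_cons, mul_assoc]
  · exact h3
  · exact h2.symm
  · rw [← h3, h2']
  · exact h4
  · rw [h3, ← mul_assoc (cs.simple 1), ← mul_assoc (cs.simple 0), ← mul_assoc (cs.simple 2),
      ← mul_assoc (cs.simple 2)] 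
    have := congrArg (· * cs.simple 2) h4
    simpa [mul_assoc] using this
  · rw [h2, ← h3', h2']


theorem simple_eq (s : Fin 3) : cs.wordProd [s] = cs.simple s := by simp

/-- Right multiplication of an element of `A_1`. -/
def as (a : Fin 2) (l : List (Fin 1)) : Fin 2 := l.foldl (fun a _ => 1 - a) a

/-- Right multiplication of an element of `B_2`. -/
def bs (p : Fin 2 × Fin 4) (l : List (Fin 2)) : Fin 2 × Fin 4 :=
  l.foldl (fun p s => (as p.1 (ys p.2 s).1, (ys p.2 s).2)) p

theorem R_enc : ∀ a y x s, R s (enc a y x) =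
    enc (bs (a, y) (xs x s).1).1 (bs (a, y) (xs x s).1).2 (xs x s).2 := by decide +kernel

theorem as_spec (a : Fin 2) (l : List (Fin 1)) :
    cs.wordProd (Aw a) * cs.wordProd (l.map (fun _ => 0)) = cs.wordProd (Aw (as a l)) := by
  induction l generalizing a with
  | nil => simp [as]
  | cons s l ih =>
    have : cs.wordProd (Aw a) * cs.simple 0 = cs.wordProd (Aw (1 - a)) := by
      fin_cases a <;> simp [Aw]
    rw [List.map_cons, cs.wordProd_cons, ← mul_assoc, this, ih]
    rfl

theorem bs_spec (p : Fin 2 × Fin 4) (l : List (Fin 2)) :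
    cs.wordProd (Aw p.1) * cs.wordProd (Yw p.2) * cs.wordProd (l.map i2) =
      cs.wordProd (Aw (bs p l).1) * cs.wordProd (Yw (bs p l).2) := by
  induction l generalizing p with
  | nil => simp [bs]
  | cons s l ih =>
    rw [List.map_cons, cs.wordProd_cons, ← mul_assoc, mul_assoc (cs.wordProd (Aw p.1)), ys_spec,
      ← mul_assoc, as_spec]
    exact ih (as p.1 (ys p.2 s).1, (ys p.2 s).2)

/-- The group element with index `i`. -/
def nu (i : Fin 48) : W := cs.wordProd (word i)

theorem nu_mul_simple (i : Fin 48) (s : Fin 3) : nu cs i * cs.simple s = nu cs (R s i) := by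
  obtain ⟨a, y, x, rfl⟩ := exists_enc i
  rw [R_enc]
  unfold nu
  rw [word_enc, word_enc, cs.wordProd_append, cs.wordProd_append, cs.wordProd_append,
    cs.wordProd_append, mul_assoc, mul_assoc, xs_spec, ← mul_assoc, ← mul_assoc, bs_spec cs (a, y),
    mul_assoc]

theorem nu_mul_word (i : Fin 48) (ω : List (Fin 3)) :
    nu cs i * cs.wordProd ω = nu cs (run i ω) := by
  induction ω generalizing i with
  | nil => simp [run]
  | cons s l ih =>
    rw [cs.wordProd_cons, ← mul_assoc, nu_mul_simple, ih]
    rfl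

theorem nu_zero : nu cs 0 = 1 := by
  have : word 0 = [] := by decide
  simp [nu, this]

theorem word_eq_nu (ω : List (Fin 3)) : cs.wordProd ω = nu cs (run 0 ω) := by
  rw [← nu_mul_word, nu_zero, one_mul]

theorem nu_inv_mul (i k : Fin 48) : (nu cs i)⁻¹ * nu cs k = nu cs (dv i k) := by
  unfold dv
  rw [← nu_mul_word, ← word_eq_nu, cs.wordProd_reverse]
  rfl

theorem liftable : (BMat 3).IsLiftable (G := Function.End (Fin 48)) (fun s => R s) := by
  have key : ∀ (s t : Fin 3) (i : Fin 48), (fun k => R s (R t k))^[BMat 3 s t] i = i := by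
    decide +kernel
  intro s t
  funext i
  have : ∀ (n : ℕ) (f : Function.End (Fin 48)) (i : Fin 48), (f ^ n) i = f^[n] i := by
    intro n f
    induction n with
    | zero => intro i; rfl
    | succ n ih => intro i; exact ih (f i)
  rw [this]
  exact key s t i

theorem run_eq (ω : List (Fin 3)) (i : Fin 48) :
    cs.lift ⟨_, liftable⟩ (cs.wordProd ω.reverse) i = run i ω := by
  induction ω generalizing i with
  | nil => rw [List.reverse_nil, cs.wordProd_nil, map_one]; rfl
  | cons s l ih =>
    rw [List.reverse_cons, cs.wordProd_append, cs.wordProd_singleton, map_mul,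
      cs.lift_apply_simple liftable]
    exact ih (R s i)

theorem run_congr {ω ω' : List (Fin 3)} (h : cs.wordProd ω = cs.wordProd ω') :
    run 0 ω = run 0 ω' := by
  rw [← run_eq cs, ← run_eq cs, cs.wordProd_reverse, cs.wordProd_reverse, h]

theorem nu_bij : Function.Bijective (nu cs) := by
  constructor
  · intro i j h
    have := run_congr cs h
    rwa [run_word, run_word] at this
  · intro w
    obtain ⟨ω, rfl⟩ := cs.wordProd_surjective w
    exact ⟨_, (word_eq_nu cs ω).symm⟩

theorem run_len (i : Fin 48) (ω : List (Fin 3)) :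
    (word (run i ω)).length ≤ (word i).length + ω.length := by
  induction ω generalizing i with
  | nil => simp [run]
  | cons s l ih =>
    have h1 := ih (R s i)
    have h2 := len_step s i
    simp only [List.length_cons]
    change (word (run (R s i) l)).length ≤ _
    omega

theorem length_nu (i : Fin 48) : cs.length (nu cs i) = (word i).length := by
  apply le_antisymm
  · exact cs.length_wordProd_le _
  · obtain ⟨ω, h, e⟩ := cs.exists_isReduced (nu cs i)
    have h1 := run_congr cs e
    rw [run_word] at h1
    have h2 := run_len 0 ω
    rw [← h1] at h2
    have h3 : (word 0).length = 0 := by decide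
    rw [e, h.eq]
    omega

/-- The subset of simple reflections with bit mask `J`. -/
def S (J : Fin 8) : Set (Fin 3) := {s | Nat.testBit J.val s.val = true}

theorem S_surj (A : Set (Fin 3)) : ∃ J, A = S J := by
  classical
  have : ∀ B : Finset (Fin 3), ∃ J : Fin 8, ∀ s, s ∈ B ↔ Nat.testBit J.val s.val = true := by
    decide +kernel
  obtain ⟨J, hJ⟩ := this A.toFinset
  exact ⟨J, Set.ext fun s => by simpa [S] using hJ s⟩

theorem S_0 : S 0 = ∅ := by ext s; fin_cases s <;> simp [S]
theorem S_1 : S 1 = {0} := by ext s; fin_cases s <;> simp [S, Nat.testBit]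
theorem S_2 : S 2 = {1} := by ext s; fin_cases s <;> simp [S, Nat.testBit]
theorem S_4 : S 4 = {2} := by ext s; fin_cases s <;> simp [S, Nat.testBit]

variable [Fintype W] (F : Type*) [Field F]

theorem coeff_x (J : Fin 8) (k : Fin 48) :
    (descentElt F cs (S J)).coeff (nu cs k) = if ok (des k.val) J.val = true then 1 else 0 := by
  classical
  have : (∀ i ∈ S J, cs.length (nu cs k) < cs.length (nu cs k * cs.simple i)) ↔
      ok (des k.val) J.val = true := by
    rw [des_spec]
    simp only [nu_mul_simple, length_nu]
    rfl
  simp only [← this]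
  unfold descentElt
  rw [MonoidAlgebra.coeff_sum, Finsupp.finsetSum_apply, Finset.sum_eq_single (nu cs k)]
  · split_ifs <;> simp
  · intro b _ hb
    split_ifs <;> simp [hb]
  · simp

theorem coeff_mul (a b : MonoidAlgebra F W) (k : Fin 48) :
    (a * b).coeff (nu cs k) = ∑ i, a.coeff (nu cs i) * b.coeff (nu cs (dv i k)) := by
  classical
  rw [MonoidAlgebra.coeff_mul_apply_left, Finsupp.sum_fintype _ _ (by simp),
    ← (Equiv.ofBijective _ (nu_bij cs)).sum_comp]
  simp [nu_inv_mul]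

theorem ext_nu {a b : MonoidAlgebra F W} (h : ∀ k, a.coeff (nu cs k) = b.coeff (nu cs k)) :
    a = b := by
  ext w
  obtain ⟨k, rfl⟩ := (nu_bij cs).2 w
  exact h k

theorem x_mul [CharP F 2] (J K : Fin 8) : descentElt F cs (S J) * descentElt F cs (S K) =
    ∑ L, (T J K L : F) • descentElt F cs (S L) := by
  apply ext_nu cs
  intro k
  rw [coeff_mul, MonoidAlgebra.coeff_sum, Finsupp.finsetSum_apply]
  simp only [MonoidAlgebra.coeff_smul_apply, coeff_x, smul_eq_mul]
  have h := (CharP.natCast_eq_natCast F 2).2 (cnt_spec J K k)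
  rw [cnt_eq, Finset.sum_range] at h
  push_cast at h
  convert h using 2 with i _ i _
  · rw [dd_eq]
    cases ok (des i.val) J.val <;> cases ok (des (dv i k).val) K.val <;> simp
  · cases ok (des k.val) i.val <;> simp

theorem x_seven : descentElt F cs (S 7) = 1 := by
  apply ext_nu cs
  intro k
  have : ∀ k : Fin 48, ok (des k.val) 7 = true ↔ k = 0 := by decide +kernel
  have h0 : (1 : W) = nu cs 0 ∧ ((1 : W) = nu cs k ↔ k = 0) := by
    refine ⟨(nu_zero cs).symm, ?_⟩
    rw [← nu_zero cs, (nu_bij cs).1.eq_iff]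
    exact eq_comm
  classical
  have h1 : ((1 : MonoidAlgebra F W)).coeff (nu cs k) = if (1 : W) = nu cs k then 1 else 0 := by
    rw [MonoidAlgebra.one_def, MonoidAlgebra.coeff_single, Finsupp.single_apply]
  rw [coeff_x, h1]
  simp only [h0.2]
  exact if_congr (this k) rfl rfl

/-- Index of an element with descent set exactly the complement of `J`. -/
def rep : Fin 8 → Fin 48 := ![47, 18, 9, 8, 7, 2, 1, 0]

theorem x_li : LinearIndependent F (fun J => descentElt F cs (S J)) := by
  rw [Fintype.linearIndependent_iff]
  intro g hg
  have h : ∀ k : Fin 48, ∑ J : Fin 8, g J * (if ok (des k.val) J.val = true then 1 else 0) = 0 := by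
    intro k
    have := congrArg (fun a => a.coeff (nu cs k)) hg
    simpa [MonoidAlgebra.coeff_sum, Finsupp.finsetSum_apply, coeff_x] using this
  have key : ∀ J L : Fin 8, ok (des (rep J).val) L.val = decide (Nat.land L.val J.val = L.val) := by
    decide +kernel
  have h' : ∀ J : Fin 8, ∑ L : Fin 8, g L * (if Nat.land L.val J.val = L.val then 1 else 0) = 0 := by
    intro J
    have := h (rep J)
    simpa [key] using this
  have lt : ∀ J L : Fin 8, Nat.land L.val J.val = L.val → L ≠ J → L < J := by decide +kernel
  have self : ∀ J : Fin 8, Nat.land J.val J.val = J.val := by decide +kernel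
  intro J
  induction J using WellFoundedLT.induction with
  | ind J ih =>
    have := h' J
    rw [Finset.sum_eq_single J] at this
    · simpa [self] using this
    · intro L _ hne
      split_ifs with hL
      · rw [ih L (lt J L hL hne), zero_mul]
      · rw [mul_zero]
    · simp

end group

section alg
variable {F A : Type*} [Field F] [Ring A] [Algebra F A]

theorem adjoin_eq_span (x : Fin 8 → A) (t : Fin 8 → Fin 8 → Fin 8 → F)
    (hx : ∀ J K, x J * x K = ∑ L, t J K L • x L) (h1 : x 7 = 1) :
    Subalgebra.toSubmodule (Algebra.adjoin F (Set.range x)) = Submodule.span F (Set.range x) := by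
  apply le_antisymm
  · intro a ha
    change a ∈ Algebra.adjoin F (Set.range x) at ha
    induction ha using Algebra.adjoin_induction with
    | mem a ha => exact Submodule.subset_span ha
    | algebraMap r =>
      rw [Algebra.algebraMap_eq_smul_one, ← h1]
      exact Submodule.smul_mem _ _ (Submodule.subset_span ⟨7, rfl⟩)
    | add a b _ _ ha hb => exact Submodule.add_mem _ ha hb
    | mul a b _ _ ha hb =>
      have := Submodule.mul_mem_mul ha hb
      rw [Submodule.span_mul_span] at this
      refine Submodule.span_le.2 ?_ this
      rintro _ ⟨_, ⟨J, rfl⟩, _, ⟨K, rfl⟩, rfl⟩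
      change x J * x K ∈ Submodule.span F (Set.range x)
      rw [hx]
      exact Submodule.sum_mem _ fun L _ =>
        Submodule.smul_mem _ _ (Submodule.subset_span ⟨L, rfl⟩)
  · exact Submodule.span_le.2 Algebra.subset_adjoin

/-- Coordinates of a product. -/
theorem repr_mul {R : Type*} [Ring R] [Algebra F R] (b : Module.Basis (Fin 8) F R)
    (t : Fin 8 → Fin 8 → Fin 8 → F) (hb : ∀ J K, b J * b K = ∑ L, t J K L • b L) (d e : R)
    (L : Fin 8) : b.repr (d * e) L = ∑ i, ∑ j, b.repr d i * b.repr e j * t i j L := by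
  conv_lhs => rw [← b.sum_repr d, ← b.sum_repr e]
  simp only [Finset.sum_mul_sum, map_sum, Finsupp.finsetSum_apply, smul_mul_smul_comm, map_smul, hb,
    Finsupp.smul_apply, Module.Basis.repr_self, smul_eq_mul]
  simp [Finsupp.single_apply]

/-- The final computation. -/
theorem final {R : Type*} [Ring R] [Algebra F R] (b : Module.Basis (Fin 8) F R)
    (hb : ∀ J K, b J * b K = ∑ L, (T J K L : F) • b L) (h1 : b 7 = 1)
    (Jac : Ideal R) (hJac : Jac = (⊥ : Ideal R).jacobson) :
    (∀ d, d ∈ Jac • Jac ↔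
      b.repr d 3 = 0 ∧ b.repr d 5 = 0 ∧ b.repr d 6 = 0 ∧ b.repr d 7 = 0) ∧
    subquotDim F R Jac (Jac • Jac) = 3 := by
  have hm := repr_mul b _ hb
  have m7 : ∀ d e, b.repr (d * e) 7 = b.repr d 7 * b.repr e 7 := by
    intro d e
    have : ∀ i j, T i j 7 = if i = 7 ∧ j = 7 then 1 else 0 := by decide +kernel
    rw [hm]
    simp [this, Fin.sum_univ_eight]
  have one7 : b.repr 1 7 = 1 := by rw [← h1]; simp
  have mI : ∀ d e, b.repr d 7 = 0 → b.repr e 7 = 0 →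
      b.repr (d * e) 3 = 0 ∧ b.repr (d * e) 5 = 0 ∧ b.repr (d * e) 6 = 0 ∧
        b.repr (d * e) 7 = 0 := by
    intro d e hd he
    have : ∀ L ∈ ({3, 5, 6, 7} : Finset (Fin 8)), ∀ i j, i = 7 ∨ j = 7 ∨ T i j L = 0 := by
      decide +kernel
    have h : ∀ L ∈ ({3, 5, 6, 7} : Finset (Fin 8)), b.repr (d * e) L = 0 := by
      intro L hL
      rw [hm]
      refine Finset.sum_eq_zero fun i _ => Finset.sum_eq_zero fun j _ => ?_
      rcases this L hL i j with rfl | rfl | h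
      · simp [hd]
      · simp [he]
      · simp [h]
    exact ⟨h 3 (by simp), h 5 (by simp), h 6 (by simp), h 7 (by simp)⟩
  have mS : ∀ d e, (b.repr d 3 = 0 ∧ b.repr d 5 = 0 ∧ b.repr d 6 = 0 ∧ b.repr d 7 = 0) →
      (b.repr e 3 = 0 ∧ b.repr e 5 = 0 ∧ b.repr e 6 = 0 ∧ b.repr e 7 = 0) → d * e = 0 := by
    rintro d e ⟨d3, d5, d6, d7⟩ ⟨e3, e5, e6, e7⟩
    have : ∀ L i j, (i = 3 ∨ i = 5 ∨ i = 6 ∨ i = 7) ∨ (j = 3 ∨ j = 5 ∨ j = 6 ∨ j = 7) ∨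
        T i j L = 0 := by
      decide +kernel
    apply b.repr.injective
    ext L
    rw [hm, map_zero, Finsupp.zero_apply]
    refine Finset.sum_eq_zero fun i _ => Finset.sum_eq_zero fun j _ => ?_
    rcases this L i j with (rfl | rfl | rfl | rfl) | (rfl | rfl | rfl | rfl) | h
    all_goals simp [*]
  have jac : ∀ d, d ∈ Jac ↔ b.repr d 7 = 0 := by
    intro d
    rw [hJac, Ideal.mem_jacobson_iff]
    constructor
    · intro h
      by_contra hne
      obtain ⟨z, hz⟩ := h (-(b.repr d 7)⁻¹ • 1)
      rw [Ideal.mem_bot] at hz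
      have := congrArg (fun a => b.repr a 7) hz
      simp only [map_add, map_sub, Finsupp.add_apply, Finsupp.sub_apply, m7, map_smul,
        Finsupp.smul_apply, one7, map_zero, Finsupp.zero_apply, smul_eq_mul] at this
      field_simp at this
      simp at this
    · intro hd y
      have hp : b.repr (y * d) 7 = 0 := by rw [m7, hd, mul_zero]
      set p := y * d with hpd
      have h2 := mI p p hp hp
      have h4 : p * p * (p * p) = 0 := mS _ _ h2 h2
      refine ⟨1 - p + p * p - p * p * p, ?_⟩
      rw [Ideal.mem_bot, mul_assoc, ← hpd]
      have : (1 - p + p * p - p * p * p) * p + (1 - p + p * p - p * p * p) - 1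
        = - (p * p * (p * p)) := by noncomm_ring
      rw [this, h4, neg_zero]
  have bJ : ∀ i : Fin 8, i ≠ 7 → b i ∈ Jac := by
    intro i hi
    rw [jac]
    simp [hi]
  have hsm : ∀ (I : Ideal R) (r : F) (a : R), a ∈ I → r • a ∈ I := by
    intro I r a ha
    rw [← one_mul a, ← smul_mul_assoc]
    exact I.mul_mem_left _ ha
  have sq : ∀ d, d ∈ Jac • Jac ↔
      b.repr d 3 = 0 ∧ b.repr d 5 = 0 ∧ b.repr d 6 = 0 ∧ b.repr d 7 = 0 := by
    intro d
    constructor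
    · intro h
      refine Submodule.smul_induction_on h ?_ ?_
      · intro r hr n hn
        exact mI _ _ ((jac _).1 hr) ((jac _).1 hn)
      · rintro x y ⟨x3, x5, x6, x7⟩ ⟨y3, y5, y6, y7⟩
        simp [*]
    · rintro ⟨d3, d5, d6, d7⟩
      have g : ∀ i j : Fin 8, i ≠ 7 → j ≠ 7 → b i * b j ∈ Jac • Jac := fun i j hi hj =>
        Submodule.smul_mem_smul (bJ i hi) (bJ j hj)
      have t13 : ∀ L, T 1 3 L = if L = 0 then 1 else 0 := by decide +kernel
      have t33 : ∀ L, T 3 3 L = if L = 1 then 1 else 0 := by decide +kernel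
      have t53 : ∀ L, T 5 3 L = if L = 2 then 1 else 0 := by decide +kernel
      have t35 : ∀ L, T 3 5 L = if L = 4 then 1 else 0 := by decide +kernel
      have b0 : b 0 ∈ Jac • Jac := by
        have := g 1 3 (by decide) (by decide)
        rw [hb] at this
        simpa [t13] using this
      have b1 : b 1 ∈ Jac • Jac := by
        have := g 3 3 (by decide) (by decide)
        rw [hb] at this
        simpa [t33] using this
      have b2 : b 2 ∈ Jac • Jac := by
        have := g 5 3 (by decide) (by decide)
        rw [hb] at this
        simpa [t53] using this
      have b4 : b 4 ∈ Jac • Jac := by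
        have := g 3 5 (by decide) (by decide)
        rw [hb] at this
        simpa [t35] using this
      rw [← b.sum_repr d]
      simp only [Fin.sum_univ_eight, d3, d5, d6, d7, zero_smul, add_zero]
      exact add_mem (add_mem (add_mem (hsm _ _ _ b0) (hsm _ _ _ b1)) (hsm _ _ _ b2))
        (hsm _ _ _ b4)
  refine ⟨sq, ?_⟩
  unfold subquotDim
  let f : (Jac.restrictScalars F) →ₗ[F] (Fin 3 → F) :=
    (LinearMap.pi ![b.coord 3, b.coord 5, b.coord 6]) ∘ₗ (Jac.restrictScalars F).subtype
  have hker : Submodule.comap (Jac.restrictScalars F).subtype ((Jac • Jac).restrictScalars F) =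
      LinearMap.ker f := by
    ext ⟨d, hd⟩
    have hd' := (jac d).1 hd
    rw [Submodule.mem_comap, LinearMap.mem_ker]
    change d ∈ Jac • Jac ↔ _
    rw [sq, funext_iff, Fin.forall_fin_succ, Fin.forall_fin_succ, Fin.forall_fin_succ]
    simp [f, hd']
  have hsurj : Function.Surjective f := by
    intro v
    refine ⟨⟨v 0 • b 3 + v 1 • b 5 + v 2 • b 6, ?_⟩, ?_⟩
    · change _ ∈ Jac
      exact add_mem (add_mem (hsm _ _ _ (bJ _ (by decide))) (hsm _ _ _ (bJ _ (by decide))))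
        (hsm _ _ _ (bJ _ (by decide)))
    · ext i
      fin_cases i <;> simp [f]
  rw [hker, (f.quotKerEquivOfSurjective hsurj).finrank_eq]
  simp

end alg
end B3
/-- If `char F = 2`, the square of the Jacobson radical of the descent algebra `D = D_F(B_3)`,
viewed as an `F`-subspace of the group algebra, is the span of the four elements `x_J` with
`|J| ≤ 1`, and `dim_F J(D)/J(D)² = 3`: the Ext-quiver of `D_F(B_3)` is a single vertex with
exactly three loops. -/
theorem stmt_19 (F : Type*) [Field F] (hchar : ringChar F = 2)
    (W : Type*) [Group W] [Fintype W] (cs : CoxeterSystem (BMat 3) W)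
    (D : Subalgebra F (MonoidAlgebra F W)) (hD : D = descentAlgebra F cs)
    (Jac : Ideal ↥D) (hJac : Jac = (⊥ : Ideal ↥D).jacobson) :
    Submodule.map D.val.toLinearMap ((Jac • Jac : Ideal ↥D).restrictScalars F) =
      Submodule.span F
        {descentElt F cs (∅ : Set (Fin 3)), descentElt F cs ({0} : Set (Fin 3)),
          descentElt F cs ({1} : Set (Fin 3)), descentElt F cs ({2} : Set (Fin 3))} ∧
    subquotDim F ↥D Jac (Jac • Jac) = 3 := by
  have : CharP F 2 := ringChar.of_eq hchar
  set x : Fin 8 → MonoidAlgebra F W := fun J => descentElt F cs (B3.S J) with hx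
  have hrange : Set.range (descentElt F cs) = Set.range x := by
    ext a
    constructor
    · rintro ⟨A, rfl⟩
      obtain ⟨J, rfl⟩ := B3.S_surj A
      exact ⟨J, rfl⟩
    · rintro ⟨J, rfl⟩
      exact ⟨_, rfl⟩
  have hspan : Subalgebra.toSubmodule D = Submodule.span F (Set.range x) := by
    rw [hD, descentAlgebra, hrange]
    exact B3.adjoin_eq_span x _ (B3.x_mul cs F) (B3.x_seven cs F)
  let e : Submodule.span F (Set.range x) ≃ₗ[F] D := LinearEquiv.ofEq _ _ hspan.symm
  let b : Module.Basis (Fin 8) F D := (Module.Basis.span (B3.x_li cs F)).map e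
  have hbx : ∀ J, (b J : MonoidAlgebra F W) = x J := by
    intro J
    change ((Module.Basis.span (B3.x_li cs F) J : Submodule.span F (Set.range x)) :
      MonoidAlgebra F W) = x J
    rw [Module.Basis.span_apply]
  have hb : ∀ J K, b J * b K = ∑ L, (B3.T J K L : F) • b L := by
    intro J K
    apply Subtype.ext
    have := B3.x_mul cs F J K
    simpa [hbx] using this
  have h1 : b 7 = 1 := by
    apply Subtype.ext
    rw [hbx]
    exact B3.x_seven cs F
  obtain ⟨sq, hdim⟩ := B3.final b hb h1 Jac hJac
  refine ⟨?_, hdim⟩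
  rw [← B3.S_0, ← B3.S_1, ← B3.S_2, ← B3.S_4]
  change _ = Submodule.span F {x 0, x 1, x 2, x 4}
  apply le_antisymm
  · rintro _ ⟨d, hd, rfl⟩
    obtain ⟨d3, d5, d6, d7⟩ := (sq d).1 hd
    rw [← b.sum_repr d]
    simp only [Fin.sum_univ_eight, d3, d5, d6, d7, zero_smul, add_zero, map_add, map_smul]
    change b.repr d 0 • (b 0 : MonoidAlgebra F W) + b.repr d 1 • (b 1 : MonoidAlgebra F W) +
      b.repr d 2 • (b 2 : MonoidAlgebra F W) + b.repr d 4 • (b 4 : MonoidAlgebra F W) ∈ _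
    simp only [hbx]
    refine add_mem (add_mem (add_mem ?_ ?_) ?_) ?_ <;>
      exact Submodule.smul_mem _ _ (Submodule.subset_span (by simp))
  · have hmem : ∀ J : Fin 8, J ≠ 3 → J ≠ 5 → J ≠ 6 → J ≠ 7 → x J ∈ Submodule.map
        D.val.toLinearMap ((Jac • Jac : Ideal ↥D).restrictScalars F) := by
      intro J h3 h5 h6 h7
      refine ⟨b J, (sq _).2 ?_, hbx J⟩
      simp [h3, h5, h6, h7]
    rw [Submodule.span_le]
    rintro _ (rfl | rfl | rfl | rfl) <;> exact hmem _ (by decide) (by decide) (by decide) (by decide)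
end
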